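/- (ε-regularity criterion) Let c₀ > 0 and let f : [0,T]×ℝ³ → [0,∞) be a smooth, rapidly decaying solution of the Landau–Coulomb equation satisfying the normalization (N) and A[f](t,v) ≥ c₀⟨v⟩^{−3} Id (as symmetric matrices) for all (t,v). Then there is a constant ε₀ > 0, depending only on c₀, with the following property: if for some threshold K ≥ 0 the quantity ε(f) := sup_{0<τ<T} ∫_{ℝ³} ⟨v⟩^{9/2} (f(τ)−K)₊^{3/2} dv + ∫_0^T ∫_{ℝ³} ⟨v⟩^{3/2} |∇_v (f−K)₊^{3/4}|² dv dτ satisfies ε(f) < ε₀, then for every 0 < t ≤ T one has f(τ,v) ≤ C*(K + 1) + C* ε(f)^{2/3} t^{−1} for all (τ,v) ∈ [t,T]×ℝ³, where C* > 0 depends only on c₀. -/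

import Mathlib

open MeasureTheory Real
noncomputable section

/-- Velocity space `ℝ³`. -/
abbrev V3 : Type := EuclideanSpace ℝ (Fin 3)

/-- Japanese bracket `⟨v⟩ = (1 + |v|²)^{1/2}`. -/
def jap (v : V3) : ℝ := Real.sqrt (1 + ‖v‖ ^ 2)

/-- Positive part `x₊ = max(x,0)`. -/
def plus (x : ℝ) : ℝ := max x 0

/-- Partial derivative in the `i`-th coordinate direction. -/
def pd (i : Fin 3) (F : V3 → ℝ) (v : V3) : ℝ :=
  fderiv ℝ F v (EuclideanSpace.single i 1)

/-- The Landau-Coulomb diffusion matrix `A[g]`. -/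
def Amat (g : V3 → ℝ) (v : V3) : Matrix (Fin 3) (Fin 3) ℝ := fun i j =>
  ∫ w : V3, g w * (((if i = j then (1 : ℝ) else 0) -
      (v - w) i * (v - w) j / ‖v - w‖ ^ 2) / (8 * π * ‖v - w‖))

/-- The Coulomb potential `a[g]`. -/
def apot (g : V3 → ℝ) (v : V3) : ℝ := ∫ w : V3, g w / (4 * π * ‖v - w‖)

/-- Right-hand side `∇·(A[g]∇g − ∇a[g] g)` of the Landau equation. -/
def landauRHS (g : V3 → ℝ) (v : V3) : ℝ :=
  ∑ i : Fin 3, pd i (fun u =>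
    (∑ j : Fin 3, Amat g u i j * pd j g u) - pd i (apot g) u * g u) v

/-- `f` solves the Landau equation pointwise at every time in `s`. -/
def SolvesLandauOn (s : Set ℝ) (f : ℝ → V3 → ℝ) : Prop :=
  ∀ t ∈ s, ∀ v : V3, HasDerivAt (fun τ => f τ v) (landauRHS (f t) v) t

/-- A smooth, rapidly decaying (Schwartz-class in `v`) nonnegative solution on the
time set `s`, solving the equation pointwise on the interior of `s`. -/
structure SmoothRapidSolutionOn (s : Set ℝ) (f : ℝ → V3 → ℝ) : Prop where
  nonneg : ∀ t ∈ s, ∀ v : V3, 0 ≤ f t v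
  smooth : ContDiffOn ℝ (⊤ : ℕ∞) (fun q : ℝ × V3 => f q.1 q.2) (s ×ˢ (Set.univ : Set V3))
  schwartz : ∀ t ∈ s, ∃ φ : SchwartzMap V3 ℝ, ∀ v, f t v = φ v
  solves : SolvesLandauOn (interior s) f

/-- Normalization: unit mass, zero mean velocity, temperature `3`. -/
def Normalized (g : V3 → ℝ) : Prop :=
  (∫ v : V3, g v) = 1 ∧ (∀ i : Fin 3, (∫ v : V3, v i * g v) = 0) ∧
    (∫ v : V3, ‖v‖ ^ 2 * g v) = 3

/-- `c • Id ≤ M` as quadratic forms. -/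
def matGE (c : ℝ) (M : Matrix (Fin 3) (Fin 3) ℝ) : Prop :=
  ∀ ξ : Fin 3 → ℝ, c * ∑ i, ξ i ^ 2 ≤ ∑ i, ∑ j, M i j * ξ i * ξ j

/-- `M ≤ c • Id` as quadratic forms. -/
def matLE (M : Matrix (Fin 3) (Fin 3) ℝ) (c : ℝ) : Prop :=
  ∀ ξ : Fin 3 → ℝ, (∑ i, ∑ j, M i j * ξ i * ξ j) ≤ c * ∑ i, ξ i ^ 2

/-- `‖A[g]‖_{L^∞}`: sup over `v` of the operator norm of `A[g](v)`. -/
def AinfNorm (g : V3 → ℝ) : ℝ :=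
  ⨆ v : V3, ‖Matrix.toEuclideanCLM (𝕜 := ℝ) (Amat g v)‖

/-- Fisher information (with the convention `x/0 = 0`). -/
def fisher (g : V3 → ℝ) : ℝ := ∫ v : V3, ‖gradient g v‖ ^ 2 / g v


/-! ### Elementary kernel integrability -/

theorem er_kint_ball (r : ℝ) : IntegrableOn (fun z : V3 => (‖z‖ ^ 2)⁻¹) (Metric.ball 0 r) := by
  have := (integrableOn_fun_norm_addHaar (volume : Measure V3) (f := fun y : ℝ => (y ^ 2)⁻¹) (r := r))
  rw [this]
  have h1 : IntegrableOn (fun _ : ℝ => (1 : ℝ)) (Set.Ioo 0 r) := by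
    simp [integrableOn_const_iff]
  refine h1.congr_fun ?_ measurableSet_Ioo
  intro y hy
  have hy' : y ≠ 0 := ne_of_gt hy.1
  simp [hy']

/-- The constant `∫_{|z|<1} |z|^{-2}`. -/
def erC1 : ℝ := ∫ z : V3 in Metric.ball 0 1, (‖z‖ ^ 2)⁻¹

theorem erC1_nonneg : 0 ≤ erC1 := by
  unfold erC1; exact integral_nonneg (fun z => by positivity)

theorem er_kint_scale {ρ : ℝ} (hρ : 0 < ρ) :
    ∫ z : V3 in Metric.ball 0 ρ, (‖z‖ ^ 2)⁻¹ = erC1 * ρ := by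
  have h := Measure.integral_comp_smul (volume : Measure V3)
    (Set.indicator (Metric.ball 0 ρ) (fun z : V3 => (‖z‖ ^ 2)⁻¹)) ρ
  have h2 : ∀ z : V3, Set.indicator (Metric.ball 0 ρ) (fun z : V3 => (‖z‖ ^ 2)⁻¹) (ρ • z)
      = (ρ ^ 2)⁻¹ * Set.indicator (Metric.ball 0 1) (fun z : V3 => (‖z‖ ^ 2)⁻¹) z := by
    intro z
    by_cases hz : ‖z‖ < 1
    · have : ρ • z ∈ Metric.ball (0 : V3) ρ := by
        simp only [mem_ball_zero_iff, norm_smul, Real.norm_eq_abs, abs_of_pos hρ]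
        nlinarith
      rw [Set.indicator_of_mem this, Set.indicator_of_mem (by simpa using hz)]
      simp only [norm_smul, Real.norm_eq_abs, abs_of_pos hρ]
      rw [mul_pow, mul_inv]
    · have : ρ • z ∉ Metric.ball (0 : V3) ρ := by
        simp only [mem_ball_zero_iff, norm_smul, Real.norm_eq_abs, abs_of_pos hρ]
        nlinarith
      rw [Set.indicator_of_notMem this, Set.indicator_of_notMem (by simpa using hz)]
      simp
  simp_rw [h2] at h
  rw [integral_const_mul, integral_indicator Metric.isOpen_ball.measurableSet,
    integral_indicator Metric.isOpen_ball.measurableSet] at h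
  simp only [finrank_euclideanSpace, Fintype.card_fin, smul_eq_mul] at h
  rw [abs_of_pos (by positivity)] at h
  unfold erC1
  field_simp at h
  simp only [one_div] at h
  linarith

theorem er_klint (v : V3) {ρ : ℝ} (hρ : 0 < ρ) :
    ∫⁻ w : V3 in Metric.ball v ρ, ENNReal.ofReal ((‖v - w‖ ^ 2)⁻¹) = ENNReal.ofReal (erC1 * ρ) := by
  rw [← er_kint_scale hρ, ofReal_integral_eq_lintegral_ofReal (er_kint_ball ρ)
    (Filter.Eventually.of_forall fun z => by positivity),
    ← lintegral_indicator Metric.isOpen_ball.measurableSet,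
    ← lintegral_indicator Metric.isOpen_ball.measurableSet,
    ← lintegral_sub_left_eq_self _ v]
  congr 1
  ext w
  by_cases hw : ‖w‖ < ρ
  · rw [Set.indicator_of_mem (by simpa [dist_eq_norm, norm_sub_rev] using hw),
      Set.indicator_of_mem (by simpa using hw)]
    simp
  · rw [Set.indicator_of_notMem (by simpa [dist_eq_norm, norm_sub_rev] using hw),
      Set.indicator_of_notMem (by simpa using hw)]

/-- Decay profile. -/
def erDec (z : V3) : ℝ := ((1 + ‖z‖) ^ 4)⁻¹

theorem erDec_pos (z : V3) : 0 < erDec z := by unfold erDec; positivity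

theorem erDec_le_one (z : V3) : erDec z ≤ 1 := by
  unfold erDec
  apply inv_le_one_of_one_le₀
  exact one_le_pow₀ (by linarith [norm_nonneg z])

theorem erDec_cont : Continuous erDec := by
  unfold erDec
  refine Continuous.inv₀ (by fun_prop) (fun z => by positivity)

theorem erDec_int : Integrable erDec := by
  have h := integrable_one_add_norm (E := V3) (μ := volume) (r := 4) (by simp; norm_num)
  refine h.congr (Filter.Eventually.of_forall fun z => ?_)
  simp only [erDec]
  rw [Real.rpow_neg (by positivity)]
  norm_cast

theorem er_k2dec : Integrable (fun z : V3 => (‖z‖ ^ 2)⁻¹ * erDec z) := by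
  have h1 : Integrable (Set.indicator (Metric.ball 0 1) (fun z : V3 => (‖z‖ ^ 2)⁻¹)) :=
    (integrable_indicator_iff Metric.isOpen_ball.measurableSet).2 (er_kint_ball 1)
  refine (h1.add erDec_int).mono' ?_ (Filter.Eventually.of_forall fun z => ?_)
  · exact (Measurable.inv (by fun_prop)).aestronglyMeasurable.mul erDec_cont.aestronglyMeasurable
  · have hd := erDec_pos z
    have hd1 := erDec_le_one z
    rw [Real.norm_of_nonneg (by positivity)]
    simp only [Pi.add_apply]
    by_cases hz : ‖z‖ < 1
    · rw [Set.indicator_of_mem (by simpa using hz)]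
      have : 0 ≤ (‖z‖ ^ 2)⁻¹ := by positivity
      nlinarith
    · rw [Set.indicator_of_notMem (by simpa using hz)]
      have : (‖z‖ ^ 2)⁻¹ ≤ 1 := inv_le_one_of_one_le₀ (one_le_pow₀ (by linarith))
      nlinarith

theorem er_k1dec : Integrable (fun z : V3 => (‖z‖)⁻¹ * erDec z) := by
  refine (er_k2dec.add erDec_int).mono' ?_ (Filter.Eventually.of_forall fun z => ?_)
  · exact (Measurable.inv (by fun_prop)).aestronglyMeasurable.mul erDec_cont.aestronglyMeasurable
  · have hd := erDec_pos z
    rw [Real.norm_of_nonneg (by positivity)]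
    simp only [Pi.add_apply]
    have : (‖z‖)⁻¹ ≤ (‖z‖ ^ 2)⁻¹ + 1 := by
      rw [← inv_pow]
      nlinarith [sq_nonneg ((‖z‖)⁻¹ - 1), inv_nonneg.2 (norm_nonneg z)]
    nlinarith

theorem er_dec_shift (v z : V3) : erDec (v - z) ≤ (1 + ‖v‖) ^ 4 * erDec z := by
  unfold erDec
  have h : 1 + ‖z‖ ≤ (1 + ‖v‖) * (1 + ‖v - z‖) := by
    have : ‖z‖ ≤ ‖v‖ + ‖v - z‖ := by
      have := norm_sub_le v (v - z); simpa using this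
    nlinarith [norm_nonneg v, norm_nonneg (v - z), norm_nonneg z, mul_nonneg (norm_nonneg v) (norm_nonneg (v-z))]
  rw [← div_eq_mul_inv, inv_le_comm₀ (by positivity) (by positivity), inv_div, div_le_iff₀ (by positivity)]
  calc (1 + ‖z‖) ^ 4 ≤ ((1 + ‖v‖) * (1 + ‖v - z‖)) ^ 4 := by gcongr
    _ = _ := by ring

/-- Schwartz functions are bounded by a multiple of the decay profile. -/
theorem er_schwartz_dec {E : Type} [NormedAddCommGroup E] [NormedSpace ℝ E] (φ : SchwartzMap V3 E) :
    ∃ C : ℝ, 0 ≤ C ∧ ∀ v, ‖φ v‖ ≤ C * erDec v := by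
  have h := fun x => SchwartzMap.one_add_le_sup_seminorm_apply (𝕜 := ℝ) (m := (4, 0)) (k := 4) (n := 0)
    le_rfl le_rfl φ x
  set C := 2 ^ 4 * ((Finset.Iic ((4, 0) : ℕ × ℕ)).sup fun m => SchwartzMap.seminorm ℝ m.1 m.2) φ
  refine ⟨C, by positivity, fun v => ?_⟩
  have := h v
  simp only [norm_iteratedFDeriv_zero] at this
  unfold erDec
  rw [← div_eq_mul_inv, le_div_iff₀ (by positivity)]
  linarith


/-! ### Potentials of Schwartz functions -/

/-- Convolution with a weakly singular kernel. -/
def erT {E : Type} [NormedAddCommGroup E] [NormedSpace ℝ E] (k : V3 → ℝ) (φ : V3 → E) (v : V3) : E :=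
  ∫ z : V3, k z • φ (v - z)

theorem erT_int {E : Type} [NormedAddCommGroup E] [NormedSpace ℝ E] {k : V3 → ℝ}
    (hk : Measurable k) {C : ℝ} (hC : ∀ z, |k z| ≤ C * ‖z‖⁻¹) (φ : SchwartzMap V3 E) (v : V3) :
    Integrable (fun z : V3 => k z • φ (v - z)) := by
  obtain ⟨D, hD0, hD⟩ := er_schwartz_dec φ
  refine (er_k1dec.const_mul (C * D * (1 + ‖v‖) ^ 4)).mono' ?_ (Filter.Eventually.of_forall fun z => ?_)
  · exact hk.aestronglyMeasurable.smul
      ((φ.continuous.comp (continuous_const.sub continuous_id)).aestronglyMeasurable)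
  · rw [norm_smul, Real.norm_eq_abs]
    calc |k z| * ‖φ (v - z)‖ ≤ (C * ‖z‖⁻¹) * (D * ((1 + ‖v‖) ^ 4 * erDec z)) := by
          apply mul_le_mul (hC z) _ (norm_nonneg _) ((abs_nonneg _).trans (hC z))
          exact (hD _).trans (mul_le_mul_of_nonneg_left (er_dec_shift v z) hD0)
      _ = _ := by ring

theorem erT_hasFDerivAt {E : Type} [NormedAddCommGroup E] [NormedSpace ℝ E] [CompleteSpace E]
    {k : V3 → ℝ}
    (hk : Measurable k) {C : ℝ} (hC : ∀ z, |k z| ≤ C * ‖z‖⁻¹) (φ : SchwartzMap V3 E) (v : V3) :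
    HasFDerivAt (erT k φ) (erT k (fderiv ℝ φ) v) v := by
  set φ' := SchwartzMap.fderivCLM ℝ V3 E φ with hφ'
  have hφ'a : ∀ x, φ' x = fderiv ℝ φ x := fun x => SchwartzMap.fderivCLM_apply ℝ φ x
  obtain ⟨D, hD0, hD⟩ := er_schwartz_dec φ'
  have key := hasFDerivAt_integral_of_dominated_of_fderiv_le (𝕜 := ℝ) (μ := (volume : Measure V3))
    (F := fun v z => k z • φ (v - z)) (F' := fun v z => k z • fderiv ℝ φ (v - z))
    (x₀ := v) (s := Metric.ball v 1)
    (bound := fun z => (C * D * (2 + ‖v‖) ^ 4) * (‖z‖⁻¹ * erDec z))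
    (Metric.ball_mem_nhds v one_pos)
    (Filter.Eventually.of_forall fun x => (erT_int hk hC φ x).aestronglyMeasurable)
    (erT_int hk hC φ v)
    (by
      have := (erT_int hk hC φ' v).aestronglyMeasurable
      simpa only [hφ'a] using this)
    (by
      refine Filter.Eventually.of_forall fun z x hx => ?_
      rw [norm_smul, Real.norm_eq_abs, ← hφ'a]
      have hxv : ‖x‖ ≤ 1 + ‖v‖ := by
        rw [Metric.mem_ball, dist_eq_norm] at hx
        have := norm_le_norm_add_norm_sub' x v
        linarith
      calc |k z| * ‖φ' (x - z)‖ ≤ (C * ‖z‖⁻¹) * (D * ((2 + ‖v‖) ^ 4 * erDec z)) := by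
            apply mul_le_mul (hC z) _ (norm_nonneg _) ((abs_nonneg _).trans (hC z))
            refine (hD _).trans (mul_le_mul_of_nonneg_left ((er_dec_shift x z).trans ?_) hD0)
            apply mul_le_mul_of_nonneg_right _ (erDec_pos z).le
            apply pow_le_pow_left₀ (by positivity)
            linarith
        _ = _ := by ring)
    (er_k1dec.const_mul _)
    (by
      refine Filter.Eventually.of_forall fun z x _ => ?_
      have h1 : HasFDerivAt φ (fderiv ℝ φ (x - z)) (x - z) := φ.differentiableAt.hasFDerivAt
      have h2 : HasFDerivAt (fun x : V3 => x - z) (ContinuousLinearMap.id ℝ V3) x :=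
        (hasFDerivAt_id x).sub_const z
      have h3 := h1.comp x h2
      have h4 := h3.const_smul (k z)
      rw [ContinuousLinearMap.comp_id] at h4
      exact h4)
  exact key

theorem erT_contDiff {E : Type} [NormedAddCommGroup E] [NormedSpace ℝ E] [CompleteSpace E]
    {k : V3 → ℝ}
    (hk : Measurable k) {C : ℝ} (hC : ∀ z, |k z| ≤ C * ‖z‖⁻¹) (φ : SchwartzMap V3 E) :
    ContDiff ℝ 1 (erT k φ) := by
  rw [contDiff_one_iff_hasFDerivAt]
  refine ⟨erT k (fderiv ℝ φ), ?_, erT_hasFDerivAt hk hC φ⟩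
  set φ' := SchwartzMap.fderivCLM ℝ V3 E φ with hφ'
  have hφ'a : (φ' : V3 → _) = fderiv ℝ φ := funext fun x => SchwartzMap.fderivCLM_apply ℝ φ x
  rw [← hφ'a]
  exact continuous_iff_continuousAt.2 fun v => (erT_hasFDerivAt hk hC φ' v).continuousAt

/-- The directional derivative as a Schwartz function. -/
theorem er_pd_schwartz (φ : SchwartzMap V3 ℝ) (i : Fin 3) :
    ∃ ψ : SchwartzMap V3 ℝ, ∀ v, ψ v = pd i φ v := by
  refine ⟨LineDeriv.lineDerivOp (EuclideanSpace.single i (1:ℝ) : V3) φ, fun v => ?_⟩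
  rw [SchwartzMap.lineDerivOp_apply_eq_fderiv]
  rfl

theorem erT_pd {k : V3 → ℝ}
    (hk : Measurable k) {C : ℝ} (hC : ∀ z, |k z| ≤ C * ‖z‖⁻¹) (φ : SchwartzMap V3 ℝ) (i : Fin 3) (v : V3) :
    pd i (erT k φ) v = erT k (pd i φ) v := by
  unfold pd
  rw [(erT_hasFDerivAt hk hC φ v).fderiv]
  unfold erT
  set φ' := SchwartzMap.fderivCLM ℝ V3 ℝ φ with hφ'
  have hφ'a : ∀ x, φ' x = fderiv ℝ φ x := fun x => SchwartzMap.fderivCLM_apply ℝ φ x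
  have hi := erT_int hk hC φ' v
  simp only [hφ'a] at hi
  rw [ContinuousLinearMap.integral_apply hi]
  simp

/-- Kernel of the diffusion matrix. -/
def erKA (i j : Fin 3) (z : V3) : ℝ :=
  ((if i = j then (1 : ℝ) else 0) - z i * z j / ‖z‖ ^ 2) / (8 * π * ‖z‖)

/-- Kernel of the Coulomb potential. -/
def erKa (z : V3) : ℝ := (4 * π * ‖z‖)⁻¹

theorem erKA_meas (i j : Fin 3) : Measurable (erKA i j) := by
  unfold erKA
  have h1 : Measurable (fun z : V3 => z i) := by fun_prop
  have h2 : Measurable (fun z : V3 => z j) := by fun_prop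
  exact ((measurable_const.sub ((h1.mul h2).div (by fun_prop)))).div (by fun_prop)

theorem erKA_bound (i j : Fin 3) (z : V3) : |erKA i j z| ≤ 1 * ‖z‖⁻¹ := by
  unfold erKA
  by_cases hz : z = 0
  · subst hz; simp
  have hz' : 0 < ‖z‖ := norm_pos_iff.2 hz
  have hi : |z i| ≤ ‖z‖ := by simpa using PiLp.norm_apply_le z i
  have hj : |z j| ≤ ‖z‖ := by simpa using PiLp.norm_apply_le z j
  rw [abs_div, abs_of_pos (show 0 < 8 * π * ‖z‖ by positivity), div_le_iff₀ (by positivity)]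
  have h1 : |(if i = j then (1 : ℝ) else 0) - z i * z j / ‖z‖ ^ 2| ≤ 2 := by
    have h2 : |z i * z j / ‖z‖ ^ 2| ≤ 1 := by
      rw [abs_div, abs_mul, abs_of_pos (show 0 < ‖z‖ ^ 2 by positivity), div_le_one (by positivity), sq]
      exact mul_le_mul hi hj (abs_nonneg _) (norm_nonneg _)
    have h3 : |(if i = j then (1 : ℝ) else 0)| ≤ 1 := by split_ifs <;> simp
    exact (abs_sub _ _).trans (by linarith)
  refine h1.trans ?_
  have : 1 * ‖z‖⁻¹ * (8 * π * ‖z‖) = 8 * π := by field_simp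
  rw [this]; linarith [Real.pi_gt_three]

theorem erKa_meas : Measurable erKa := by unfold erKa; fun_prop

theorem erKa_bound (z : V3) : |erKa z| ≤ 1 * ‖z‖⁻¹ := by
  unfold erKa
  rw [abs_of_nonneg (by positivity), mul_inv]
  apply mul_le_mul_of_nonneg_right _ (by positivity)
  apply inv_le_one_of_one_le₀
  linarith [Real.pi_gt_three]

theorem er_Amat_eq (f : V3 → ℝ) (v : V3) (i j : Fin 3) : Amat f v i j = erT (erKA i j) f v := by
  unfold Amat erT
  rw [← integral_sub_left_eq_self _ _ v]
  congr 1; ext z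
  simp only [erKA, smul_eq_mul]
  have : v - (v - z) = z := by abel
  rw [this, mul_comm]

theorem er_apot_eq (f : V3 → ℝ) (v : V3) : apot f v = erT erKa f v := by
  unfold apot erT
  rw [← integral_sub_left_eq_self _ _ v]
  congr 1; ext z
  simp only [erKa, smul_eq_mul]
  have : v - (v - z) = z := by abel
  rw [this, div_eq_mul_inv, mul_comm]


/-! ### The Newtonian potential -/

theorem er_schwartz_refl (φ : SchwartzMap V3 ℝ) (v : V3) :
    ∃ χ : SchwartzMap V3 ℝ, ∀ z, χ z = φ (v - z) := by
  have h1 : (fun z : V3 => v - z).HasTemperateGrowth := by fun_prop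
  have h2 : AntilipschitzWith 1 (fun z : V3 => v - z) := by
    intro x y
    simp [edist_dist, dist_eq_norm, norm_sub_rev]
  exact ⟨SchwartzMap.compCLMOfAntilipschitz ℝ h1 h2 φ, fun z => rfl⟩

/-- Regularized inverse norm. -/
def erQ (ε : ℝ) (z : V3) : ℝ := (Real.sqrt (‖z‖ ^ 2 + ε ^ 2))⁻¹

theorem erQ_pos {ε : ℝ} (hε : 0 < ε) (z : V3) : 0 < erQ ε z := by
  unfold erQ; positivity

theorem erQ_sq {ε : ℝ} (z : V3) : (erQ ε z) ^ 2 = (‖z‖ ^ 2 + ε ^ 2)⁻¹ := by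
  unfold erQ; rw [inv_pow, Real.sq_sqrt (by positivity)]

theorem erQ_le {ε : ℝ} (hε : 0 < ε) (z : V3) : erQ ε z ≤ ε⁻¹ := by
  unfold erQ
  apply inv_anti₀ hε
  apply Real.le_sqrt_of_sq_le
  nlinarith [sq_nonneg ‖z‖]

theorem erQ_norm {ε : ℝ} (hε : 0 < ε) (z : V3) : ‖z‖ * erQ ε z ≤ 1 := by
  unfold erQ
  rw [← div_eq_mul_inv, div_le_one (by positivity)]
  apply Real.le_sqrt_of_sq_le
  nlinarith [sq_nonneg ε]

theorem erQ_hasFDerivAt {ε : ℝ} (hε : 0 < ε) (z : V3) :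
    HasFDerivAt (erQ ε) (-(erQ ε z ^ 3) • innerSL ℝ z) z := by
  have h0 : 0 < ‖z‖ ^ 2 + ε ^ 2 := by positivity
  have h1 : HasFDerivAt (fun z : V3 => ‖z‖ ^ 2 + ε ^ 2) (2 • innerSL ℝ z) z :=
    (hasStrictFDerivAt_norm_sq z).hasFDerivAt.add_const _
  have h2 := (h1.sqrt h0.ne')
  have h3 := (hasDerivAt_inv (show Real.sqrt (‖z‖ ^ 2 + ε ^ 2) ≠ 0 by positivity)).comp_hasFDerivAt z h2
  refine h3.congr_fderiv ?_
  ext w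
  simp only [erQ, ContinuousLinearMap.smul_apply, smul_eq_mul, nsmul_eq_mul]
  have hs : Real.sqrt (‖z‖ ^ 2 + ε ^ 2) ≠ 0 := by positivity
  field_simp
  push_cast
  ring

theorem erQ_pd {ε : ℝ} (hε : 0 < ε) (i : Fin 3) (z : V3) :
    pd i (erQ ε) z = - (z i * erQ ε z ^ 3) := by
  unfold pd
  rw [(erQ_hasFDerivAt hε z).fderiv]
  simp [innerSL_apply_apply, EuclideanSpace.inner_single_right]
  ring

theorem erQ_cont {ε : ℝ} (hε : 0 < ε) : Continuous (erQ ε) :=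
  continuous_iff_continuousAt.2 fun z => (erQ_hasFDerivAt hε z).continuousAt

theorem erQ2_hasFDerivAt {ε : ℝ} (hε : 0 < ε) (i : Fin 3) (z : V3) :
    HasFDerivAt (fun z : V3 => z i * erQ ε z ^ 3)
      (z i • ((3 * erQ ε z ^ 2) • (-(erQ ε z ^ 3) • innerSL ℝ z)) +
        (erQ ε z ^ 3) • (EuclideanSpace.proj i : V3 →L[ℝ] ℝ)) z := by
  have h1 : HasFDerivAt (fun z : V3 => z i) (EuclideanSpace.proj i : V3 →L[ℝ] ℝ) z :=
    (EuclideanSpace.proj i : V3 →L[ℝ] ℝ).hasFDerivAt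
  have h2 := (erQ_hasFDerivAt hε z).pow 3
  refine (h1.mul h2).congr_fderiv ?_
  simp

theorem erQ2_pd {ε : ℝ} (hε : 0 < ε) (i : Fin 3) (z : V3) :
    pd i (fun z : V3 => z i * erQ ε z ^ 3) z = erQ ε z ^ 3 - 3 * z i ^ 2 * erQ ε z ^ 5 := by
  unfold pd
  rw [(erQ2_hasFDerivAt hε i z).fderiv]
  simp [innerSL_apply_apply, EuclideanSpace.inner_single_right]
  ring

theorem erQ_sum {ε : ℝ} (hε : 0 < ε) (z : V3) :
    ∑ i : Fin 3, (erQ ε z ^ 3 - 3 * z i ^ 2 * erQ ε z ^ 5) = 3 * ε ^ 2 * erQ ε z ^ 5 := by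
  have hn : ‖z‖ ^ 2 = ∑ i : Fin 3, z i ^ 2 := by
    rw [EuclideanSpace.norm_sq_eq]; simp
  have h := erQ_sq (ε := ε) z
  have h0 : 0 < ‖z‖ ^ 2 + ε ^ 2 := by positivity
  have h1 : erQ ε z ^ 2 * (‖z‖ ^ 2 + ε ^ 2) = 1 := by rw [h]; field_simp
  rw [hn] at h1
  simp only [Fin.sum_univ_three] at h1 ⊢
  linear_combination (- 3 * erQ ε z ^ 3) * h1

theorem er_abs_coord (z : V3) (i : Fin 3) : |z i| ≤ ‖z‖ := by
  simpa using PiLp.norm_apply_le z i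

theorem erQ2_bound {ε : ℝ} (hε : 0 < ε) (i : Fin 3) (z : V3) :
    |z i * erQ ε z ^ 3| ≤ erQ ε z ^ 2 := by
  have h := erQ_pos hε z
  rw [abs_mul, abs_of_pos (pow_pos h 3)]
  have h1 := er_abs_coord z i
  have h2 := erQ_norm hε z
  calc |z i| * erQ ε z ^ 3 ≤ ‖z‖ * erQ ε z ^ 3 := by gcongr
    _ = (‖z‖ * erQ ε z) * erQ ε z ^ 2 := by ring
    _ ≤ 1 * erQ ε z ^ 2 := by gcongr
    _ = _ := by ring

theorem er_schwartz_mul_int (χ : SchwartzMap V3 ℝ) {h : V3 → ℝ} (hc : Continuous h) {C : ℝ}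
    (hC : ∀ z, |h z| ≤ C) : Integrable (fun z => h z * χ z) := by
  exact χ.integrable.bdd_mul hc.aestronglyMeasurable (c := C)
    (Filter.Eventually.of_forall fun z => by simpa using hC z)

theorem er_ibp_eps1 {ε : ℝ} (hε : 0 < ε) (χ : SchwartzMap V3 ℝ) (i : Fin 3) :
    ∫ z, erQ ε z * pd i χ z = ∫ z, (z i * erQ ε z ^ 3) * χ z := by
  obtain ⟨ψ, hψ⟩ := er_pd_schwartz χ i
  have hc := erQ_cont hε
  have hc2 : Continuous (fun z : V3 => z i * erQ ε z ^ 3) :=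
    continuous_iff_continuousAt.2 fun z => (erQ2_hasFDerivAt hε i z).continuousAt
  have hb1 : ∀ z, |erQ ε z| ≤ ε⁻¹ := fun z => by
    rw [abs_of_pos (erQ_pos hε z)]; exact erQ_le hε z
  have hb2 : ∀ z : V3, |z i * erQ ε z ^ 3| ≤ (ε⁻¹) ^ 2 := fun z =>
    (erQ2_bound hε i z).trans (pow_le_pow_left₀ (erQ_pos hε z).le (erQ_le hε z) 2)
  have e1 : ∀ z, fderiv ℝ (erQ ε) z (EuclideanSpace.single i 1) = - (z i * erQ ε z ^ 3) :=
    fun z => erQ_pd hε i z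
  have key := integral_mul_fderiv_eq_neg_fderiv_mul_of_integrable (𝕜 := ℝ) (μ := (volume : Measure V3))
    (f := erQ ε) (g := χ) (v := EuclideanSpace.single i 1)
    (by
      simp only [e1, neg_mul]
      exact (er_schwartz_mul_int χ hc2 hb2).neg)
    (by
      have := er_schwartz_mul_int ψ hc hb1
      simpa only [hψ, pd] using this)
    (er_schwartz_mul_int χ hc hb1)
    (fun x _ => (erQ_hasFDerivAt hε x).differentiableAt)
    (fun x _ => χ.differentiableAt)
  simp only [e1, neg_mul, integral_neg, neg_neg] at key
  exact key

theorem er_ibp_eps2 {ε : ℝ} (hε : 0 < ε) (χ : SchwartzMap V3 ℝ) (i : Fin 3) :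
    Integrable (fun z => (erQ ε z ^ 3 - 3 * z i ^ 2 * erQ ε z ^ 5) * χ z) ∧
    ∫ z, (z i * erQ ε z ^ 3) * pd i χ z = - ∫ z, (erQ ε z ^ 3 - 3 * z i ^ 2 * erQ ε z ^ 5) * χ z := by
  obtain ⟨ψ, hψ⟩ := er_pd_schwartz χ i
  have hc := erQ_cont hε
  have hci : Continuous (fun z : V3 => z i) := by fun_prop
  have hc2 : Continuous (fun z : V3 => z i * erQ ε z ^ 3) := hci.mul (hc.pow 3)
  have hc3 : Continuous (fun z : V3 => erQ ε z ^ 3 - 3 * z i ^ 2 * erQ ε z ^ 5) := by fun_prop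
  have hb2 : ∀ z : V3, |z i * erQ ε z ^ 3| ≤ (ε⁻¹) ^ 2 := fun z =>
    (erQ2_bound hε i z).trans (pow_le_pow_left₀ (erQ_pos hε z).le (erQ_le hε z) 2)
  have hb3 : ∀ z : V3, |erQ ε z ^ 3 - 3 * z i ^ 2 * erQ ε z ^ 5| ≤ 4 * (ε⁻¹) ^ 3 := fun z => by
    have hq := erQ_pos hε z
    have h3 : erQ ε z ^ 3 ≤ (ε⁻¹) ^ 3 := pow_le_pow_left₀ hq.le (erQ_le hε z) 3
    have h2 := erQ_norm hε z
    have h5 : |z i * erQ ε z| ≤ 1 := by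
      rw [abs_mul, abs_of_pos hq]
      exact le_trans (mul_le_mul_of_nonneg_right (er_abs_coord z i) hq.le) h2
    have h6 : (z i * erQ ε z) ^ 2 ≤ 1 := by
      rw [← sq_abs]; exact pow_le_one₀ (abs_nonneg _) h5
    have h7 : erQ ε z ^ 3 - 3 * z i ^ 2 * erQ ε z ^ 5 = erQ ε z ^ 3 * (1 - 3 * (z i * erQ ε z) ^ 2) := by ring
    rw [h7, abs_mul, abs_of_pos (pow_pos hq 3), mul_comm]
    apply mul_le_mul _ h3 (by positivity) (by norm_num)
    rw [abs_le]; constructor <;> nlinarith [sq_nonneg (z i * erQ ε z)]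
  have e1 : ∀ z, fderiv ℝ (fun z : V3 => z i * erQ ε z ^ 3) z (EuclideanSpace.single i 1) =
      erQ ε z ^ 3 - 3 * z i ^ 2 * erQ ε z ^ 5 :=
    fun z => erQ2_pd hε i z
  refine ⟨er_schwartz_mul_int χ hc3 hb3, ?_⟩
  have key := integral_mul_fderiv_eq_neg_fderiv_mul_of_integrable (𝕜 := ℝ) (μ := (volume : Measure V3))
    (f := fun z : V3 => z i * erQ ε z ^ 3) (g := χ) (v := EuclideanSpace.single i 1)
    (by
      simp only [e1]
      exact (er_schwartz_mul_int χ hc3 hb3))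
    (by
      have := er_schwartz_mul_int ψ hc2 hb2
      simpa only [hψ, pd] using this)
    (er_schwartz_mul_int χ hc2 hb2)
    (fun x _ => (erQ2_hasFDerivAt hε i x).differentiableAt)
    (fun x _ => χ.differentiableAt)
  simp only [e1] at key
  exact key


theorem erQ_le_inv {ε : ℝ} (hε : 0 < ε) {z : V3} (hz : z ≠ 0) : erQ ε z ≤ ‖z‖⁻¹ := by
  have := erQ_norm hε z
  have hz' : 0 < ‖z‖ := norm_pos_iff.2 hz
  rw [← one_div, le_div_iff₀ hz']; linarith

theorem erQ_tendsto {z : V3} (hz : z ≠ 0) {e : ℕ → ℝ} (he : Filter.Tendsto e Filter.atTop (nhds 0)) :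
    Filter.Tendsto (fun n => erQ (e n) z) Filter.atTop (nhds ‖z‖⁻¹) := by
  unfold erQ
  have hz' : 0 < ‖z‖ := norm_pos_iff.2 hz
  have h1 : Filter.Tendsto (fun n => Real.sqrt (‖z‖ ^ 2 + e n ^ 2)) Filter.atTop
      (nhds (Real.sqrt (‖z‖ ^ 2 + 0 ^ 2))) :=
    (Real.continuous_sqrt.tendsto _).comp (tendsto_const_nhds.add (he.pow 2))
  have h2 : Real.sqrt (‖z‖ ^ 2 + 0 ^ 2) = ‖z‖ := by simp
  rw [h2] at h1
  exact h1.inv₀ hz'.ne'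

theorem er_ae_ne : ∀ᵐ z : V3, z ≠ 0 := by
  simp [ae_iff]

def erE (n : ℕ) : ℝ := 1 / ((n : ℝ) + 1)
theorem erE_pos (n : ℕ) : 0 < erE n := by unfold erE; positivity
theorem erE_tendsto : Filter.Tendsto erE Filter.atTop (nhds 0) := tendsto_one_div_add_atTop_nhds_zero_nat

theorem er_lim1 (χ : SchwartzMap V3 ℝ) :
    Filter.Tendsto (fun n => ∫ z, erQ (erE n) z * χ z) Filter.atTop (nhds (∫ z, ‖z‖⁻¹ * χ z)) := by
  obtain ⟨D, hD0, hD⟩ := er_schwartz_dec χ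
  refine tendsto_integral_of_dominated_convergence (fun z => D * (‖z‖⁻¹ * erDec z)) ?_ (er_k1dec.const_mul D) ?_ ?_
  · intro n
    exact ((erQ_cont (erE_pos n)).mul χ.continuous).aestronglyMeasurable
  · intro n
    filter_upwards [er_ae_ne] with z hz
    rw [norm_mul, Real.norm_of_nonneg (erQ_pos (erE_pos n) z).le]
    calc erQ (erE n) z * ‖χ z‖ ≤ ‖z‖⁻¹ * (D * erDec z) :=
          mul_le_mul (erQ_le_inv (erE_pos n) hz) (hD z) (norm_nonneg _) (by positivity)
      _ = _ := by ring
  · filter_upwards [er_ae_ne] with z hz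
    exact (erQ_tendsto hz erE_tendsto).mul_const _

theorem er_lim2 (χ : SchwartzMap V3 ℝ) (i : Fin 3) :
    Filter.Tendsto (fun n => ∫ z, (z i * erQ (erE n) z ^ 3) * χ z) Filter.atTop
      (nhds (∫ z, (z i * ‖z‖⁻¹ ^ 3) * χ z)) := by
  obtain ⟨D, hD0, hD⟩ := er_schwartz_dec χ
  refine tendsto_integral_of_dominated_convergence (fun z => D * ((‖z‖ ^ 2)⁻¹ * erDec z)) ?_ (er_k2dec.const_mul D) ?_ ?_
  · intro n
    have hci : Continuous (fun z : V3 => z i) := by fun_prop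
    exact ((hci.mul ((erQ_cont (erE_pos n)).pow 3)).mul χ.continuous).aestronglyMeasurable
  · intro n
    filter_upwards [er_ae_ne] with z hz
    rw [norm_mul, Real.norm_eq_abs]
    have h1 : |z i * erQ (erE n) z ^ 3| ≤ (‖z‖ ^ 2)⁻¹ := by
      refine (erQ2_bound (erE_pos n) i z).trans ?_
      rw [← inv_pow]
      exact pow_le_pow_left₀ (erQ_pos (erE_pos n) z).le (erQ_le_inv (erE_pos n) hz) 2
    calc |z i * erQ (erE n) z ^ 3| * ‖χ z‖ ≤ (‖z‖ ^ 2)⁻¹ * (D * erDec z) :=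
          mul_le_mul h1 (hD z) (norm_nonneg _) (by positivity)
      _ = _ := by ring
  · filter_upwards [er_ae_ne] with z hz
    exact (((erQ_tendsto hz erE_tendsto).pow 3).const_mul _).mul_const _

/-- The Newtonian constant. -/
def erκ0 : ℝ := ∫ y : V3, 3 * erQ 1 y ^ 5

theorem erQ_dec (y : V3) : erQ 1 y ^ 5 ≤ 4 * erDec y := by
  have h1 : erQ 1 y ^ 5 ≤ erQ 1 y ^ 4 := by
    have := erQ_le one_pos y
    have h0 := erQ_pos one_pos y
    apply pow_le_pow_of_le_one h0.le (by simpa using this) (by norm_num)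
  have h2 : erQ 1 y ^ 4 = ((‖y‖ ^ 2 + 1 ^ 2) ^ 2)⁻¹ := by
    have := erQ_sq (ε := 1) y
    calc erQ 1 y ^ 4 = (erQ 1 y ^ 2) ^ 2 := by ring
      _ = _ := by rw [this, inv_pow]
  rw [h2] at h1
  refine h1.trans ?_
  unfold erDec
  rw [← div_eq_mul_inv, ← one_div, div_le_div_iff₀ (by positivity) (by positivity)]
  have : (1 + ‖y‖) ^ 2 ≤ 2 * (‖y‖ ^ 2 + 1 ^ 2) := by nlinarith [sq_nonneg (‖y‖ - 1)]
  calc 1 * (1 + ‖y‖) ^ 4 = ((1 + ‖y‖) ^ 2) ^ 2 := by ring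
    _ ≤ (2 * (‖y‖ ^ 2 + 1 ^ 2)) ^ 2 := pow_le_pow_left₀ (by positivity) this 2
    _ = _ := by ring

theorem er_scale_eq {ε : ℝ} (hε : 0 < ε) (χ : V3 → ℝ) :
    ∫ z, (3 * ε ^ 2 * erQ ε z ^ 5) * χ z = ∫ y, (3 * erQ 1 y ^ 5) * χ (ε • y) := by
  have h := Measure.integral_comp_smul (volume : Measure V3) (fun z => (3 * ε ^ 2 * erQ ε z ^ 5) * χ z) ε
  have e : ∀ y : V3, erQ ε (ε • y) = ε⁻¹ * erQ 1 y := by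
    intro y
    unfold erQ
    rw [norm_smul, Real.norm_of_nonneg hε.le, ← mul_inv]
    congr 1
    rw [show (ε * ‖y‖) ^ 2 + ε ^ 2 = ε ^ 2 * (‖y‖ ^ 2 + 1 ^ 2) by ring, Real.sqrt_mul (by positivity),
      Real.sqrt_sq hε.le]
  simp only [finrank_euclideanSpace, Fintype.card_fin, smul_eq_mul, e] at h
  rw [abs_of_pos (by positivity)] at h
  have h2 : ∀ y : V3, 3 * ε ^ 2 * (ε⁻¹ * erQ 1 y) ^ 5 * χ (ε • y) = (ε ^ 3)⁻¹ * ((3 * erQ 1 y ^ 5) * χ (ε • y)) := by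
    intro y; field_simp
  simp_rw [h2] at h
  rw [integral_const_mul] at h
  exact (mul_left_cancel₀ (by positivity) h).symm

theorem er_lim3 (χ : SchwartzMap V3 ℝ) :
    Filter.Tendsto (fun n => ∫ z, (3 * (erE n) ^ 2 * erQ (erE n) z ^ 5) * χ z) Filter.atTop
      (nhds (erκ0 * χ 0)) := by
  obtain ⟨D, hD0, hD⟩ := er_schwartz_dec χ
  have hh : ∀ n, ∫ z, (3 * (erE n) ^ 2 * erQ (erE n) z ^ 5) * χ z =
      ∫ y, (3 * erQ 1 y ^ 5) * χ (erE n • y) := fun n => er_scale_eq (erE_pos n) χ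
  simp_rw [hh]
  unfold erκ0
  rw [← integral_mul_const]
  refine tendsto_integral_of_dominated_convergence (fun z => 12 * D * erDec z) ?_ (erDec_int.const_mul _) ?_ ?_
  · intro n
    have h1 : Continuous fun y : V3 => χ (erE n • y) := χ.continuous.comp (continuous_const_smul _)
    exact ((continuous_const.mul ((erQ_cont one_pos).pow 5)).mul h1).aestronglyMeasurable
  · intro n
    refine Filter.Eventually.of_forall fun z => ?_
    have h0 := erQ_pos one_pos z
    rw [norm_mul, Real.norm_of_nonneg (by positivity)]
    have h1 := erQ_dec z
    have h2 : ‖χ (erE n • z)‖ ≤ D := (hD _).trans (mul_le_of_le_one_right hD0 (erDec_le_one _))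
    calc 3 * erQ 1 z ^ 5 * ‖χ (erE n • z)‖ ≤ (3 * (4 * erDec z)) * D :=
        mul_le_mul (by linarith) h2 (norm_nonneg _) (by have := erDec_pos z; positivity)
      _ = _ := by ring
  · refine Filter.Eventually.of_forall fun z => ?_
    have h1 : Filter.Tendsto (fun n => erE n • z) Filter.atTop (nhds 0) := by
      have := erE_tendsto.smul_const z
      simpa using this
    exact ((χ.continuous.tendsto 0).comp h1).const_mul _

theorem erκ0_nonneg : 0 ≤ erκ0 := by
  unfold erκ0
  exact integral_nonneg fun y => by have := erQ_pos one_pos y; positivity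

theorem er_K1 (χ : SchwartzMap V3 ℝ) (i : Fin 3) :
    ∫ z, ‖z‖⁻¹ * pd i χ z = ∫ z, (z i * ‖z‖⁻¹ ^ 3) * χ z := by
  obtain ⟨ψ, hψ⟩ := er_pd_schwartz χ i
  have h1 := er_lim1 ψ
  simp only [hψ] at h1
  refine tendsto_nhds_unique h1 ?_
  refine (er_lim2 χ i).congr fun n => ?_
  exact (er_ibp_eps1 (erE_pos n) χ i).symm

theorem er_K2 (χ : SchwartzMap V3 ℝ) :
    ∑ i : Fin 3, ∫ z, (z i * ‖z‖⁻¹ ^ 3) * pd i χ z = - (erκ0 * χ 0) := by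
  have h1 : Filter.Tendsto (fun n => ∑ i : Fin 3, ∫ z, (z i * erQ (erE n) z ^ 3) * pd i χ z) Filter.atTop
      (nhds (∑ i : Fin 3, ∫ z, (z i * ‖z‖⁻¹ ^ 3) * pd i χ z)) := by
    refine tendsto_finsetSum _ fun i _ => ?_
    obtain ⟨ψ, hψ⟩ := er_pd_schwartz χ i
    have h1 := er_lim2 ψ i
    simpa only [hψ] using h1
  refine tendsto_nhds_unique h1 ?_
  refine (er_lim3 χ).neg.congr fun n => ?_
  have h2 := fun i => er_ibp_eps2 (erE_pos n) χ i
  rw [Finset.sum_congr rfl fun i _ => (h2 i).2, Finset.sum_neg_distrib, ← integral_finsetSum _ fun i _ => (h2 i).1]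
  congr 1
  congr 1
  ext z
  rw [← Finset.sum_mul, erQ_sum (erE_pos n)]


/-- The normalized Newtonian constant. -/
def erκ : ℝ := erκ0 / (4 * π)

theorem erκ_nonneg : 0 ≤ erκ := div_nonneg erκ0_nonneg (by positivity)

/-- Riesz potential with kernel `|z|^{-2}`. -/
def erB (φ : V3 → ℝ) (v : V3) : ℝ := ∫ z : V3, (‖z‖ ^ 2)⁻¹ * φ (v - z)

theorem erB_int (φ : SchwartzMap V3 ℝ) (v : V3) :
    Integrable (fun z : V3 => (‖z‖ ^ 2)⁻¹ * φ (v - z)) := by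
  obtain ⟨D, hD0, hD⟩ := er_schwartz_dec φ
  refine (er_k2dec.const_mul (D * (1 + ‖v‖) ^ 4)).mono' ?_ (Filter.Eventually.of_forall fun z => ?_)
  · exact (Measurable.inv (by fun_prop)).aestronglyMeasurable.mul
      ((φ.continuous.comp (continuous_const.sub continuous_id)).aestronglyMeasurable)
  · rw [norm_mul, Real.norm_of_nonneg (by positivity)]
    calc (‖z‖ ^ 2)⁻¹ * ‖φ (v - z)‖ ≤ (‖z‖ ^ 2)⁻¹ * (D * ((1 + ‖v‖) ^ 4 * erDec z)) := by
          gcongr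
          exact (hD _).trans (mul_le_mul_of_nonneg_left (er_dec_shift v z) hD0)
      _ = _ := by ring

theorem er_pd_refl (φ χ : SchwartzMap V3 ℝ) (v : V3) (h : ∀ z, χ z = φ (v - z)) (i : Fin 3) (z : V3) :
    pd i χ z = - pd i φ (v - z) := by
  have h0 : (χ : V3 → ℝ) = fun z => φ (v - z) := funext h
  have h1 : HasFDerivAt φ (fderiv ℝ φ (v - z)) (v - z) := φ.differentiableAt.hasFDerivAt
  have h2 : HasFDerivAt (fun z : V3 => v - z) (-ContinuousLinearMap.id ℝ V3) z :=
    (hasFDerivAt_id z).const_sub v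
  have h3 : HasFDerivAt (fun z => φ (v - z)) _ z := h1.comp z h2
  unfold pd
  rw [h0, h3.fderiv]
  simp

theorem er_Ka_pd (φ : SchwartzMap V3 ℝ) (i : Fin 3) (v : V3) :
    erT erKa (pd i φ) v = - ((4 * π)⁻¹ * ∫ z, (z i * ‖z‖⁻¹ ^ 3) * φ (v - z)) := by
  obtain ⟨χ, hχ⟩ := er_schwartz_refl φ v
  have hk := er_K1 χ i
  simp only [er_pd_refl φ χ v hχ i, mul_neg, integral_neg, hχ] at hk
  rw [← hk]
  unfold erT erKa
  rw [mul_neg, neg_neg, ← integral_const_mul]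
  congr 1; ext z
  simp only [smul_eq_mul, mul_inv]; ring

theorem er_pd_apot (φ : SchwartzMap V3 ℝ) (i : Fin 3) : pd i (apot φ) = erT erKa (pd i φ) := by
  have h0 : apot φ = erT erKa φ := funext fun v => er_apot_eq φ v
  rw [h0]
  funext v
  exact erT_pd erKa_meas erKa_bound φ i v

theorem er_apot_pd_C1 (φ : SchwartzMap V3 ℝ) (i : Fin 3) : ContDiff ℝ 1 (pd i (apot φ)) := by
  rw [er_pd_apot]
  obtain ⟨ψ, hψ⟩ := er_pd_schwartz φ i
  rw [← funext hψ]
  exact erT_contDiff erKa_meas erKa_bound ψ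

theorem er_Amat_C1 (φ : SchwartzMap V3 ℝ) (i j : Fin 3) : ContDiff ℝ 1 (fun v => Amat φ v i j) := by
  have h0 : (fun v => Amat φ v i j) = erT (erKA i j) φ := funext fun v => er_Amat_eq φ v i j
  rw [h0]
  exact erT_contDiff (erKA_meas i j) (erKA_bound i j) φ

theorem er_Amat_symm (φ : V3 → ℝ) (v : V3) (i j : Fin 3) : Amat φ v i j = Amat φ v j i := by
  unfold Amat
  congr 1; ext w
  simp only [eq_comm (a := i) (b := j), mul_comm ((v - w) i)]

theorem er_laplace_apot (φ : SchwartzMap V3 ℝ) (v : V3) :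
    ∑ i : Fin 3, pd i (pd i (apot φ)) v = - (erκ * φ v) := by
  have h1 : ∀ i : Fin 3, pd i (pd i (apot φ)) v =
      (4 * π)⁻¹ * ∫ z, (z i * ‖z‖⁻¹ ^ 3) * (- pd i φ (v - z)) := by
    intro i
    rw [er_pd_apot]
    obtain ⟨ψ, hψ⟩ := er_pd_schwartz φ i
    rw [← funext hψ, erT_pd erKa_meas erKa_bound ψ i v, er_Ka_pd]
    simp only [mul_neg, integral_neg]
  obtain ⟨χ, hχ⟩ := er_schwartz_refl φ v
  have hk := er_K2 χ
  simp only [er_pd_refl φ χ v hχ] at hk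
  rw [Finset.sum_congr rfl fun i _ => h1 i, ← Finset.mul_sum, hk, hχ]
  unfold erκ
  simp only [sub_zero]
  field_simp

theorem er_pd_apot_bound (φ : SchwartzMap V3 ℝ) (h0 : ∀ v, 0 ≤ φ v) (i : Fin 3) (v : V3) :
    |pd i (apot φ) v| ≤ erB φ v := by
  rw [er_pd_apot, er_Ka_pd, abs_neg, abs_mul, abs_of_pos (show (0:ℝ) < (4 * π)⁻¹ by positivity)]
  have h1 : |∫ z, (z i * ‖z‖⁻¹ ^ 3) * φ (v - z)| ≤ erB φ v := by
    rw [← Real.norm_eq_abs]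
    refine norm_integral_le_of_norm_le (erB_int φ v) ?_
    filter_upwards [er_ae_ne] with z hz
    have hz' : 0 < ‖z‖ := norm_pos_iff.2 hz
    rw [norm_mul, Real.norm_of_nonneg (h0 _), Real.norm_eq_abs, abs_mul, abs_of_pos (show 0 < ‖z‖⁻¹ ^ 3 by positivity)]
    apply mul_le_mul_of_nonneg_right _ (h0 _)
    calc |z i| * ‖z‖⁻¹ ^ 3 ≤ ‖z‖ * ‖z‖⁻¹ ^ 3 := by gcongr; exact er_abs_coord z i
      _ = _ := by field_simp
  have h2 : (4 * π)⁻¹ ≤ 1 := inv_le_one_of_one_le₀ (by linarith [Real.pi_gt_three])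
  exact (mul_le_of_le_one_left (abs_nonneg _) h2).trans h1

theorem er_Amat_bound (φ : SchwartzMap V3 ℝ) (h0 : ∀ v, 0 ≤ φ v) (hm : ∫ v, φ v = 1) (i j : Fin 3) (v : V3) :
    |Amat φ v i j| ≤ erB φ v + 1 := by
  rw [er_Amat_eq, ← Real.norm_eq_abs]
  unfold erT
  have hm' : ∫ z, φ (v - z) = 1 := by rw [integral_sub_left_eq_self _ _ v]; exact hm
  have hi : Integrable (fun z => φ (v - z)) := by
    obtain ⟨χ, hχ⟩ := er_schwartz_refl φ v
    rw [← funext hχ]; exact χ.integrable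
  unfold erB
  rw [← hm', ← integral_add (erB_int φ v) hi]
  refine norm_integral_le_of_norm_le ((erB_int φ v).add hi) (Filter.Eventually.of_forall fun z => ?_)
  rw [smul_eq_mul, norm_mul, Real.norm_of_nonneg (h0 _), Real.norm_eq_abs]
  have h1 := erKA_bound i j z
  have h2 : ‖z‖⁻¹ ≤ (‖z‖ ^ 2)⁻¹ + 1 := by
    rw [← inv_pow]
    nlinarith [sq_nonneg ((‖z‖)⁻¹ - 1), inv_nonneg.2 (norm_nonneg z)]
  have := h0 (v - z)
  nlinarith

theorem erB_nonneg (φ : SchwartzMap V3 ℝ) (h0 : ∀ v, 0 ≤ φ v) (v : V3) : 0 ≤ erB φ v :=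
  integral_nonneg fun z => mul_nonneg (by positivity) (h0 _)


/-! ### Truncations and cutoffs -/

theorem er_pp_deriv (n : ℕ) (x : ℝ) :
    HasDerivAt (fun x : ℝ => max x 0 ^ (n + 2)) (((n : ℝ) + 2) * max x 0 ^ (n + 1)) x := by
  rcases lt_trichotomy x 0 with hx | hx | hx
  · have h1 : (fun x : ℝ => max x 0 ^ (n + 2)) =ᶠ[nhds x] fun _ => 0 := by
      filter_upwards [gt_mem_nhds hx] with y hy
      rw [max_eq_right hy.le]; simp
    rw [max_eq_right hx.le]
    simpa using (hasDerivAt_const x (0:ℝ)).congr_of_eventuallyEq h1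
  · subst hx
    have h2 : ∀ x : ℝ, max x 0 ^ (n + 2) = x * max x 0 ^ (n + 1) := by
      intro x
      rcases le_total x 0 with h | h
      · rw [max_eq_right h]; simp
      · rw [max_eq_left h]; ring
    simp_rw [h2]
    simp only [max_self, ne_eq, Nat.add_eq_zero_iff, one_ne_zero, and_false, not_false_eq_true, zero_pow,
      mul_zero]
    rw [hasDerivAt_iff_tendsto_slope]
    have h3 : Filter.Tendsto (fun x : ℝ => max x 0 ^ (n + 1)) (nhdsWithin 0 {0}ᶜ) (nhds 0) := by
      have : Continuous (fun x : ℝ => max x 0 ^ (n + 1)) := by fun_prop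
      have := this.tendsto 0
      simp only [max_self, ne_eq, Nat.add_eq_zero_iff, one_ne_zero, and_false, not_false_eq_true, zero_pow] at this
      exact this.mono_left nhdsWithin_le_nhds
    refine h3.congr' ?_
    filter_upwards [self_mem_nhdsWithin] with y hy
    have : y ≠ 0 := hy
    simp [slope_def_field, this]
  · have h1 : (fun x : ℝ => max x 0 ^ (n + 2)) =ᶠ[nhds x] fun x => x ^ (n + 2) := by
      filter_upwards [lt_mem_nhds hx] with y hy
      rw [max_eq_left hy.le]
    rw [max_eq_left hx.le]
    have h2 := (hasDerivAt_pow (n + 2) x).congr_of_eventuallyEq h1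
    refine h2.congr_deriv ?_
    push_cast; rfl

theorem er_pp_C1 (n : ℕ) : ContDiff ℝ 1 (fun x : ℝ => max x 0 ^ (n + 2)) := by
  rw [contDiff_one_iff_deriv]
  refine ⟨fun x => (er_pp_deriv n x).differentiableAt, ?_⟩
  have : deriv (fun x : ℝ => max x 0 ^ (n + 2)) = fun x => ((n : ℝ) + 2) * max x 0 ^ (n + 1) :=
    funext fun x => (er_pp_deriv n x).deriv
  rw [this]; fun_prop

/-- Spatial cutoff. -/
def erφ (r : ℝ) (v₀ v : V3) : ℝ := max (r ^ 2 - ‖v - v₀‖ ^ 2) 0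
/-- Truncation. -/
def erg (f : V3 → ℝ) (k : ℝ) (v : V3) : ℝ := max (f v - k) 0

theorem erφ_nonneg (r : ℝ) (v₀ v : V3) : 0 ≤ erφ r v₀ v := le_max_right _ _
theorem erg_nonneg (f : V3 → ℝ) (k : ℝ) (v : V3) : 0 ≤ erg f k v := le_max_right _ _
theorem erφ_le_one {r : ℝ} (h0 : 0 ≤ r) (h1 : r ≤ 1) (v₀ v : V3) : erφ r v₀ v ≤ 1 := by
  unfold erφ; apply max_le _ zero_le_one; nlinarith [sq_nonneg ‖v - v₀‖]
theorem erφ_cont (r : ℝ) (v₀ : V3) : Continuous (erφ r v₀) := by unfold erφ; fun_prop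
theorem erg_cont {f : V3 → ℝ} (hf : Continuous f) (k : ℝ) : Continuous (erg f k) := by unfold erg; fun_prop

theorem erφ_eq_zero {r : ℝ} {v₀ v : V3} (h0 : 0 ≤ r) (h : r ≤ ‖v - v₀‖) : erφ r v₀ v = 0 := by
  unfold erφ; apply max_eq_right; nlinarith

theorem er_pd_pp {u : V3 → ℝ} {v : V3} (hu : DifferentiableAt ℝ u v) (n : ℕ) :
    HasFDerivAt (fun v => max (u v) 0 ^ (n + 2)) ((((n : ℝ) + 2) * max (u v) 0 ^ (n + 1)) • fderiv ℝ u v) v :=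
  (er_pp_deriv n (u v)).comp_hasFDerivAt v hu.hasFDerivAt

/-- coordinate derivative of the cutoff -/
def erd (v₀ : V3) (i : Fin 3) (v : V3) : ℝ := -2 * (v - v₀) i

theorem er_quad_hasFDerivAt (r : ℝ) (v₀ v : V3) :
    HasFDerivAt (fun v : V3 => r ^ 2 - ‖v - v₀‖ ^ 2) (-(2 • innerSL ℝ (v - v₀))) v := by
  have h2 : HasFDerivAt (fun x : V3 => x - v₀) (ContinuousLinearMap.id ℝ V3) v :=
    (hasFDerivAt_id v).sub_const v₀
  have h1 := (hasStrictFDerivAt_norm_sq (v - v₀)).hasFDerivAt.comp v h2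
  have := h1.const_sub (r ^ 2)
  rw [ContinuousLinearMap.comp_id] at this
  exact this

theorem er_pd_quad (r : ℝ) (v₀ v : V3) (i : Fin 3) :
    fderiv ℝ (fun v : V3 => r ^ 2 - ‖v - v₀‖ ^ 2) v (EuclideanSpace.single i 1) = erd v₀ i v := by
  rw [(er_quad_hasFDerivAt r v₀ v).fderiv]
  simp [innerSL_apply_apply, EuclideanSpace.inner_single_right, erd]

theorem erφ_pow_hasFDerivAt (r : ℝ) (v₀ v : V3) (n : ℕ) :
    HasFDerivAt (fun v => erφ r v₀ v ^ (n + 2)) ((((n : ℝ) + 2) * erφ r v₀ v ^ (n + 1)) •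
      fderiv ℝ (fun v : V3 => r ^ 2 - ‖v - v₀‖ ^ 2) v) v :=
  er_pd_pp (er_quad_hasFDerivAt r v₀ v).differentiableAt n

theorem erg_pow_hasFDerivAt {f : V3 → ℝ} {v : V3} (hf : DifferentiableAt ℝ f v) (k : ℝ) (n : ℕ) :
    HasFDerivAt (fun v => erg f k v ^ (n + 2)) ((((n : ℝ) + 2) * erg f k v ^ (n + 1)) •
      fderiv ℝ f v) v := by
  have := er_pd_pp (u := fun v => f v - k) (hf.sub_const k) n
  rwa [fderiv_sub_const] at this

theorem erφ_pow_C1 (r : ℝ) (v₀ : V3) (n : ℕ) : ContDiff ℝ 1 (fun v => erφ r v₀ v ^ (n + 2)) := by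
  have : ContDiff ℝ 1 (fun v : V3 => r ^ 2 - ‖v - v₀‖ ^ 2) :=
    contDiff_const.sub ((contDiff_id.sub contDiff_const).norm_sq ℝ)
  exact (er_pp_C1 n).comp this

theorem erg_pow_C1 {f : V3 → ℝ} (hf : ContDiff ℝ 1 f) (k : ℝ) (n : ℕ) :
    ContDiff ℝ 1 (fun v => erg f k v ^ (n + 2)) :=
  (er_pp_C1 n).comp (hf.sub contDiff_const)

theorem er_pd_prod {f : V3 → ℝ} (hf : Differentiable ℝ f) (r : ℝ) (v₀ : V3) (k : ℝ) (a b : ℕ) (i : Fin 3) (v : V3) :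
    pd i (fun v => erφ r v₀ v ^ (a + 2) * erg f k v ^ (b + 2)) v =
      ((a : ℝ) + 2) * erφ r v₀ v ^ (a + 1) * erd v₀ i v * erg f k v ^ (b + 2) +
      erφ r v₀ v ^ (a + 2) * (((b : ℝ) + 2) * erg f k v ^ (b + 1) * pd i f v) := by
  unfold pd
  have h : HasFDerivAt (fun v => erφ r v₀ v ^ (a + 2) * erg f k v ^ (b + 2)) _ v :=
    (erφ_pow_hasFDerivAt r v₀ v a).mul (erg_pow_hasFDerivAt (hf v) k b)
  rw [h.fderiv]
  simp only [ContinuousLinearMap.add_apply, ContinuousLinearMap.smul_apply, smul_eq_mul, er_pd_quad]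
  ring

theorem er_cs {a : ℕ} (r : ℝ) (h0 : 0 ≤ r) (v₀ : V3) (h : V3 → ℝ) :
    HasCompactSupport (fun v => erφ r v₀ v ^ (a + 1) * h v) := by
  apply HasCompactSupport.intro (isCompact_closedBall v₀ r)
  intro v hv
  rw [Metric.mem_closedBall, dist_eq_norm, not_le] at hv
  rw [erφ_eq_zero h0 hv.le]; simp

theorem er_cs_int {a : ℕ} (r : ℝ) (h0 : 0 ≤ r) (v₀ : V3) {h : V3 → ℝ} (hc : Continuous h) :
    Integrable (fun v => erφ r v₀ v ^ (a + 1) * h v) :=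
  (((erφ_cont r v₀).pow _).mul hc).integrable_of_hasCompactSupport (er_cs r h0 v₀ h)

theorem er_pd_cont {F : V3 → ℝ} (hF : ContDiff ℝ 1 F) (i : Fin 3) : Continuous (pd i F) :=
  (hF.continuous_fderiv one_ne_zero).clm_apply continuous_const

theorem er_ibp_cs {ψ F : V3 → ℝ} (hψ : ContDiff ℝ 1 ψ) (hF : ContDiff ℝ 1 F) (hs : HasCompactSupport ψ)
    (i : Fin 3) : ∫ v, ψ v * pd i F v = - ∫ v, pd i ψ v * F v := by
  have h1 : HasCompactSupport (pd i ψ) := by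
    have := hs.fderiv (𝕜 := ℝ)
    exact this.comp_left (g := fun L : V3 →L[ℝ] ℝ => L (EuclideanSpace.single i 1)) (by simp)
  exact integral_mul_fderiv_eq_neg_fderiv_mul_of_integrable (𝕜 := ℝ) (μ := (volume : Measure V3))
    (f := ψ) (g := F) (v := EuclideanSpace.single i 1)
    (((er_pd_cont hψ i).mul hF.continuous).integrable_of_hasCompactSupport h1.mul_right)
    ((hψ.continuous.mul (er_pd_cont hF i)).integrable_of_hasCompactSupport hs.mul_right)
    ((hψ.continuous.mul hF.continuous).integrable_of_hasCompactSupport hs.mul_right)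
    (fun x _ => hψ.differentiable one_ne_zero x) (fun x _ => hF.differentiable one_ne_zero x)

theorem erB_cont (φ : SchwartzMap V3 ℝ) : Continuous (erB φ) := by
  obtain ⟨D, hD0, hD⟩ := er_schwartz_dec φ
  rw [continuous_iff_continuousAt]
  intro v
  unfold erB
  refine continuousAt_of_dominated (bound := fun z => (D * (2 + ‖v‖) ^ 4) * ((‖z‖ ^ 2)⁻¹ * erDec z)) ?_ ?_
    (er_k2dec.const_mul _) ?_
  · exact Filter.Eventually.of_forall fun x => (erB_int φ x).aestronglyMeasurable
  · filter_upwards [Metric.ball_mem_nhds v one_pos] with x hx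
    refine Filter.Eventually.of_forall fun z => ?_
    have hxv : ‖x‖ ≤ 1 + ‖v‖ := by
      rw [Metric.mem_ball, dist_eq_norm] at hx
      have := norm_le_norm_add_norm_sub' x v
      linarith
    rw [norm_mul, Real.norm_of_nonneg (by positivity)]
    calc (‖z‖ ^ 2)⁻¹ * ‖φ (x - z)‖ ≤ (‖z‖ ^ 2)⁻¹ * (D * ((2 + ‖v‖) ^ 4 * erDec z)) := by
          gcongr
          refine (hD _).trans (mul_le_mul_of_nonneg_left ((er_dec_shift x z).trans ?_) hD0)
          apply mul_le_mul_of_nonneg_right _ (erDec_pos z).le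
          apply pow_le_pow_left₀ (by positivity)
          linarith
      _ = _ := by ring
  · refine Filter.Eventually.of_forall fun z => ?_
    have : Continuous fun x : V3 => φ (x - z) := φ.continuous.comp (continuous_id.sub continuous_const)
    exact (continuous_const.mul this).continuousAt


/-! ### The singular term -/

/-- Truncated kernel. -/
def erJ (ρ : ℝ) (z : V3) : ℝ := if ‖z‖ < ρ then (‖z‖ ^ 2)⁻¹ else 0

theorem erJ_nonneg (ρ : ℝ) (z : V3) : 0 ≤ erJ ρ z := by unfold erJ; split_ifs <;> positivity

theorem erJ_lint (v : V3) {ρ : ℝ} (hρ : 0 ≤ ρ) :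
    ∫⁻ w : V3, ENNReal.ofReal (erJ ρ (v - w)) = ENNReal.ofReal (erC1 * ρ) := by
  rcases hρ.eq_or_lt with h | h
  · subst h
    have : ∀ w : V3, erJ 0 (v - w) = 0 := fun w => by
      unfold erJ; rw [if_neg]; exact not_lt.2 (norm_nonneg _)
    simp [this]
  · rw [← er_klint v h, ← lintegral_indicator Metric.isOpen_ball.measurableSet]
    congr 1; ext w
    by_cases hw : ‖v - w‖ < ρ
    · rw [Set.indicator_of_mem (by simpa [dist_eq_norm, norm_sub_rev] using hw)]
      simp [erJ, hw]
    · rw [Set.indicator_of_notMem (by simpa [dist_eq_norm, norm_sub_rev] using hw)]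
      simp [erJ, hw]

theorem erJ_lint' (w : V3) {ρ : ℝ} (hρ : 0 ≤ ρ) :
    ∫⁻ v : V3, ENNReal.ofReal (erJ ρ (v - w)) = ENNReal.ofReal (erC1 * ρ) := by
  rw [← erJ_lint w hρ]
  congr 1; ext v
  unfold erJ; rw [norm_sub_rev]

theorem erφ_compare {r : ℝ} (h0 : 0 < r) (h1 : r ≤ 1) (v₀ v w : V3) (h : ‖v - w‖ < erφ r v₀ v ^ 2 / 8) :
    erφ r v₀ v ≤ 2 * erφ r v₀ w ∧ ‖v - w‖ < erφ r v₀ w ^ 2 / 2 := by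
  have hn := norm_nonneg (v - w)
  have hp : 0 < erφ r v₀ v := by
    rcases (erφ_nonneg r v₀ v).eq_or_lt with h' | h'
    · rw [← h'] at h; norm_num at h; linarith
    · exact h'
  have hle := erφ_le_one h0.le h1 v₀ v
  have e1 : erφ r v₀ v = r ^ 2 - ‖v - v₀‖ ^ 2 := by
    unfold erφ at hp ⊢
    rcases le_total (r ^ 2 - ‖v - v₀‖ ^ 2) 0 with h' | h'
    · rw [max_eq_right h'] at hp; exact absurd hp (lt_irrefl _)
    · exact max_eq_left h'
  have e2 : r ^ 2 - ‖w - v₀‖ ^ 2 ≤ erφ r v₀ w := le_max_left _ _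
  have e3 : ‖w - v₀‖ ≤ ‖v - v₀‖ + ‖v - w‖ := by
    have : w - v₀ = (v - v₀) - (v - w) := by abel
    rw [this]; exact norm_sub_le _ _
  have hv : ‖v - v₀‖ ≤ 1 := by
    by_contra hcon
    push Not at hcon
    have : r ^ 2 ≤ 1 := by nlinarith
    nlinarith
  have hv0 := norm_nonneg (v - v₀)
  set p := erφ r v₀ v
  set q := erφ r v₀ w
  have e4 : ‖w - v₀‖ ^ 2 ≤ ‖v - v₀‖ ^ 2 + 3 * ‖v - w‖ := by
    have h8 : ‖v - w‖ ≤ 1 := by nlinarith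
    calc ‖w - v₀‖ ^ 2 ≤ (‖v - v₀‖ + ‖v - w‖) ^ 2 := pow_le_pow_left₀ (norm_nonneg _) e3 2
      _ ≤ _ := by nlinarith
  have e5 : p - 3 * (p ^ 2 / 8) ≤ q := by nlinarith
  have e6 : p ≤ 2 * q := by nlinarith
  refine ⟨e6, ?_⟩
  nlinarith

theorem er_bpt {f : V3 → ℝ} (hf0 : ∀ v, 0 ≤ f v) {k : ℝ} (hk : 0 ≤ k) {r : ℝ} (h0 : 0 < r) (h1 : r ≤ 1)
    (v₀ v w : V3) :
    erφ r v₀ v ^ 22 * erg f k v ^ 4 * ((‖v - w‖ ^ 2)⁻¹ * f w) ≤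
      (64 * (erφ r v₀ v ^ 18 * erg f k v ^ 4)) * f w +
      (k * (erφ r v₀ v ^ 22 * erg f k v ^ 4) + erφ r v₀ v ^ 22 * erg f k v ^ 5) * erJ (erφ r v₀ v ^ 2 / 8) (v - w) +
      (2 ^ 22 * (erφ r v₀ w ^ 22 * erg f k w ^ 5)) * erJ (erφ r v₀ w ^ 2 / 2) (v - w) := by
  have hp := erφ_nonneg r v₀ v
  have hq := erφ_nonneg r v₀ w
  have hg := erg_nonneg f k v
  have hgw := erg_nonneg f k w
  have hN : 0 ≤ (‖v - w‖ ^ 2)⁻¹ := by positivity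
  by_cases h : ‖v - w‖ < erφ r v₀ v ^ 2 / 8
  · obtain ⟨c1, c2⟩ := erφ_compare h0 h1 v₀ v w h
    have hJ1 : erJ (erφ r v₀ v ^ 2 / 8) (v - w) = (‖v - w‖ ^ 2)⁻¹ := by unfold erJ; rw [if_pos h]
    have hJ2 : erJ (erφ r v₀ w ^ 2 / 2) (v - w) = (‖v - w‖ ^ 2)⁻¹ := by unfold erJ; rw [if_pos c2]
    rw [hJ1, hJ2]
    have hfw : f w ≤ k + erg f k w := by
      have : f w - k ≤ erg f k w := le_max_left _ _
      linarith
    have hy : erg f k v ^ 4 * erg f k w ≤ erg f k v ^ 5 + erg f k w ^ 5 := by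
      rcases le_total (erg f k v) (erg f k w) with hh | hh
      · have : erg f k v ^ 4 ≤ erg f k w ^ 4 := pow_le_pow_left₀ hg hh 4
        nlinarith [pow_nonneg hg 5]
      · have : 0 ≤ erg f k v ^ 4 := by positivity
        nlinarith [pow_nonneg hgw 5]
    have hpq : erφ r v₀ v ^ 22 ≤ 2 ^ 22 * erφ r v₀ w ^ 22 := by
      rw [← mul_pow]; exact pow_le_pow_left₀ hp c1 22
    set N := (‖v - w‖ ^ 2)⁻¹
    set P := erφ r v₀ v ^ 22
    have hP : 0 ≤ P := by positivity
    have s1 : P * erg f k v ^ 4 * (N * f w) ≤ P * erg f k v ^ 4 * (N * (k + erg f k w)) := by gcongr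
    have s2 : P * (erg f k v ^ 4 * erg f k w) * N ≤ P * (erg f k v ^ 5 + erg f k w ^ 5) * N := by gcongr
    have s3 : P * erg f k w ^ 5 * N ≤ (2 ^ 22 * erφ r v₀ w ^ 22) * erg f k w ^ 5 * N := by gcongr
    have s4 : 0 ≤ (64 * (erφ r v₀ v ^ 18 * erg f k v ^ 4)) * f w := by have := hf0 w; positivity
    linarith
  · have hJ1 := erJ_nonneg (erφ r v₀ v ^ 2 / 8) (v - w)
    have hJ2 := erJ_nonneg (erφ r v₀ w ^ 2 / 2) (v - w)
    have s1 : 0 ≤ (k * (erφ r v₀ v ^ 22 * erg f k v ^ 4) + erφ r v₀ v ^ 22 * erg f k v ^ 5) * erJ (erφ r v₀ v ^ 2 / 8) (v - w) := by positivity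
    have s2 : 0 ≤ (2 ^ 22 * (erφ r v₀ w ^ 22 * erg f k w ^ 5)) * erJ (erφ r v₀ w ^ 2 / 2) (v - w) := by positivity
    have s3 : erφ r v₀ v ^ 4 * (‖v - w‖ ^ 2)⁻¹ ≤ 64 := by
      rcases hp.eq_or_lt with h' | h'
      · rw [← h']; norm_num
      · push Not at h
        have hb : 0 < erφ r v₀ v ^ 2 / 8 := by positivity
        have hb2 : (erφ r v₀ v ^ 2 / 8) ^ 2 ≤ ‖v - w‖ ^ 2 := pow_le_pow_left₀ hb.le h 2
        have : (‖v - w‖ ^ 2)⁻¹ ≤ ((erφ r v₀ v ^ 2 / 8) ^ 2)⁻¹ := inv_anti₀ (by positivity) hb2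
        calc erφ r v₀ v ^ 4 * (‖v - w‖ ^ 2)⁻¹ ≤ erφ r v₀ v ^ 4 * ((erφ r v₀ v ^ 2 / 8) ^ 2)⁻¹ := by gcongr
          _ = 64 := by field_simp; norm_num
    have s4 : erφ r v₀ v ^ 22 * erg f k v ^ 4 * ((‖v - w‖ ^ 2)⁻¹ * f w) =
        (erφ r v₀ v ^ 4 * (‖v - w‖ ^ 2)⁻¹) * (erφ r v₀ v ^ 18 * erg f k v ^ 4 * f w) := by ring
    rw [s4]
    have s5 : 0 ≤ erφ r v₀ v ^ 18 * erg f k v ^ 4 * f w := by have := hf0 w; positivity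
    nlinarith

theorem erJ_meas {ρ : V3 × V3 → ℝ} (hρ : Measurable ρ) :
    Measurable (fun x : V3 × V3 => erJ (ρ x) (x.1 - x.2)) := by
  unfold erJ
  refine Measurable.ite (measurableSet_lt (by fun_prop) hρ) (by fun_prop) measurable_const

/-- Universal constant of the singular term. -/
def erCb : ℝ := 64 + erC1 * 2 ^ 22

theorem erCb_pos : 0 < erCb := by unfold erCb; have := erC1_nonneg; positivity

theorem er_lint3 {T1 T2 T3 : V3 × V3 → ENNReal} (m1 : Measurable T1) (m2 : Measurable T2) (m3 : Measurable T3) :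
    ∫⁻ v, ∫⁻ w, (T1 (v, w) + T2 (v, w) + T3 (v, w)) =
      (∫⁻ v, ∫⁻ w, T1 (v, w)) + (∫⁻ v, ∫⁻ w, T2 (v, w)) + (∫⁻ v, ∫⁻ w, T3 (v, w)) := by
  have e : ∀ v, ∫⁻ w, (T1 (v, w) + T2 (v, w) + T3 (v, w)) =
      (∫⁻ w, T1 (v, w)) + (∫⁻ w, T2 (v, w)) + (∫⁻ w, T3 (v, w)) := by
    intro v
    have k3 : Measurable (fun w => T3 (v, w)) := m3.comp measurable_prodMk_left
    have k2 : Measurable (fun w => T2 (v, w)) := m2.comp measurable_prodMk_left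
    rw [lintegral_add_right _ k3, lintegral_add_right _ k2]
  simp_rw [e]
  rw [lintegral_add_right _ m3.lintegral_prod_right', lintegral_add_right _ m2.lintegral_prod_right']

set_option maxHeartbeats 1000000 in
theorem er_bterm (φ : SchwartzMap V3 ℝ) (hf0 : ∀ v, 0 ≤ φ v) (hm : ∫ v, φ v = 1) {k : ℝ} (hk : 0 ≤ k)
    {r : ℝ} (h0 : 0 < r) (h1 : r ≤ 1) (v₀ : V3) :
    ∫ v, erφ r v₀ v ^ 22 * (erg φ k v ^ 4 * erB φ v) ≤
      erCb * ((∫ v, erφ r v₀ v ^ 18 * erg φ k v ^ 4) + (∫ v, erφ r v₀ v ^ 24 * (k * erg φ k v ^ 4)) +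
        ∫ v, erφ r v₀ v ^ 24 * erg φ k v ^ 5) := by
  have hgc : Continuous (erg φ k) := erg_cont φ.continuous k
  have hpc := erφ_cont r v₀
  have hp := erφ_nonneg r v₀
  have hg := erg_nonneg φ k
  have hC1 := erC1_nonneg
  have hfm : Measurable (φ : V3 → ℝ) := φ.continuous.measurable
  have hgm := hgc.measurable
  have hpm := hpc.measurable
  have i18 : Integrable (fun v => erφ r v₀ v ^ 18 * erg φ k v ^ 4) := er_cs_int (a := 17) r h0.le v₀ (by fun_prop)
  have i24a : Integrable (fun v => erφ r v₀ v ^ 24 * (k * erg φ k v ^ 4)) := er_cs_int (a := 23) r h0.le v₀ (by fun_prop)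
  have i24b : Integrable (fun v => erφ r v₀ v ^ 24 * erg φ k v ^ 5) := er_cs_int (a := 23) r h0.le v₀ (by fun_prop)
  have n18 : 0 ≤ ∫ v, erφ r v₀ v ^ 18 * erg φ k v ^ 4 :=
    integral_nonneg fun v => mul_nonneg (pow_nonneg (hp v) _) (pow_nonneg (hg v) _)
  have n24a : 0 ≤ ∫ v, erφ r v₀ v ^ 24 * (k * erg φ k v ^ 4) :=
    integral_nonneg fun v => mul_nonneg (pow_nonneg (hp v) _) (mul_nonneg hk (pow_nonneg (hg v) _))
  have n24b : 0 ≤ ∫ v, erφ r v₀ v ^ 24 * erg φ k v ^ 5 :=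
    integral_nonneg fun v => mul_nonneg (pow_nonneg (hp v) _) (pow_nonneg (hg v) _)
  -- ENNReal estimate
  have hB : ∀ v, ENNReal.ofReal (erφ r v₀ v ^ 22 * (erg φ k v ^ 4 * erB φ v)) =
      ∫⁻ w, ENNReal.ofReal (erφ r v₀ v ^ 22 * erg φ k v ^ 4 * ((‖v - w‖ ^ 2)⁻¹ * φ w)) := by
    intro v
    have e1 : erB φ v = ∫ w, (‖v - w‖ ^ 2)⁻¹ * φ w := by
      unfold erB
      rw [← integral_sub_left_eq_self _ _ v]
      congr 1; ext z; rw [sub_sub_cancel]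
    have e2 : Integrable (fun w => (‖v - w‖ ^ 2)⁻¹ * φ w) := by
      have := (erB_int φ v).comp_sub_left v
      refine this.congr (Filter.Eventually.of_forall fun z => ?_)
      simp only [sub_sub_cancel]
    rw [← mul_assoc, e1, ← integral_const_mul, ofReal_integral_eq_lintegral_ofReal (e2.const_mul _)]
    exact Filter.Eventually.of_forall fun w => by
      have := hf0 w; have := hp v; have := hg v; positivity
  have main : ∫⁻ v, ENNReal.ofReal (erφ r v₀ v ^ 22 * (erg φ k v ^ 4 * erB φ v)) ≤
      ENNReal.ofReal (erCb * ((∫ v, erφ r v₀ v ^ 18 * erg φ k v ^ 4) + (∫ v, erφ r v₀ v ^ 24 * (k * erg φ k v ^ 4)) +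
        ∫ v, erφ r v₀ v ^ 24 * erg φ k v ^ 5)) := by
    set a1 : V3 → ℝ := fun v => 64 * (erφ r v₀ v ^ 18 * erg φ k v ^ 4) with ha1
    set a2 : V3 → ℝ := fun v => k * (erφ r v₀ v ^ 22 * erg φ k v ^ 4) + erφ r v₀ v ^ 22 * erg φ k v ^ 5 with ha2
    set a3 : V3 → ℝ := fun v => 2 ^ 22 * (erφ r v₀ v ^ 22 * erg φ k v ^ 5) with ha3
    have p1 : ∀ v, 0 ≤ a1 v := fun v => by have := hp v; have := hg v; positivity
    have p2 : ∀ v, 0 ≤ a2 v := fun v => by have := hp v; have := hg v; positivity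
    have p3 : ∀ v, 0 ≤ a3 v := fun v => by have := hp v; have := hg v; positivity
    have m1 : Measurable a1 := by fun_prop
    have m2 : Measurable a2 := by fun_prop
    have m3 : Measurable a3 := by fun_prop
    have mJ1 : Measurable (fun x : V3 × V3 => ENNReal.ofReal (erJ (erφ r v₀ x.1 ^ 2 / 8) (x.1 - x.2))) :=
      (erJ_meas (by fun_prop)).ennreal_ofReal
    have mJ2 : Measurable (fun x : V3 × V3 => ENNReal.ofReal (erJ (erφ r v₀ x.2 ^ 2 / 2) (x.1 - x.2))) :=
      (erJ_meas (by fun_prop)).ennreal_ofReal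
    have mT1 : Measurable (fun x : V3 × V3 => ENNReal.ofReal (a1 x.1) * ENNReal.ofReal (φ x.2)) := by fun_prop
    have mT2 : Measurable (fun x : V3 × V3 => ENNReal.ofReal (a2 x.1) * ENNReal.ofReal (erJ (erφ r v₀ x.1 ^ 2 / 8) (x.1 - x.2))) :=
      (by fun_prop : Measurable (fun x : V3 × V3 => ENNReal.ofReal (a2 x.1))).mul mJ1
    have mT3 : Measurable (fun x : V3 × V3 => ENNReal.ofReal (a3 x.2) * ENNReal.ofReal (erJ (erφ r v₀ x.2 ^ 2 / 2) (x.1 - x.2))) :=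
      (by fun_prop : Measurable (fun x : V3 × V3 => ENNReal.ofReal (a3 x.2))).mul mJ2
    have hmass : ∫⁻ w, ENNReal.ofReal (φ w) = 1 := by
      rw [← ofReal_integral_eq_lintegral_ofReal φ.integrable (Filter.Eventually.of_forall hf0), hm]; simp
    have I1 : ∫⁻ v, ∫⁻ w, ENNReal.ofReal (a1 v) * ENNReal.ofReal (φ w) = ENNReal.ofReal (64 * ∫ v, erφ r v₀ v ^ 18 * erg φ k v ^ 4) := by
      have : ∀ v, ∫⁻ w, ENNReal.ofReal (a1 v) * ENNReal.ofReal (φ w) = ENNReal.ofReal (a1 v) := fun v => by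
        rw [lintegral_const_mul _ hfm.ennreal_ofReal, hmass, mul_one]
      simp_rw [this]
      rw [← ofReal_integral_eq_lintegral_ofReal (i18.const_mul 64) (Filter.Eventually.of_forall p1), integral_const_mul]
    have I2 : ∫⁻ v, ∫⁻ w, ENNReal.ofReal (a2 v) * ENNReal.ofReal (erJ (erφ r v₀ v ^ 2 / 8) (v - w)) =
        ENNReal.ofReal (erC1 / 8 * ((∫ v, erφ r v₀ v ^ 24 * (k * erg φ k v ^ 4)) + ∫ v, erφ r v₀ v ^ 24 * erg φ k v ^ 5)) := by
      have : ∀ v, ∫⁻ w, ENNReal.ofReal (a2 v) * ENNReal.ofReal (erJ (erφ r v₀ v ^ 2 / 8) (v - w)) =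
          ENNReal.ofReal (erC1 / 8 * (erφ r v₀ v ^ 24 * (k * erg φ k v ^ 4) + erφ r v₀ v ^ 24 * erg φ k v ^ 5)) := fun v => by
        rw [lintegral_const_mul' _ _ ENNReal.ofReal_ne_top, erJ_lint v (by positivity), ← ENNReal.ofReal_mul (p2 v)]
        congr 1; rw [ha2]; ring
      simp_rw [this]
      have i24 : Integrable (fun v => erφ r v₀ v ^ 24 * (k * erg φ k v ^ 4) + erφ r v₀ v ^ 24 * erg φ k v ^ 5) := i24a.add i24b
      rw [← ofReal_integral_eq_lintegral_ofReal (i24.const_mul _), integral_const_mul, integral_add i24a i24b]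
      · exact Filter.Eventually.of_forall fun v => by
          have := hp v; have := hg v; simp only [Pi.zero_apply]; positivity
    have I3 : ∫⁻ v, ∫⁻ w, ENNReal.ofReal (a3 w) * ENNReal.ofReal (erJ (erφ r v₀ w ^ 2 / 2) (v - w)) =
        ENNReal.ofReal (erC1 * 2 ^ 21 * ∫ v, erφ r v₀ v ^ 24 * erg φ k v ^ 5) := by
      rw [lintegral_lintegral_swap mT3.aemeasurable]
      have : ∀ w, ∫⁻ v, ENNReal.ofReal (a3 w) * ENNReal.ofReal (erJ (erφ r v₀ w ^ 2 / 2) (v - w)) =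
          ENNReal.ofReal (erC1 * 2 ^ 21 * (erφ r v₀ w ^ 24 * erg φ k w ^ 5)) := fun w => by
        rw [lintegral_const_mul' _ _ ENNReal.ofReal_ne_top, erJ_lint' w (by positivity), ← ENNReal.ofReal_mul (p3 w)]
        congr 1; rw [ha3]; ring
      simp_rw [this]
      rw [← ofReal_integral_eq_lintegral_ofReal (i24b.const_mul _), integral_const_mul]
      exact Filter.Eventually.of_forall fun v => by
          have := hp v; have := hg v; simp only [Pi.zero_apply]; positivity
    calc ∫⁻ v, ENNReal.ofReal (erφ r v₀ v ^ 22 * (erg φ k v ^ 4 * erB φ v))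
        = ∫⁻ v, ∫⁻ w, ENNReal.ofReal (erφ r v₀ v ^ 22 * erg φ k v ^ 4 * ((‖v - w‖ ^ 2)⁻¹ * φ w)) := by
          simp_rw [hB]
      _ ≤ ∫⁻ v, ∫⁻ w, (ENNReal.ofReal (a1 v) * ENNReal.ofReal (φ w) +
            ENNReal.ofReal (a2 v) * ENNReal.ofReal (erJ (erφ r v₀ v ^ 2 / 8) (v - w)) +
            ENNReal.ofReal (a3 w) * ENNReal.ofReal (erJ (erφ r v₀ w ^ 2 / 2) (v - w))) := by
          refine lintegral_mono fun v => lintegral_mono fun w => ?_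
          have hJ1 := erJ_nonneg (erφ r v₀ v ^ 2 / 8) (v - w)
          have hJ2 := erJ_nonneg (erφ r v₀ w ^ 2 / 2) (v - w)
          simp only []
          rw [← ENNReal.ofReal_mul (p1 v), ← ENNReal.ofReal_mul (p2 v), ← ENNReal.ofReal_mul (p3 w),
            ← ENNReal.ofReal_add (mul_nonneg (p1 v) (hf0 w)) (mul_nonneg (p2 v) hJ1),
            ← ENNReal.ofReal_add (add_nonneg (mul_nonneg (p1 v) (hf0 w)) (mul_nonneg (p2 v) hJ1)) (mul_nonneg (p3 w) hJ2)]
          exact ENNReal.ofReal_le_ofReal (er_bpt hf0 hk h0 h1 v₀ v w)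
      _ = (∫⁻ v, ∫⁻ w, ENNReal.ofReal (a1 v) * ENNReal.ofReal (φ w)) +
          (∫⁻ v, ∫⁻ w, ENNReal.ofReal (a2 v) * ENNReal.ofReal (erJ (erφ r v₀ v ^ 2 / 8) (v - w))) +
          (∫⁻ v, ∫⁻ w, ENNReal.ofReal (a3 w) * ENNReal.ofReal (erJ (erφ r v₀ w ^ 2 / 2) (v - w))) := by
          exact er_lint3 mT1 mT2 mT3
      _ ≤ _ := by
          rw [I1, I2, I3, ← ENNReal.ofReal_add (by positivity) (by positivity), ← ENNReal.ofReal_add (by positivity) (by positivity)]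
          apply ENNReal.ofReal_le_ofReal
          unfold erCb
          nlinarith [mul_nonneg hC1 n18, mul_nonneg hC1 n24a, mul_nonneg hC1 n24b]
  have hBc := erB_cont φ
  have hBn := erB_nonneg φ hf0
  have iB : Integrable (fun v => erφ r v₀ v ^ 22 * (erg φ k v ^ 4 * erB φ v)) :=
    er_cs_int (a := 21) r h0.le v₀ (by fun_prop)
  rw [← ofReal_integral_eq_lintegral_ofReal iB] at main
  · exact (ENNReal.ofReal_le_ofReal_iff (mul_nonneg erCb_pos.le (by positivity))).1 main
  · exact Filter.Eventually.of_forall fun v => mul_nonneg (pow_nonneg (hp v) _) (mul_nonneg (pow_nonneg (hg v) _) (hBn v))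


/-! ### Sobolev inequality -/

theorem er_fderiv_norm_sq (u : V3 → ℝ) (v : V3) : ‖fderiv ℝ u v‖ ^ 2 ≤ 3 * ∑ i : Fin 3, pd i u v ^ 2 := by
  have h1 : ‖fderiv ℝ u v‖ ≤ ∑ i : Fin 3, |pd i u v| := by
    refine ContinuousLinearMap.opNorm_le_bound _ (Finset.sum_nonneg fun i _ => abs_nonneg _) fun w => ?_
    have hw : w = ∑ i : Fin 3, w i • (EuclideanSpace.single i (1:ℝ) : V3) := by
      ext j; fin_cases j <;> simp [Fin.sum_univ_three]
    have e : fderiv ℝ u v w = ∑ i : Fin 3, w i * pd i u v := by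
      conv_lhs => rw [hw]
      simp [map_sum, pd]
    rw [e, Finset.sum_mul, Real.norm_eq_abs]
    refine (Finset.abs_sum_le_sum_abs _ _).trans (Finset.sum_le_sum fun i _ => ?_)
    rw [abs_mul, mul_comm]
    exact mul_le_mul_of_nonneg_left (er_abs_coord w i) (abs_nonneg _)
  have h2 : ‖fderiv ℝ u v‖ ^ 2 ≤ (∑ i : Fin 3, |pd i u v|) ^ 2 := pow_le_pow_left₀ (norm_nonneg _) h1 2
  refine h2.trans ?_
  simp only [Fin.sum_univ_three]
  rw [← sq_abs (pd 0 u v), ← sq_abs (pd 1 u v), ← sq_abs (pd 2 u v)]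
  nlinarith [sq_nonneg (|pd 0 u v| - |pd 1 u v|), sq_nonneg (|pd 0 u v| - |pd 2 u v|), sq_nonneg (|pd 1 u v| - |pd 2 u v|)]

/-- Sobolev constant. -/
def erS : ℝ := 3 * ((SNormLESNormFDerivOfEqConst ℝ (volume : Measure V3) 2 : NNReal) : ℝ) ^ 2

theorem erS_nonneg : 0 ≤ erS := by unfold erS; positivity

set_option maxHeartbeats 1000000 in
theorem er_sobolev {u : V3 → ℝ} (hu : ContDiff ℝ 1 u) (hs : HasCompactSupport u) :
    (∫ v, u v ^ 6) ^ ((1:ℝ)/3) ≤ erS * ∫ v, ∑ i : Fin 3, pd i u v ^ 2 := by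
  have h := eLpNorm_le_eLpNorm_fderiv_of_eq (μ := (volume : Measure V3)) hu hs (p := 2) (p' := 6) (by norm_num)
    (by simp) (by simp; norm_num)
  have hdc : Continuous (fderiv ℝ u) := hu.continuous_fderiv one_ne_zero
  have hds : HasCompactSupport (fderiv ℝ u) := hs.fderiv (𝕜 := ℝ)
  have m6 : MemLp u ((6 : NNReal) : ENNReal) volume := hu.continuous.memLp_of_hasCompactSupport hs
  have m2 : MemLp (fderiv ℝ u) ((2 : NNReal) : ENNReal) volume := hdc.memLp_of_hasCompactSupport hds
  rw [m6.eLpNorm_eq_integral_rpow_norm (by norm_num) (by norm_num),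
    m2.eLpNorm_eq_integral_rpow_norm (by norm_num) (by norm_num)] at h
  simp only [ENNReal.coe_toReal, NNReal.coe_ofNat] at h
  have e6 : ∀ v, ‖u v‖ ^ (6:ℝ) = u v ^ 6 := fun v => by
    rw [show (6:ℝ) = ((6:ℕ):ℝ) by norm_num, Real.rpow_natCast, Real.norm_eq_abs, Even.pow_abs (by decide)]
  have e2 : ∀ v, ‖fderiv ℝ u v‖ ^ (2:ℝ) = ‖fderiv ℝ u v‖ ^ 2 := fun v => by
    rw [show (2:ℝ) = ((2:ℕ):ℝ) by norm_num, Real.rpow_natCast]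
  simp_rw [e6, e2] at h
  have n6 : 0 ≤ ∫ v, u v ^ 6 := integral_nonneg fun v => by positivity
  have n2 : 0 ≤ ∫ v, ‖fderiv ℝ u v‖ ^ 2 := integral_nonneg fun v => by positivity
  set S := SNormLESNormFDerivOfEqConst ℝ (volume : Measure V3) 2 with hS
  rw [← ENNReal.ofReal_coe_nnreal, ← ENNReal.ofReal_mul S.coe_nonneg, ENNReal.ofReal_le_ofReal_iff (mul_nonneg S.coe_nonneg (by positivity))] at h
  have h2 := pow_le_pow_left₀ (by positivity) h 2
  have e3 : ((∫ v, u v ^ 6) ^ ((6:ℝ)⁻¹)) ^ 2 = (∫ v, u v ^ 6) ^ ((1:ℝ)/3) := by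
    rw [← Real.rpow_natCast, ← Real.rpow_mul n6]; norm_num
  have e4 : ((∫ v, ‖fderiv ℝ u v‖ ^ 2) ^ ((2:ℝ)⁻¹)) ^ 2 = ∫ v, ‖fderiv ℝ u v‖ ^ 2 := by
    rw [← Real.rpow_natCast, ← Real.rpow_mul n2]; norm_num
  rw [mul_pow, e3, e4] at h2
  refine h2.trans ?_
  have c1 : HasCompactSupport (fun v => ‖fderiv ℝ u v‖ ^ 2) := by
    refine hds.mono fun v hv => ?_
    rw [Function.mem_support] at hv ⊢
    intro h0; apply hv; rw [h0]; simp
  have c2 : HasCompactSupport (fun v => 3 * ∑ i : Fin 3, pd i u v ^ 2) := by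
    refine hds.mono fun v hv => ?_
    rw [Function.mem_support] at hv ⊢
    intro h0; apply hv; simp [pd, h0]
  have h3 : ∫ v, ‖fderiv ℝ u v‖ ^ 2 ≤ ∫ v, 3 * ∑ i : Fin 3, pd i u v ^ 2 := by
    refine integral_mono ?_ ?_ fun v => er_fderiv_norm_sq u v
    · exact (hdc.norm.pow 2).integrable_of_hasCompactSupport c1
    · refine Continuous.integrable_of_hasCompactSupport ?_ ?_
      · have := fun i => er_pd_cont hu i
        fun_prop
      · exact c2
  rw [integral_const_mul] at h3
  unfold erS
  calc (S:ℝ) ^ 2 * ∫ v, ‖fderiv ℝ u v‖ ^ 2 ≤ (S:ℝ) ^ 2 * (3 * ∫ v, ∑ i : Fin 3, pd i u v ^ 2) := by gcongr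
    _ = _ := by ring


/-! ### The energy inequality at a fixed time -/

theorem er_alg (A : Matrix (Fin 3) (Fin 3) ℝ) (hA : ∀ i j, A i j = A j i) (d u a : Fin 3 → ℝ)
    (p g F k B lam : ℝ) (hp : 0 ≤ p) (hp1 : p ≤ 1) (hB : 0 ≤ B) (hlam : 0 ≤ lam)
    (hgF : g * F = g * (g + k)) (hge : matGE lam A) (hAb : ∀ i j, |A i j| ≤ B + 1) (hab : ∀ i, |a i| ≤ B)
    (hd : ∀ i, |d i| ≤ 2) :
    ∑ i : Fin 3, (-(4 * ((24 * p ^ 23 * d i * g ^ 3 + p ^ 24 * (3 * g ^ 2 * u i)) * (∑ j, A i j * u j - a i * F)))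
      - (3 * (24 * p ^ 23 * d i * g ^ 4 + p ^ 24 * (4 * g ^ 3 * u i)) +
         4 * k * (24 * p ^ 23 * d i * g ^ 3 + p ^ 24 * (3 * g ^ 2 * u i))) * a i) ≤
      -(6 * lam * (p ^ 24 * (g ^ 2 * ∑ i, u i ^ 2))) + 14000 * (p ^ 22 * (g ^ 4 * (B + 1))) := by
  have H1 := hge (fun i => p ^ 12 * g * u i + 8 * (p ^ 11 * g ^ 2 * d i))
  have H1' : 0 ≤ lam * ∑ i, (p ^ 12 * g * u i + 8 * (p ^ 11 * g ^ 2 * d i)) ^ 2 :=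
    mul_nonneg hlam (Finset.sum_nonneg fun i _ => sq_nonneg _)
  have H2 := hge (fun i => p ^ 12 * g * u i)
  have H3 : ∑ i, ∑ j, A i j * d i * d j ≤ 36 * (B + 1) := by
    have : ∀ i ∈ Finset.univ, ∀ j ∈ Finset.univ, A i j * d i * d j ≤ 4 * (B + 1) := by
      intro i _ j _
      refine (le_abs_self _).trans ?_
      rw [abs_mul, abs_mul]
      have h1 := hAb i j; have h2 := hd i; have h3 := hd j
      calc |A i j| * |d i| * |d j| ≤ (B + 1) * 2 * 2 := by gcongr
        _ = _ := by ring
    calc ∑ i, ∑ j, A i j * d i * d j ≤ ∑ i : Fin 3, ∑ j : Fin 3, 4 * (B + 1) :=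
          Finset.sum_le_sum fun i hi => Finset.sum_le_sum fun j hj => this i hi j hj
      _ = _ := by simp; ring
  have H4 : ∑ i, a i * d i ≤ 6 * B := by
    calc ∑ i, a i * d i ≤ ∑ i : Fin 3, 2 * B := by
          refine Finset.sum_le_sum fun i _ => (le_abs_self _).trans ?_
          rw [abs_mul]
          have h1 := hab i; have h2 := hd i
          calc |a i| * |d i| ≤ B * 2 := by gcongr
            _ = _ := by ring
      _ = _ := by simp; ring
  have w1 : 0 ≤ p ^ 22 * g ^ 4 := by positivity
  have w2 : 0 ≤ p ^ 23 * g ^ 4 := by positivity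
  have H3' := mul_le_mul_of_nonneg_left H3 w1
  have H4' := mul_le_mul_of_nonneg_left H4 w2
  have H5 : p ^ 23 * g ^ 4 * B ≤ p ^ 22 * g ^ 4 * B := by
    have : p ^ 23 ≤ p ^ 22 := pow_le_pow_of_le_one hp hp1 (by norm_num)
    gcongr
  have H6 : 0 ≤ p ^ 22 * g ^ 4 * B := by positivity
  have s10 := hA 1 0
  have s20 := hA 2 0
  have s21 := hA 2 1
  have g3 : ∀ i, a i * (24 * p ^ 23 * d i * g ^ 3 + p ^ 24 * (3 * g ^ 2 * u i)) * F =
      a i * (24 * p ^ 23 * d i * g ^ 2 + p ^ 24 * (3 * g * u i)) * (g * (g + k)) := fun i => by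
    rw [← hgF]; ring
  have e : ∑ i : Fin 3, (-(4 * ((24 * p ^ 23 * d i * g ^ 3 + p ^ 24 * (3 * g ^ 2 * u i)) * (∑ j, A i j * u j - a i * F)))
      - (3 * (24 * p ^ 23 * d i * g ^ 4 + p ^ 24 * (4 * g ^ 3 * u i)) +
         4 * k * (24 * p ^ 23 * d i * g ^ 3 + p ^ 24 * (3 * g ^ 2 * u i))) * a i) =
      ∑ i : Fin 3, (-(4 * ((24 * p ^ 23 * d i * g ^ 3 + p ^ 24 * (3 * g ^ 2 * u i)) * (∑ j, A i j * u j))) +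
        24 * (p ^ 23 * g ^ 4) * (a i * d i)) := by
    refine Finset.sum_congr rfl fun i _ => ?_
    linear_combination 4 * g3 i
  rw [e]
  have key : ∑ i : Fin 3, (-(4 * ((24 * p ^ 23 * d i * g ^ 3 + p ^ 24 * (3 * g ^ 2 * u i)) * (∑ j, A i j * u j))) +
        24 * (p ^ 23 * g ^ 4) * (a i * d i)) =
      -6 * (∑ i, ∑ j, A i j * (p ^ 12 * g * u i + 8 * (p ^ 11 * g ^ 2 * d i)) * (p ^ 12 * g * u j + 8 * (p ^ 11 * g ^ 2 * d j)))
      - 6 * (∑ i, ∑ j, A i j * (p ^ 12 * g * u i) * (p ^ 12 * g * u j)) +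
      384 * (p ^ 22 * g ^ 4 * ∑ i, ∑ j, A i j * d i * d j) + 24 * (p ^ 23 * g ^ 4 * ∑ i, a i * d i) := by
    simp only [Fin.sum_univ_three]
    rw [s10, s20, s21]
    ring
  have k2 : lam * ∑ i, (p ^ 12 * g * u i) ^ 2 = lam * (p ^ 24 * (g ^ 2 * ∑ i, u i ^ 2)) := by
    simp only [Fin.sum_univ_three]; ring
  rw [key]
  rw [k2] at H2
  linarith

theorem erd_bound {v₀ v : V3} (h : ‖v - v₀‖ ≤ 1) (i : Fin 3) : |erd v₀ i v| ≤ 2 := by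
  unfold erd
  rw [abs_mul]
  have := er_abs_coord (v - v₀) i
  norm_num
  norm_num at this
  linarith


theorem er_schwartz_C1 (φ : SchwartzMap V3 ℝ) : ContDiff ℝ 1 φ := φ.smooth 1

theorem er_schwartz_pd_C1 (φ : SchwartzMap V3 ℝ) (i : Fin 3) : ContDiff ℝ 1 (pd i φ) := by
  obtain ⟨ψ, hψ⟩ := er_pd_schwartz φ i
  rw [← funext hψ]; exact ψ.smooth 1

/-- flux -/
def erF (f : V3 → ℝ) (i : Fin 3) (u : V3) : ℝ := (∑ j : Fin 3, Amat f u i j * pd j f u) - pd i (apot f) u * f u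

theorem erF_C1 (φ : SchwartzMap V3 ℝ) (i : Fin 3) : ContDiff ℝ 1 (erF φ i) := by
  unfold erF
  refine ContDiff.sub (ContDiff.sum fun j _ => (er_Amat_C1 φ i j).mul (er_schwartz_pd_C1 φ j)) ?_
  exact (er_apot_pd_C1 φ i).mul (er_schwartz_C1 φ)

theorem er_landau_eq (f : V3 → ℝ) (v : V3) : landauRHS f v = ∑ i : Fin 3, pd i (erF f i) v := rfl

theorem er_landau_cont (φ : SchwartzMap V3 ℝ) : Continuous (landauRHS φ) := by
  have : landauRHS φ = fun v => ∑ i : Fin 3, pd i (erF φ i) v := funext fun v => er_landau_eq φ v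
  rw [this]
  exact continuous_finsetSum _ fun i _ => er_pd_cont (erF_C1 φ i) i

set_option maxHeartbeats 1000000 in
theorem er_energy0 (φ : SchwartzMap V3 ℝ) (hf0 : ∀ v, 0 ≤ φ v) (hm : ∫ v, φ v = 1) {k : ℝ}
    {r : ℝ} (h0 : 0 < r) (h1 : r ≤ 1) (v₀ : V3) {lam : ℝ} (hlam : 0 ≤ lam)
    (hge : ∀ v, ‖v - v₀‖ ≤ 1 → matGE lam (Amat φ v)) :
    (∫ v, erφ r v₀ v ^ 24 * (4 * erg φ k v ^ 3 * landauRHS φ v)) +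
      6 * lam * (∫ v, erφ r v₀ v ^ 24 * (erg φ k v ^ 2 * ∑ i : Fin 3, pd i φ v ^ 2)) ≤
    14000 * (∫ v, erφ r v₀ v ^ 22 * (erg φ k v ^ 4 * (erB φ v + 1))) +
      erκ * ∫ v, erφ r v₀ v ^ 24 * (3 * erg φ k v ^ 5 + 7 * (k * erg φ k v ^ 4) + 4 * (k ^ 2 * erg φ k v ^ 3)) := by
  have hgc : Continuous (erg φ k) := erg_cont φ.continuous k
  have hpc := erφ_cont r v₀
  have hBc := erB_cont φ
  have hfc := φ.continuous
  have hpd : ∀ i, Continuous (pd i φ) := fun i => (er_schwartz_pd_C1 φ i).continuous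
  have had : ∀ i, Continuous (pd i (apot φ)) := fun i => (er_apot_pd_C1 φ i).continuous
  have hFc : ∀ i, Continuous (erF φ i) := fun i => (erF_C1 φ i).continuous
  have w3 : ContDiff ℝ 1 (fun v => erφ r v₀ v ^ 24 * erg φ k v ^ 3) :=
    (erφ_pow_C1 r v₀ 22).mul (erg_pow_C1 (er_schwartz_C1 φ) k 1)
  have w4 : ContDiff ℝ 1 (fun v => erφ r v₀ v ^ 24 * erg φ k v ^ 4) :=
    (erφ_pow_C1 r v₀ 22).mul (erg_pow_C1 (er_schwartz_C1 φ) k 2)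
  have s3 : HasCompactSupport (fun v => erφ r v₀ v ^ 24 * erg φ k v ^ 3) := er_cs (a := 23) r h0.le v₀ _
  have s4 : HasCompactSupport (fun v => erφ r v₀ v ^ 24 * erg φ k v ^ 4) := er_cs (a := 23) r h0.le v₀ _
  have hfd : Differentiable ℝ φ := φ.differentiable
  have d3 : ∀ i v, pd i (fun v => erφ r v₀ v ^ 24 * erg φ k v ^ 3) v =
      24 * erφ r v₀ v ^ 23 * erd v₀ i v * erg φ k v ^ 3 + erφ r v₀ v ^ 24 * (3 * erg φ k v ^ 2 * pd i φ v) := by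
    intro i v
    have := er_pd_prod hfd r v₀ k 22 1 i v
    norm_num at this
    exact this
  have d4 : ∀ i v, pd i (fun v => erφ r v₀ v ^ 24 * erg φ k v ^ 4) v =
      24 * erφ r v₀ v ^ 23 * erd v₀ i v * erg φ k v ^ 4 + erφ r v₀ v ^ 24 * (4 * erg φ k v ^ 3 * pd i φ v) := by
    intro i v
    have := er_pd_prod hfd r v₀ k 22 2 i v
    norm_num at this
    exact this
  have hedc : ∀ i, Continuous (erd v₀ i) := fun i => by unfold erd; fun_prop
  have sp : ∀ {ψ : V3 → ℝ}, ContDiff ℝ 1 ψ → HasCompactSupport ψ → ∀ {h : V3 → ℝ}, Continuous h → ∀ i,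
      Integrable (fun v => pd i ψ v * h v) := by
    intro ψ c1 c2 h c3 i
    have h1 : HasCompactSupport (pd i ψ) := by
      have := c2.fderiv (𝕜 := ℝ)
      exact this.comp_left (g := fun L : V3 →L[ℝ] ℝ => L (EuclideanSpace.single i 1)) (by simp)
    exact ((er_pd_cont c1 i).mul c3).integrable_of_hasCompactSupport h1.mul_right
  set ψ3 : V3 → ℝ := fun v => erφ r v₀ v ^ 24 * erg φ k v ^ 3 with hψ3
  set ψ4 : V3 → ℝ := fun v => erφ r v₀ v ^ 24 * erg φ k v ^ 4 with hψ4
  -- first integration by parts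
  have E1 : ∫ v, erφ r v₀ v ^ 24 * (4 * erg φ k v ^ 3 * landauRHS φ v) =
      ∫ v, ∑ i : Fin 3, -(4 * (pd i ψ3 v * erF φ i v)) := by
    have e1 : ∀ v, erφ r v₀ v ^ 24 * (4 * erg φ k v ^ 3 * landauRHS φ v) = ∑ i : Fin 3, 4 * (ψ3 v * pd i (erF φ i) v) := by
      intro v
      rw [er_landau_eq, ← Finset.mul_sum, ← Finset.mul_sum, hψ3]; ring
    simp_rw [e1]
    rw [integral_finsetSum, integral_finsetSum]
    · refine Finset.sum_congr rfl fun i _ => ?_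
      rw [integral_const_mul, er_ibp_cs w3 (erF_C1 φ i) s3 i, integral_neg, integral_const_mul]; ring
    · intro i _
      exact ((sp w3 s3 (hFc i) i).const_mul 4).neg
    · intro i _
      exact ((w3.continuous.mul (er_pd_cont (erF_C1 φ i) i)).integrable_of_hasCompactSupport s3.mul_right).const_mul 4
  have E2 : ∀ {ψ : V3 → ℝ}, ContDiff ℝ 1 ψ → HasCompactSupport ψ →
      ∫ v, ∑ i : Fin 3, pd i ψ v * pd i (apot φ) v = erκ * ∫ v, ψ v * φ v := by
    intro ψ c1 c2
    rw [integral_finsetSum _ fun i _ => sp c1 c2 (had i) i]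
    have : ∀ i ∈ Finset.univ, ∫ v, pd i ψ v * pd i (apot φ) v = - ∫ v, ψ v * pd i (pd i (apot φ)) v := fun i _ => by
      rw [er_ibp_cs c1 (er_apot_pd_C1 φ i) c2 i, neg_neg]
    rw [Finset.sum_congr rfl this, Finset.sum_neg_distrib, ← integral_finsetSum, ← integral_const_mul, ← integral_neg]
    · congr 1; ext v
      rw [← Finset.mul_sum, er_laplace_apot]; ring
    · intro i _
      exact (c1.continuous.mul (er_pd_cont (er_apot_pd_C1 φ i) i)).integrable_of_hasCompactSupport c2.mul_right
  have i3 : Integrable (fun v => ∑ i : Fin 3, pd i ψ3 v * pd i (apot φ) v) :=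
    integrable_finsetSum _ fun i _ => sp w3 s3 (had i) i
  have i4 : Integrable (fun v => ∑ i : Fin 3, pd i ψ4 v * pd i (apot φ) v) :=
    integrable_finsetSum _ fun i _ => sp w4 s4 (had i) i
  have iF : Integrable (fun v => ∑ i : Fin 3, -(4 * (pd i ψ3 v * erF φ i v))) :=
    integrable_finsetSum _ fun i _ => ((sp w3 s3 (hFc i) i).const_mul 4).neg
  have iD : Integrable (fun v => erφ r v₀ v ^ 24 * (erg φ k v ^ 2 * ∑ i : Fin 3, pd i φ v ^ 2)) :=
    er_cs_int (a := 23) r h0.le v₀ (by fun_prop)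
  have iB : Integrable (fun v => erφ r v₀ v ^ 22 * (erg φ k v ^ 4 * (erB φ v + 1))) :=
    er_cs_int (a := 21) r h0.le v₀ (by fun_prop)
  have pt : ∀ v, (∑ i : Fin 3, -(4 * (pd i ψ3 v * erF φ i v))) -
      3 * (∑ i : Fin 3, pd i ψ4 v * pd i (apot φ) v) - 4 * k * (∑ i : Fin 3, pd i ψ3 v * pd i (apot φ) v) ≤
      -(6 * lam * (erφ r v₀ v ^ 24 * (erg φ k v ^ 2 * ∑ i : Fin 3, pd i φ v ^ 2))) +
        14000 * (erφ r v₀ v ^ 22 * (erg φ k v ^ 4 * (erB φ v + 1))) := by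
    intro v
    by_cases hv : r ≤ ‖v - v₀‖
    · have hz : erφ r v₀ v = 0 := erφ_eq_zero h0.le hv
      simp [d3, d4, hz]
    · push Not at hv
      have hv1 : ‖v - v₀‖ ≤ 1 := by linarith
      have hgF : erg φ k v * φ v = erg φ k v * (erg φ k v + k) := by
        unfold erg
        rcases le_total (φ v - k) 0 with h | h
        · rw [max_eq_right h]; ring
        · rw [max_eq_left h]; ring
      have key := er_alg (Amat φ v) (er_Amat_symm φ v) (fun i => erd v₀ i v) (fun i => pd i φ v)
        (fun i => pd i (apot φ) v) (erφ r v₀ v) (erg φ k v) (φ v) k (erB φ v) lam (erφ_nonneg _ _ _)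
        (erφ_le_one h0.le h1 _ _) (erB_nonneg φ hf0 v) hlam hgF (hge v hv1)
        (fun i j => er_Amat_bound φ hf0 hm i j v) (fun i => er_pd_apot_bound φ hf0 i v) (fun i => erd_bound hv1 i)
      refine le_trans (le_of_eq ?_) key
      rw [Finset.mul_sum, Finset.mul_sum, ← Finset.sum_sub_distrib, ← Finset.sum_sub_distrib]
      refine Finset.sum_congr rfl fun i _ => ?_
      rw [d3, d4]
      unfold erF
      ring
  have main := integral_mono ((iF.sub (i4.const_mul 3)).sub (i3.const_mul (4 * k)))
    ((iD.const_mul (6 * lam)).neg.add (iB.const_mul 14000)) pt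
  have eL : ∫ v, ((∑ i : Fin 3, -(4 * (pd i ψ3 v * erF φ i v))) -
      3 * (∑ i : Fin 3, pd i ψ4 v * pd i (apot φ) v) - 4 * k * (∑ i : Fin 3, pd i ψ3 v * pd i (apot φ) v)) =
      (∫ v, ∑ i : Fin 3, -(4 * (pd i ψ3 v * erF φ i v))) - 3 * (erκ * ∫ v, ψ4 v * φ v) - 4 * k * (erκ * ∫ v, ψ3 v * φ v) := by
    have iA : Integrable (fun v => (∑ i : Fin 3, -(4 * (pd i ψ3 v * erF φ i v))) -
      3 * (∑ i : Fin 3, pd i ψ4 v * pd i (apot φ) v)) := iF.sub (i4.const_mul 3)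
    rw [integral_sub iA (i3.const_mul (4 * k)), integral_sub iF (i4.const_mul 3),
      integral_const_mul, integral_const_mul, E2 w3 s3, E2 w4 s4]
  have eR : ∫ v, (-(6 * lam * (erφ r v₀ v ^ 24 * (erg φ k v ^ 2 * ∑ i : Fin 3, pd i φ v ^ 2))) +
        14000 * (erφ r v₀ v ^ 22 * (erg φ k v ^ 4 * (erB φ v + 1)))) =
      -(6 * lam * ∫ v, (erφ r v₀ v ^ 24 * (erg φ k v ^ 2 * ∑ i : Fin 3, pd i φ v ^ 2))) +
        14000 * ∫ v, (erφ r v₀ v ^ 22 * (erg φ k v ^ 4 * (erB φ v + 1))) := by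
    have iN : Integrable (fun v => -(6 * lam * (erφ r v₀ v ^ 24 * (erg φ k v ^ 2 * ∑ i : Fin 3, pd i φ v ^ 2)))) :=
      (iD.const_mul (6 * lam)).neg
    rw [integral_add iN (iB.const_mul 14000), integral_neg, integral_const_mul, integral_const_mul]
  have main' := eL.symm.le.trans (main.trans eR.le)
  rw [← E1] at main'
  have j4 : Integrable (fun v => ψ4 v * φ v) := (w4.continuous.mul hfc).integrable_of_hasCompactSupport s4.mul_right
  have j3 : Integrable (fun v => ψ3 v * φ v) := (w3.continuous.mul hfc).integrable_of_hasCompactSupport s3.mul_right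
  have eχ : ∫ v, erφ r v₀ v ^ 24 * (3 * erg φ k v ^ 5 + 7 * (k * erg φ k v ^ 4) + 4 * (k ^ 2 * erg φ k v ^ 3)) =
      3 * (∫ v, ψ4 v * φ v) + 4 * k * ∫ v, ψ3 v * φ v := by
    rw [← integral_const_mul, ← integral_const_mul, ← integral_add (j4.const_mul 3) (j3.const_mul (4 * k))]
    congr 1; ext v
    have hgF : erg φ k v * φ v = erg φ k v * (erg φ k v + k) := by
      unfold erg
      rcases le_total (φ v - k) 0 with h | h
      · rw [max_eq_right h]; ring
      · rw [max_eq_left h]; ring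
    rw [hψ3, hψ4]
    simp only
    linear_combination (-(3 * erφ r v₀ v ^ 24 * erg φ k v ^ 3) - 4 * k * erφ r v₀ v ^ 24 * erg φ k v ^ 2) * hgF
  rw [eχ]
  linarith


/-- Sobolev quantity -/
def erP (f : V3 → ℝ) (k r : ℝ) (v₀ : V3) : ℝ := (∫ v, (erφ r v₀ v ^ 24 * erg f k v ^ 4) ^ 3) ^ ((1:ℝ)/3)

/-- right-hand density -/
def erQd (p g k : ℝ) : ℝ := p ^ 18 * (g ^ 4 + p ^ 6 * (g ^ 5 + k * g ^ 4 + k ^ 2 * g ^ 3))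

def erc : ℝ := 3 / (4 * (erS + 1))
def erCe : ℝ := 14000 * (erCb + 1) + 7 * erκ + 2592

theorem erc_pos : 0 < erc := by
  have := erS_nonneg
  unfold erc; positivity

theorem erCe_pos : 0 < erCe := by
  have := erCb_pos
  have := erκ_nonneg
  unfold erCe; positivity

set_option maxHeartbeats 1000000 in
theorem er_energy (φ : SchwartzMap V3 ℝ) (hf0 : ∀ v, 0 ≤ φ v) (hm : ∫ v, φ v = 1) {k : ℝ} (hk : 0 ≤ k)
    {r : ℝ} (h0 : 0 < r) (h1 : r ≤ 1) (v₀ : V3) {lam : ℝ} (hlam : 0 ≤ lam) (hlam1 : lam ≤ 1)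
    (hge : ∀ v, ‖v - v₀‖ ≤ 1 → matGE lam (Amat φ v)) :
    (∫ v, erφ r v₀ v ^ 24 * (4 * erg φ k v ^ 3 * landauRHS φ v)) + erc * lam * erP φ k r v₀ ≤
      erCe * ∫ v, erQd (erφ r v₀ v) (erg φ k v) k := by
  have hgc : Continuous (erg φ k) := erg_cont φ.continuous k
  have hpc := erφ_cont r v₀
  have hBc := erB_cont φ
  have hfc := φ.continuous
  have hpd : ∀ i, Continuous (pd i φ) := fun i => (er_schwartz_pd_C1 φ i).continuous
  have hp := erφ_nonneg r v₀
  have hp1 := erφ_le_one h0.le h1 v₀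
  have hg := erg_nonneg φ k
  have hS := erS_nonneg
  have hκ := erκ_nonneg
  have hCb := erCb_pos
  have H1 := er_energy0 φ hf0 hm (k := k) h0 h1 v₀ hlam hge
  have H2 := er_bterm φ hf0 hm hk h0 h1 v₀
  have iX : Integrable (fun v => erφ r v₀ v ^ 18 * erg φ k v ^ 4) := er_cs_int (a := 17) r h0.le v₀ (by fun_prop)
  have i5 : Integrable (fun v => erφ r v₀ v ^ 24 * erg φ k v ^ 5) := er_cs_int (a := 23) r h0.le v₀ (by fun_prop)
  have i4 : Integrable (fun v => erφ r v₀ v ^ 24 * (k * erg φ k v ^ 4)) := er_cs_int (a := 23) r h0.le v₀ (by fun_prop)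
  have i3 : Integrable (fun v => erφ r v₀ v ^ 24 * (k ^ 2 * erg φ k v ^ 3)) := er_cs_int (a := 23) r h0.le v₀ (by fun_prop)
  have iD : Integrable (fun v => erφ r v₀ v ^ 24 * (erg φ k v ^ 2 * ∑ i : Fin 3, pd i φ v ^ 2)) :=
    er_cs_int (a := 23) r h0.le v₀ (by fun_prop)
  have iB : Integrable (fun v => erφ r v₀ v ^ 22 * (erg φ k v ^ 4 * erB φ v)) :=
    er_cs_int (a := 21) r h0.le v₀ (by fun_prop)
  set X := ∫ v, erφ r v₀ v ^ 18 * erg φ k v ^ 4 with hX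
  set X5 := ∫ v, erφ r v₀ v ^ 24 * erg φ k v ^ 5 with hX5
  set X4 := ∫ v, erφ r v₀ v ^ 24 * (k * erg φ k v ^ 4) with hX4
  set X3 := ∫ v, erφ r v₀ v ^ 24 * (k ^ 2 * erg φ k v ^ 3) with hX3
  set D := ∫ v, erφ r v₀ v ^ 24 * (erg φ k v ^ 2 * ∑ i : Fin 3, pd i φ v ^ 2) with hD
  have pX : 0 ≤ X := integral_nonneg fun v => by have := hp v; have := hg v; positivity
  have pX5 : 0 ≤ X5 := integral_nonneg fun v => by have := hp v; have := hg v; positivity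
  have pX4 : 0 ≤ X4 := integral_nonneg fun v => by have := hp v; have := hg v; positivity
  have pX3 : 0 ≤ X3 := integral_nonneg fun v => by have := hp v; have := hg v; positivity
  have pD : 0 ≤ D := integral_nonneg fun v => by
    have := hp v; have := hg v
    have : 0 ≤ ∑ i : Fin 3, pd i φ v ^ 2 := Finset.sum_nonneg fun i _ => sq_nonneg _
    positivity
  have eQ : ∫ v, erQd (erφ r v₀ v) (erg φ k v) k = X + X5 + X4 + X3 := by
    have j1 : Integrable (fun v => erφ r v₀ v ^ 18 * erg φ k v ^ 4 + erφ r v₀ v ^ 24 * erg φ k v ^ 5) := iX.add i5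
    have j2 : Integrable (fun v => erφ r v₀ v ^ 18 * erg φ k v ^ 4 + erφ r v₀ v ^ 24 * erg φ k v ^ 5
      + erφ r v₀ v ^ 24 * (k * erg φ k v ^ 4)) := j1.add i4
    rw [hX, hX5, hX4, hX3, ← integral_add iX i5, ← integral_add j1 i4, ← integral_add j2 i3]
    congr 1; ext v; unfold erQd; ring
  have eB : ∫ v, erφ r v₀ v ^ 22 * (erg φ k v ^ 4 * (erB φ v + 1)) ≤
      (∫ v, erφ r v₀ v ^ 22 * (erg φ k v ^ 4 * erB φ v)) + X := by
    rw [hX, ← integral_add iB iX]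
    refine integral_mono (er_cs_int (a := 21) r h0.le v₀ (by fun_prop)) (iB.add iX) fun v => ?_
    have : erφ r v₀ v ^ 22 ≤ erφ r v₀ v ^ 18 := pow_le_pow_of_le_one (hp v) (hp1 v) (by norm_num)
    have := mul_le_mul_of_nonneg_right this (pow_nonneg (hg v) 4)
    simp only [Pi.add_apply]
    linarith
  have eχ : ∫ v, erφ r v₀ v ^ 24 * (3 * erg φ k v ^ 5 + 7 * (k * erg φ k v ^ 4) + 4 * (k ^ 2 * erg φ k v ^ 3)) =
      3 * X5 + 7 * X4 + 4 * X3 := by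
    have j1 : Integrable (fun v => 3 * (erφ r v₀ v ^ 24 * erg φ k v ^ 5) + 7 * (erφ r v₀ v ^ 24 * (k * erg φ k v ^ 4))) :=
      (i5.const_mul 3).add (i4.const_mul 7)
    rw [hX5, hX4, hX3, ← integral_const_mul, ← integral_const_mul, ← integral_const_mul,
      ← integral_add (i5.const_mul 3) (i4.const_mul 7), ← integral_add j1 (i3.const_mul 4)]
    congr 1; ext v; ring
  have wu : ContDiff ℝ 1 (fun v => erφ r v₀ v ^ 12 * erg φ k v ^ 2) :=
    (erφ_pow_C1 r v₀ 10).mul (erg_pow_C1 (er_schwartz_C1 φ) k 0)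
  have su : HasCompactSupport (fun v => erφ r v₀ v ^ 12 * erg φ k v ^ 2) := er_cs (a := 11) r h0.le v₀ _
  have H3 := er_sobolev wu su
  have eP : erP φ k r v₀ = (∫ v, (erφ r v₀ v ^ 12 * erg φ k v ^ 2) ^ 6) ^ ((1:ℝ)/3) := by
    have : (fun v => (erφ r v₀ v ^ 12 * erg φ k v ^ 2) ^ 6) = fun v => (erφ r v₀ v ^ 24 * erg φ k v ^ 4) ^ 3 := by
      funext v; ring
    unfold erP; rw [this]
  rw [← eP] at H3
  have du : ∀ i v, pd i (fun v => erφ r v₀ v ^ 12 * erg φ k v ^ 2) v =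
      12 * erφ r v₀ v ^ 11 * erd v₀ i v * erg φ k v ^ 2 + erφ r v₀ v ^ 12 * (2 * erg φ k v * pd i φ v) := by
    intro i v
    have := er_pd_prod φ.differentiable r v₀ k 10 0 i v
    norm_num at this
    exact this
  have H4 : ∫ v, ∑ i : Fin 3, pd i (fun v => erφ r v₀ v ^ 12 * erg φ k v ^ 2) v ^ 2 ≤ 3456 * X + 8 * D := by
    rw [hX, hD, ← integral_const_mul, ← integral_const_mul, ← integral_add (iX.const_mul _) (iD.const_mul _)]
    refine integral_mono_of_nonneg (Filter.Eventually.of_forall fun v => Finset.sum_nonneg fun i _ => sq_nonneg _)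
      ((iX.const_mul _).add (iD.const_mul _)) (Filter.Eventually.of_forall fun v => ?_)
    simp only
    have key : ∀ i, pd i (fun v => erφ r v₀ v ^ 12 * erg φ k v ^ 2) v ^ 2 ≤
        1152 * (erφ r v₀ v ^ 18 * erg φ k v ^ 4) + 8 * (erφ r v₀ v ^ 24 * (erg φ k v ^ 2 * pd i φ v ^ 2)) := by
      intro i
      rw [du]
      by_cases hv : r ≤ ‖v - v₀‖
      · simp [erφ_eq_zero h0.le hv]
      · push Not at hv
        have hd := erd_bound (v := v) (v₀ := v₀) (by linarith) i
        have hd2 : erd v₀ i v ^ 2 ≤ 4 := by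
          have := sq_le_sq' (by linarith [abs_nonneg (erd v₀ i v)]) hd
          rw [sq_abs] at this; linarith
        have e1 : erφ r v₀ v ^ 22 ≤ erφ r v₀ v ^ 18 := pow_le_pow_of_le_one (hp v) (hp1 v) (by norm_num)
        have e2 : erφ r v₀ v ^ 22 * erd v₀ i v ^ 2 ≤ erφ r v₀ v ^ 18 * 4 :=
          mul_le_mul e1 hd2 (sq_nonneg _) (pow_nonneg (hp v) _)
        have e3 := mul_le_mul_of_nonneg_right e2 (pow_nonneg (hg v) 4)
        have e4 := sq_nonneg (12 * erφ r v₀ v ^ 11 * erd v₀ i v * erg φ k v ^ 2 - erφ r v₀ v ^ 12 * (2 * erg φ k v * pd i φ v))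
        nlinarith [e3, e4]
    refine (Finset.sum_le_sum fun i _ => key i).trans (le_of_eq ?_)
    rw [Finset.sum_add_distrib, ← Finset.mul_sum, ← Finset.mul_sum, ← Finset.mul_sum, ← Finset.mul_sum, ← Finset.mul_sum]
    simp only [Finset.sum_const, Finset.card_univ, Fintype.card_fin, nsmul_eq_mul, Nat.cast_ofNat]
    ring
  have H5 : erP φ k r v₀ ≤ (erS + 1) * (3456 * X + 8 * D) := by
    refine H3.trans ((mul_le_mul_of_nonneg_left H4 hS).trans ?_)
    nlinarith
  have H6 : erc * lam * erP φ k r v₀ ≤ 6 * lam * D + 2592 * X := by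
    have : erc * lam * erP φ k r v₀ ≤ erc * lam * ((erS + 1) * (3456 * X + 8 * D)) :=
      mul_le_mul_of_nonneg_left H5 (mul_nonneg erc_pos.le hlam)
    have e : erc * lam * ((erS + 1) * (3456 * X + 8 * D)) = lam * (2592 * X) + 6 * lam * D := by
      unfold erc; field_simp; ring
    nlinarith
  rw [eQ]
  rw [eχ] at H1
  have H7 : 14000 * (∫ v, erφ r v₀ v ^ 22 * (erg φ k v ^ 4 * (erB φ v + 1))) ≤
      14000 * (erCb * (X + X4 + X5) + X) := by linarith
  unfold erCe
  nlinarith [mul_nonneg hκ pX, mul_nonneg hκ pX5, mul_nonneg hκ pX3, mul_nonneg hκ pX4, mul_nonneg hCb.le pX3]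


theorem er_uncurry_cont {T : ℝ} {f : ℝ → V3 → ℝ} (hf : SmoothRapidSolutionOn (Set.Icc 0 T) f) :
    ContinuousOn (fun q : ℝ × V3 => f q.1 q.2) (Set.Icc 0 T ×ˢ Set.univ) := hf.smooth.continuousOn

theorem er_int_cont {T : ℝ} {f : ℝ → V3 → ℝ} (hf : SmoothRapidSolutionOn (Set.Icc 0 T) f)
    {r : ℝ} (h0 : 0 < r) (v₀ : V3) (k : ℝ) {h : ℝ → ℝ → ℝ} (hc : Continuous (fun q : ℝ × ℝ => h q.1 q.2))
    (hz : ∀ x, h 0 x = 0) :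
    ContinuousOn (fun t => ∫ v, h (erφ r v₀ v) (erg (f t) k v)) (Set.Icc 0 T) := by
  refine continuousOn_integral_of_compact_support (isCompact_closedBall v₀ r)
    (f := fun t v => h (erφ r v₀ v) (erg (f t) k v)) ?_ ?_
  · have h1 : ContinuousOn (fun q : ℝ × V3 => (erφ r v₀ q.2, erg (f q.1) k q.2)) (Set.Icc 0 T ×ˢ Set.univ) := by
      refine ContinuousOn.prodMk ((erφ_cont r v₀).comp continuous_snd).continuousOn ?_
      unfold erg
      exact ((er_uncurry_cont hf).sub continuousOn_const).sup continuousOn_const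
    exact hc.comp_continuousOn h1
  · intro t v _ hv
    rw [Metric.mem_closedBall, dist_eq_norm, not_le] at hv
    rw [erφ_eq_zero h0.le hv.le, hz]

theorem er_P_cont {T : ℝ} {f : ℝ → V3 → ℝ} (hf : SmoothRapidSolutionOn (Set.Icc 0 T) f)
    {r : ℝ} (h0 : 0 < r) (v₀ : V3) (k : ℝ) : ContinuousOn (fun t => erP (f t) k r v₀) (Set.Icc 0 T) := by
  unfold erP
  refine ContinuousOn.rpow_const (er_int_cont hf h0 v₀ k (h := fun p g => (p ^ 24 * g ^ 4) ^ 3) (by fun_prop) (by simp)) ?_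
  intro x _; right; norm_num

/-- local energy -/
def ery (f : V3 → ℝ) (k r : ℝ) (v₀ : V3) : ℝ := ∫ v, erφ r v₀ v ^ 24 * erg f k v ^ 4

theorem er_y_cont {T : ℝ} {f : ℝ → V3 → ℝ} (hf : SmoothRapidSolutionOn (Set.Icc 0 T) f)
    {r : ℝ} (h0 : 0 < r) (v₀ : V3) (k : ℝ) : ContinuousOn (fun t => ery (f t) k r v₀) (Set.Icc 0 T) := by
  unfold ery
  exact er_int_cont hf h0 v₀ k (h := fun p g => (p ^ 24 * g ^ 4)) (by fun_prop) (by simp)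

theorem er_slice_cont {T : ℝ} {f : ℝ → V3 → ℝ} (hf : SmoothRapidSolutionOn (Set.Icc 0 T) f) {t : ℝ}
    (ht : t ∈ Set.Icc 0 T) : Continuous (f t) := by
  obtain ⟨φ, hφ⟩ := hf.schwartz t ht
  rw [funext hφ]; exact φ.continuous

theorem er_y_deriv {T : ℝ} {f : ℝ → V3 → ℝ} (hf : SmoothRapidSolutionOn (Set.Icc 0 T) f)
    {r : ℝ} (h0 : 0 < r) (v₀ : V3) (k : ℝ) {t : ℝ} (ht : t ∈ Set.Ioo 0 T) :
    HasDerivAt (fun t => ery (f t) k r v₀)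
      (∫ v, erφ r v₀ v ^ 24 * (4 * erg (f t) k v ^ 3 * landauRHS (f t) v)) t := by
  have hopen : IsOpen (Set.Ioo 0 T ×ˢ (Set.univ : Set V3)) := isOpen_Ioo.prod isOpen_univ
  have hsm : ContDiffOn ℝ 1 (fun q : ℝ × V3 => f q.1 q.2) (Set.Ioo 0 T ×ˢ Set.univ) :=
    (hf.smooth.mono (Set.prod_mono Set.Ioo_subset_Icc_self le_rfl)).of_le (by exact_mod_cast le_top)
  have hD : ContinuousOn (fun q : ℝ × V3 => fderiv ℝ (fun q : ℝ × V3 => f q.1 q.2) q (1, 0))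
      (Set.Ioo 0 T ×ˢ Set.univ) :=
    (hsm.continuousOn_fderiv_of_isOpen hopen le_rfl).clm_apply continuousOn_const
  have hder : ∀ s ∈ Set.Ioo 0 T, ∀ v, HasDerivAt (fun τ => f τ v) (landauRHS (f s) v) s := by
    intro s hs v
    exact hf.solves s (by rwa [interior_Icc]) v
  have hL : ∀ s ∈ Set.Ioo 0 T, ∀ v, fderiv ℝ (fun q : ℝ × V3 => f q.1 q.2) (s, v) (1, 0) = landauRHS (f s) v := by
    intro s hs v
    have hd : DifferentiableAt ℝ (fun q : ℝ × V3 => f q.1 q.2) (s, v) :=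
      (hsm.differentiableOn one_ne_zero).differentiableAt (hopen.mem_nhds ⟨hs, Set.mem_univ _⟩)
    have h1 : HasDerivAt (fun τ : ℝ => ((τ, v) : ℝ × V3)) (1, 0) s := (hasDerivAt_id s).prodMk (hasDerivAt_const s v)
    have h2 := hd.hasFDerivAt.comp_hasDerivAt s h1
    exact h2.unique (hder s hs v)
  obtain ⟨ε, hε, hball⟩ := Metric.isOpen_iff.1 isOpen_Ioo t ht
  have hcb : Metric.closedBall t (ε/2) ⊆ Set.Ioo 0 T :=
    (Metric.closedBall_subset_ball (by linarith)).trans hball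
  have hKc : IsCompact (Metric.closedBall t (ε/2) ×ˢ Metric.closedBall v₀ r) :=
    (isCompact_closedBall _ _).prod (isCompact_closedBall _ _)
  have hsub : Metric.closedBall t (ε/2) ×ˢ Metric.closedBall v₀ r ⊆ Set.Ioo 0 T ×ˢ (Set.univ : Set V3) :=
    Set.prod_mono hcb (Set.subset_univ _)
  have hGc : ContinuousOn (fun q : ℝ × V3 => 4 * erg (f q.1) k q.2 ^ 3 *
      fderiv ℝ (fun q : ℝ × V3 => f q.1 q.2) q (1, 0)) (Set.Ioo 0 T ×ˢ Set.univ) := by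
    refine ContinuousOn.mul (continuousOn_const.mul (ContinuousOn.pow ?_ 3)) hD
    unfold erg
    exact (hsm.continuousOn.sub continuousOn_const).sup continuousOn_const
  obtain ⟨C, hC⟩ := hKc.exists_bound_of_continuousOn (hGc.mono hsub)
  have hB : ∀ v, ∀ s ∈ Metric.closedBall t (ε/2), ‖erφ r v₀ v ^ 24 * (4 * erg (f s) k v ^ 3 * landauRHS (f s) v)‖ ≤
      erφ r v₀ v ^ 24 * C := by
    intro v s hs
    by_cases hv : v ∈ Metric.closedBall v₀ r
    · have := hC (s, v) ⟨hs, hv⟩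
      simp only at this
      rw [hL s (hcb hs) v] at this
      rw [norm_mul, norm_of_nonneg (pow_nonneg (erφ_nonneg r v₀ v) 24)]
      exact mul_le_mul_of_nonneg_left this (pow_nonneg (erφ_nonneg r v₀ v) 24)
    · rw [Metric.mem_closedBall, dist_eq_norm, not_le] at hv
      rw [erφ_eq_zero h0.le hv.le]; simp
  have htI : t ∈ Set.Icc 0 T := Set.Ioo_subset_Icc_self ht
  refine (hasDerivAt_integral_of_dominated_loc_of_deriv_le (μ := (volume : Measure V3))
    (F := fun t v => erφ r v₀ v ^ 24 * erg (f t) k v ^ 4)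
    (F' := fun t v => erφ r v₀ v ^ 24 * (4 * erg (f t) k v ^ 3 * landauRHS (f t) v))
    (bound := fun v => erφ r v₀ v ^ 24 * C)
    (Metric.closedBall_mem_nhds t (half_pos hε)) ?_ ?_ ?_ ?_ ?_ ?_).2
  · filter_upwards [isOpen_Ioo.mem_nhds ht] with s hs
    have := er_slice_cont hf (Set.Ioo_subset_Icc_self hs)
    exact (((erφ_cont r v₀).pow _).mul ((erg_cont this k).pow _)).aestronglyMeasurable
  · exact er_cs_int (a := 23) r h0.le v₀ ((erg_cont (er_slice_cont hf htI) k).pow _)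
  · obtain ⟨φ, hφ⟩ := hf.schwartz t htI
    have : f t = φ := funext hφ
    rw [this]
    exact (((erφ_cont r v₀).pow _).mul ((continuous_const.mul ((erg_cont φ.continuous k).pow 3)).mul
      (er_landau_cont φ))).aestronglyMeasurable
  · exact Filter.Eventually.of_forall hB
  · exact er_cs_int (a := 23) r h0.le v₀ continuous_const
  · refine Filter.Eventually.of_forall fun v s hs => ?_
    have h1 : HasDerivAt (fun τ => f τ v - k) (landauRHS (f s) v) s := (hder s (hcb hs) v).sub_const k
    have h2 := (er_pp_deriv 2 (f s v - k)).comp s h1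
    have h3 := h2.const_mul (erφ r v₀ v ^ 24)
    refine h3.congr_deriv ?_
    unfold erg
    norm_num

theorem er_time {T : ℝ} {f : ℝ → V3 → ℝ} (hf : SmoothRapidSolutionOn (Set.Icc 0 T) f)
    (hm : ∀ t ∈ Set.Icc (0:ℝ) T, ∫ v, f t v = 1) {k : ℝ} (hk : 0 ≤ k)
    {r : ℝ} (h0 : 0 < r) (h1 : r ≤ 1) (v₀ : V3) {lam : ℝ} (hlam : 0 ≤ lam) (hlam1 : lam ≤ 1)
    (hge : ∀ t ∈ Set.Icc (0:ℝ) T, ∀ v, ‖v - v₀‖ ≤ 1 → matGE lam (Amat (f t) v))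
    {s t : ℝ} (hs : 0 ≤ s) (hst : s ≤ t) (htT : t ≤ T) {ζ ζ' ρ : ℝ → ℝ}
    (hζ : ∀ x, HasDerivAt ζ (ζ' x) x) (hζ0 : ∀ x, s ≤ x → 0 ≤ ζ x) (hζs : ζ s = 0)
    (hρ : ContinuousOn ρ (Set.Icc s t))
    (hle : ∀ x ∈ Set.Ioo s t, ζ' x * ery (f x) k r v₀ +
      ζ x * (erCe * ∫ v, erQd (erφ r v₀ v) (erg (f x) k v) k) ≤ ρ x) :
    ζ t * ery (f t) k r v₀ + erc * lam * (∫ x in s..t, ζ x * erP (f x) k r v₀) ≤ ∫ x in s..t, ρ x := by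
  have hsub : Set.Icc s t ⊆ Set.Icc 0 T := Set.Icc_subset_Icc hs htT
  have hζc : Continuous ζ := continuous_iff_continuousAt.2 fun x => (hζ x).continuousAt
  have hPc : ContinuousOn (fun x => ζ x * erP (f x) k r v₀) (Set.Icc s t) :=
    hζc.continuousOn.mul ((er_P_cont hf h0 v₀ k).mono hsub)
  have key := intervalIntegral.sub_le_integral_of_hasDeriv_right_of_le (a := s) (b := t)
    (g := fun x => ζ x * ery (f x) k r v₀)
    (g' := fun x => ζ' x * ery (f x) k r v₀ +
      ζ x * ∫ v, erφ r v₀ v ^ 24 * (4 * erg (f x) k v ^ 3 * landauRHS (f x) v))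
    (φ := fun x => ρ x - erc * lam * (ζ x * erP (f x) k r v₀)) hst
    (hζc.continuousOn.mul ((er_y_cont hf h0 v₀ k).mono hsub)) ?_ ?_ ?_
  · rw [intervalIntegral.integral_sub, intervalIntegral.integral_const_mul] at key
    · simp only [hζs, zero_mul, sub_zero] at key
      linarith
    · exact ContinuousOn.intervalIntegrable_of_Icc hst hρ
    · exact ContinuousOn.intervalIntegrable_of_Icc hst (continuousOn_const.mul hPc)
  · intro x hx
    exact ((hζ x).mul (er_y_deriv hf h0 v₀ k ⟨lt_of_le_of_lt hs hx.1, lt_of_lt_of_le hx.2 htT⟩)).hasDerivWithinAt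
  · exact (hρ.sub (continuousOn_const.mul hPc)).integrableOn_Icc
  · intro x hx
    have hxT : x ∈ Set.Icc 0 T := hsub (Set.Ioo_subset_Icc_self hx)
    obtain ⟨φ, hφ⟩ := hf.schwartz x hxT
    have e : f x = φ := funext hφ
    have H := er_energy φ (fun v => by rw [← hφ]; exact hf.nonneg x hxT v) (by rw [← e]; exact hm x hxT) hk h0 h1 v₀
      hlam hlam1 (by rw [← e]; exact hge x hxT)
    rw [← e] at H
    have H2 := hle x hx
    have H3 := mul_le_mul_of_nonneg_left H (hζ0 x hx.1.le)
    linarith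


abbrev erBall (v₀ : V3) : Set V3 := Metric.closedBall v₀ 1

theorem er_memLp {f : V3 → ℝ} (hf : Continuous f) (v₀ : V3) (p : ENNReal) :
    MemLp f p (volume.restrict (erBall v₀)) := by
  obtain ⟨C, hC⟩ := (isCompact_closedBall v₀ (1:ℝ)).exists_bound_of_continuousOn hf.continuousOn
  have : IsFiniteMeasure (volume.restrict (erBall v₀)) := ⟨by
    rw [Measure.restrict_apply_univ]; exact (isCompact_closedBall v₀ (1:ℝ)).measure_lt_top⟩
  refine MemLp.of_bound hf.aestronglyMeasurable C ?_
  exact (ae_restrict_iff' measurableSet_closedBall).2 (Filter.Eventually.of_forall fun v hv => hC v hv)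

theorem er_holder {f g : V3 → ℝ} (hf : Continuous f) (hg : Continuous g) (f0 : ∀ v, 0 ≤ f v) (g0 : ∀ v, 0 ≤ g v)
    (v₀ : V3) : ∫ v in erBall v₀, f v * g v ≤
      (∫ v in erBall v₀, f v ^ ((3:ℝ)/2)) ^ ((2:ℝ)/3) * (∫ v in erBall v₀, g v ^ 3) ^ ((1:ℝ)/3) := by
  have hpq : ((3:ℝ)/2).HolderConjugate 3 := by
    rw [Real.holderConjugate_iff]; norm_num
  have := integral_mul_le_Lp_mul_Lq_of_nonneg (μ := volume.restrict (erBall v₀)) hpq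
    (Filter.Eventually.of_forall f0) (Filter.Eventually.of_forall g0) (er_memLp hf v₀ _) (er_memLp hg v₀ _)
  have e1 : (1:ℝ) / (3/2) = 2/3 := by norm_num
  rw [e1] at this
  refine this.trans (le_of_eq ?_)
  norm_cast

theorem er_ball_eq {r : ℝ} (h0 : 0 < r) (h1 : r ≤ 1) (v₀ : V3) {h : V3 → ℝ} (hh : ∀ v, erφ r v₀ v = 0 → h v = 0) :
    ∫ v in erBall v₀, h v = ∫ v, h v := by
  refine setIntegral_eq_integral_of_forall_compl_eq_zero fun v hv => hh v ?_
  rw [Metric.mem_closedBall, dist_eq_norm, not_le] at hv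
  exact erφ_eq_zero h0.le (by linarith)

theorem er_holderP {f : V3 → ℝ} (hf : Continuous f) {r : ℝ} (h0 : 0 < r) (h1 : r ≤ 1) (v₀ : V3) (k : ℝ)
    {h : V3 → ℝ} (hc : Continuous h) (hn : ∀ v, 0 ≤ h v) :
    ∫ v, h v * (erφ r v₀ v ^ 24 * erg f k v ^ 4) ≤
      (∫ v in erBall v₀, h v ^ ((3:ℝ)/2)) ^ ((2:ℝ)/3) * erP f k r v₀ := by
  have := er_holder (g := fun v => erφ r v₀ v ^ 24 * erg f k v ^ 4) hc (((erφ_cont r v₀).pow 24).mul ((erg_cont hf k).pow 4)) hn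
    (fun v => mul_nonneg (pow_nonneg (erφ_nonneg r v₀ v) 24) (pow_nonneg (erg_nonneg f k v) 4)) v₀
  rw [er_ball_eq h0 h1 v₀ (fun v hv => by simp [hv]), er_ball_eq h0 h1 v₀ (h := fun v => (erφ r v₀ v ^ 24 * erg f k v ^ 4)^3) (fun v hv => by simp [hv])] at this
  exact this

theorem erP_nonneg (f : V3 → ℝ) (k r : ℝ) (v₀ : V3) : 0 ≤ erP f k r v₀ := by
  unfold erP
  refine rpow_nonneg (integral_nonneg fun v => ?_) _
  have := erφ_nonneg r v₀ v
  have := erg_nonneg f k v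
  positivity

theorem ery_nonneg (f : V3 → ℝ) (k r : ℝ) (v₀ : V3) : 0 ≤ ery f k r v₀ := by
  unfold ery
  refine (integral_nonneg fun v => ?_)
  have := erφ_nonneg r v₀ v
  have := erg_nonneg f k v
  positivity

theorem er_rpow32 {x : ℝ} (hx : 0 ≤ x) : x ^ ((3:ℝ)/2) = √x ^ 3 := by
  rw [Real.sqrt_eq_rpow, ← Real.rpow_natCast, ← Real.rpow_mul hx]; norm_num

theorem er_young {α x w : ℝ} (h0 : 0 ≤ α) (h1 : α ≤ 1) (hx : 0 ≤ x) (hw : 0 ≤ w) :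
    w * (α ^ 3 * x ^ 4) ≤ α ^ 4 * x ^ 5 + w * (√w ^ 5 * x ^ ((3:ℝ)/2)) := by
  rw [er_rpow32 hx]
  rcases le_total w (α * x) with h | h
  · have : w * (α ^ 3 * x ^ 4) ≤ (α * x) * (α ^ 3 * x ^ 4) := mul_le_mul_of_nonneg_right h (by positivity)
    have : 0 ≤ w * (√w ^ 5 * √x ^ 3) := by positivity
    nlinarith
  · have h2 : α ^ 3 * x ^ 4 ≤ √w ^ 5 * √x ^ 3 := by
      have hxs : √x ^ 2 = x := sq_sqrt hx
      have has : √α ^ 2 = α := sq_sqrt h0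
      have h3 : √α * √x ≤ √w := by rw [← sqrt_mul h0]; exact sqrt_le_sqrt h
      have h4 : (√α * √x) ^ 5 ≤ √w ^ 5 := pow_le_pow_left₀ (by positivity) h3 5
      have h5 : √α ^ 6 ≤ √α ^ 5 := pow_le_pow_of_le_one (sqrt_nonneg _) (by rw [sqrt_le_one]; exact h1) (by norm_num)
      calc α ^ 3 * x ^ 4 = √α ^ 6 * √x ^ 8 := by rw [← hxs, ← has]; rw [sqrt_sq (sqrt_nonneg _), sqrt_sq (sqrt_nonneg _)]; ring
        _ ≤ √α ^ 5 * √x ^ 8 := mul_le_mul_of_nonneg_right h5 (by positivity)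
        _ = (√α * √x) ^ 5 * √x ^ 3 := by ring
        _ ≤ _ := mul_le_mul_of_nonneg_right h4 (by positivity)
    have : w * (α ^ 3 * x ^ 4) ≤ w * (√w ^ 5 * √x ^ 3) := mul_le_mul_of_nonneg_left h2 hw
    have : 0 ≤ α ^ 4 * x ^ 5 := by positivity
    linarith

theorem er_youngR {α x R σ : ℝ} (h0 : 0 ≤ α) (h1 : α ≤ 1) (hx : 0 ≤ x) (hR : 0 ≤ R) (hσ : 0 < σ) :
    R * (α ^ 3 * x ^ 4) ≤ σ * (α ^ 4 * x ^ 5) + R * √(R/σ) ^ 5 * x ^ ((3:ℝ)/2) := by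
  have := mul_le_mul_of_nonneg_left (er_young h0 h1 hx (div_nonneg hR hσ.le)) hσ.le
  have e1 : σ * (R / σ * (α ^ 3 * x ^ 4)) = R * (α ^ 3 * x ^ 4) := by field_simp
  have e2 : σ * (α ^ 4 * x ^ 5 + R / σ * (√(R/σ) ^ 5 * x ^ ((3:ℝ)/2))) =
    σ * (α ^ 4 * x ^ 5) + R * √(R/σ) ^ 5 * x ^ ((3:ℝ)/2) := by field_simp
  linarith

theorem er_youngK {x K : ℝ} (hx : 0 ≤ x) (hK : 0 ≤ K) :
    K ^ 2 * x ^ 3 ≤ x ^ 5 + K * √K ^ 5 * x ^ ((3:ℝ)/2) := by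
  rw [er_rpow32 hx]
  rcases le_total K x with h | h
  · have : K ^ 2 * x ^ 3 ≤ x ^ 2 * x ^ 3 := mul_le_mul_of_nonneg_right (pow_le_pow_left₀ hK h 2) (by positivity)
    have : 0 ≤ K * √K ^ 5 * √x ^ 3 := by positivity
    nlinarith
  · have hxs : √x ^ 2 = x := sq_sqrt hx
    have hks : √K ^ 2 = K := sq_sqrt hK
    have h3 : √x ^ 3 ≤ √K ^ 3 := pow_le_pow_left₀ (sqrt_nonneg _) (sqrt_le_sqrt h) 3
    have : K ^ 2 * x ^ 3 ≤ K * √K ^ 5 * √x ^ 3 := by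
      calc K ^ 2 * x ^ 3 = K ^ 2 * √x ^ 3 * √x ^ 3 := by
            nth_rewrite 1 [← hxs]; ring
        _ ≤ K ^ 2 * √K ^ 3 * √x ^ 3 := by gcongr
        _ = K * √K ^ 5 * √x ^ 3 := by nth_rewrite 1 [pow_two]; nth_rewrite 2 [← hks]; ring
    have : 0 ≤ x ^ 5 := by positivity
    linarith

theorem er_pt1 {p g q K L C σ : ℝ} (p0 : 0 ≤ p) (p1 : p ≤ 1) (g0 : 0 ≤ g) (q0 : 0 ≤ q) (q1 : q ≤ 1)
    (hK : 0 ≤ K) (hKL : K + 1 ≤ L) (hC : 0 < C) (hσ : 0 < σ) :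
    4 * q ^ 3 * L * (p ^ 24 * g ^ 4) + q ^ 4 * (C * erQd p g K) ≤
      (3 * σ + 2 * C) * q ^ 4 * (g * (p ^ 24 * g ^ 4)) +
        (3 * ((C + 4) * L * √((C + 4) * L / σ) ^ 5) + C * (K * √K ^ 5)) * g ^ ((3:ℝ)/2) := by
  have hL : 0 < L := by linarith
  set R := (C + 4) * L with hR
  have hR0 : 0 ≤ R := by positivity
  set S := R * √(R / σ) ^ 5 with hS
  have hS0 : 0 ≤ S := by positivity
  set G := g ^ ((3:ℝ)/2) with hG
  have hG0 : 0 ≤ G := rpow_nonneg g0 _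
  set S' := K * √K ^ 5 with hS'
  have hS'0 : 0 ≤ S' := by positivity
  have a1 := er_youngR q0 q1 g0 hR0 hσ
  have a2 := er_youngR (α := p ^ 6) (by positivity) (pow_le_one₀ p0 p1) g0 hR0 hσ
  have a3 := er_youngR (α := 1) (by norm_num) le_rfl g0 hR0 hσ
  have a4 := er_youngK g0 hK
  rw [← hS, ← hG] at a1 a2 a3
  rw [← hS', ← hG] at a4
  have pp : p ^ 24 ≤ 1 := pow_le_one₀ p0 p1
  have qq : q ^ 4 ≤ 1 := pow_le_one₀ q0 q1
  have pp0 : 0 ≤ p ^ 24 := by positivity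
  have qq0 : 0 ≤ q ^ 4 := by positivity
  have qp : q ^ 4 * p ^ 24 ≤ 1 := mul_le_one₀ qq pp0 pp
  have r1 : 4 * L ≤ R := by rw [hR]; nlinarith
  have r2 : C ≤ R := by rw [hR]; nlinarith
  have r3 : C * K ≤ R := by rw [hR]; nlinarith
  have SG : 0 ≤ S * G := by positivity
  have SG' : 0 ≤ S' * G := by positivity
  have b1 : 4 * q ^ 3 * L * (p ^ 24 * g ^ 4) ≤ σ * q ^ 4 * (g * (p ^ 24 * g ^ 4)) + S * G := by
    calc 4 * q ^ 3 * L * (p ^ 24 * g ^ 4) = p ^ 24 * ((4 * L) * (q ^ 3 * g ^ 4)) := by ring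
      _ ≤ p ^ 24 * (R * (q ^ 3 * g ^ 4)) := by gcongr
      _ ≤ p ^ 24 * (σ * (q ^ 4 * g ^ 5) + S * G) := by gcongr
      _ = σ * q ^ 4 * (g * (p ^ 24 * g ^ 4)) + p ^ 24 * (S * G) := by ring
      _ ≤ σ * q ^ 4 * (g * (p ^ 24 * g ^ 4)) + 1 * (S * G) := by gcongr
      _ = _ := by ring
  have b2 : q ^ 4 * (C * (p ^ 18 * g ^ 4)) ≤ σ * q ^ 4 * (g * (p ^ 24 * g ^ 4)) + S * G := by
    calc q ^ 4 * (C * (p ^ 18 * g ^ 4)) ≤ q ^ 4 * (R * (p ^ 18 * g ^ 4)) := by gcongr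
      _ = q ^ 4 * (R * ((p ^ 6) ^ 3 * g ^ 4)) := by ring
      _ ≤ q ^ 4 * (σ * ((p ^ 6) ^ 4 * g ^ 5) + S * G) := by gcongr
      _ = σ * q ^ 4 * (g * (p ^ 24 * g ^ 4)) + q ^ 4 * (S * G) := by ring
      _ ≤ σ * q ^ 4 * (g * (p ^ 24 * g ^ 4)) + 1 * (S * G) := by gcongr
      _ = _ := by ring
  have b3 : q ^ 4 * (C * (p ^ 24 * (K * g ^ 4))) ≤ σ * q ^ 4 * (g * (p ^ 24 * g ^ 4)) + S * G := by
    calc q ^ 4 * (C * (p ^ 24 * (K * g ^ 4))) = (q ^ 4 * p ^ 24) * ((C * K) * (g ^ 4)) := by ring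
      _ ≤ (q ^ 4 * p ^ 24) * (R * g ^ 4) := by gcongr
      _ = (q ^ 4 * p ^ 24) * (R * (1 ^ 3 * g ^ 4)) := by ring
      _ ≤ (q ^ 4 * p ^ 24) * (σ * (1 ^ 4 * g ^ 5) + S * G) := by gcongr
      _ = σ * q ^ 4 * (g * (p ^ 24 * g ^ 4)) + (q ^ 4 * p ^ 24) * (S * G) := by ring
      _ ≤ σ * q ^ 4 * (g * (p ^ 24 * g ^ 4)) + 1 * (S * G) := by gcongr
      _ = _ := by ring
  have b4 : q ^ 4 * (C * (p ^ 24 * (K ^ 2 * g ^ 3))) ≤ C * q ^ 4 * (g * (p ^ 24 * g ^ 4)) + C * (S' * G) := by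
    calc q ^ 4 * (C * (p ^ 24 * (K ^ 2 * g ^ 3))) = (q ^ 4 * p ^ 24) * (C * (K ^ 2 * g ^ 3)) := by ring
      _ ≤ (q ^ 4 * p ^ 24) * (C * (g ^ 5 + S' * G)) := by gcongr
      _ = C * q ^ 4 * (g * (p ^ 24 * g ^ 4)) + (q ^ 4 * p ^ 24) * (C * (S' * G)) := by ring
      _ ≤ C * q ^ 4 * (g * (p ^ 24 * g ^ 4)) + 1 * (C * (S' * G)) := by gcongr
      _ = _ := by ring
  unfold erQd
  linarith


def ere0 : ℝ := min 1 (erc / (8 * erCe))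
theorem ere0_pos : 0 < ere0 := lt_min one_pos (div_pos erc_pos (mul_pos (by norm_num) erCe_pos))
def erN : ℝ := erCe + 4
theorem erN_pos : 0 < erN := by have := erCe_pos; unfold erN; linarith
def erC2 : ℝ := 3 * (erN * √(12 * erN / erc) ^ 5) + erCe
theorem erC2_pos : 0 < erC2 := by
  have := erCe_pos; have := erN_pos; have := erc_pos; unfold erC2; positivity

theorem er_stage1_fixed {f : V3 → ℝ} (hf : Continuous f) (v₀ : V3) {lam e K L q : ℝ} (hlam : 0 < lam)
    (he : 0 < e) (he0 : e ≤ ere0) (hK : 0 ≤ K) (hKL : K + 1 ≤ L) (q0 : 0 ≤ q) (q1 : q ≤ 1)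
    (hH : ∫ v in erBall v₀, erg f K v ^ ((3:ℝ)/2) ≤ √(e * lam) ^ 3) :
    4 * q ^ 3 * L * ery f K 1 v₀ + q ^ 4 * (erCe * ∫ v, erQd (erφ 1 v₀ v) (erg f K v) K) ≤
      erc / 2 * lam * (q ^ 4 * erP f K 1 v₀) + erC2 * L * √(K + 1 + e * L) ^ 5 * √(e * lam) ^ 3 := by
  have hC := erCe_pos
  have hc := erc_pos
  have hN := erN_pos
  have hgc : Continuous (erg f K) := erg_cont hf K
  have hpc := erφ_cont 1 v₀
  have hp := erφ_nonneg 1 v₀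
  have hp1 := erφ_le_one zero_le_one le_rfl v₀
  have hg := erg_nonneg f K
  have hL : 0 < L := by linarith
  have hP := erP_nonneg f K 1 v₀
  set σ := erc / (12 * e) with hσd
  have hσ : 0 < σ := by positivity
  set Γ := 3 * ((erCe + 4) * L * √((erCe + 4) * L / σ) ^ 5) + erCe * (K * √K ^ 5) with hΓ
  have hΓ0 : 0 ≤ Γ := by positivity
  have hG : Continuous fun v => erg f K v ^ ((3:ℝ)/2) := hgc.rpow_const fun v => Or.inr (by norm_num)
  have iG : IntegrableOn (fun v => erg f K v ^ ((3:ℝ)/2)) (erBall v₀) :=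
    hG.continuousOn.integrableOn_compact (isCompact_closedBall v₀ 1)
  -- Holder
  have Hh := er_holderP hf one_pos le_rfl v₀ K hgc hg
  have Hr : (∫ v in erBall v₀, erg f K v ^ ((3:ℝ)/2)) ^ ((2:ℝ)/3) ≤ e * lam := by
    have h0 : 0 ≤ ∫ v in erBall v₀, erg f K v ^ ((3:ℝ)/2) :=
      integral_nonneg fun v => rpow_nonneg (hg v) _
    refine (rpow_le_rpow h0 hH (by norm_num)).trans (le_of_eq ?_)
    rw [← er_rpow32 (by positivity), ← rpow_mul (by positivity)]; norm_num
  have H5 : ∫ v, erg f K v * (erφ 1 v₀ v ^ 24 * erg f K v ^ 4) ≤ e * lam * erP f K 1 v₀ :=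
    Hh.trans (mul_le_mul_of_nonneg_right Hr hP)
  -- pointwise
  have i1 : IntegrableOn (fun v => erφ 1 v₀ v ^ 24 * erg f K v ^ 4) (erBall v₀) :=
    (Continuous.continuousOn (by fun_prop)).integrableOn_compact (isCompact_closedBall v₀ 1)
  have hQc : Continuous (fun v => erQd (erφ 1 v₀ v) (erg f K v) K) := by unfold erQd; fun_prop
  have i2 : IntegrableOn (fun v => erQd (erφ 1 v₀ v) (erg f K v) K) (erBall v₀) :=
    hQc.continuousOn.integrableOn_compact (isCompact_closedBall v₀ 1)
  have i3 : IntegrableOn (fun v => erg f K v * (erφ 1 v₀ v ^ 24 * erg f K v ^ 4)) (erBall v₀) :=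
    (Continuous.continuousOn (by fun_prop)).integrableOn_compact (isCompact_closedBall v₀ 1)
  have j2 : IntegrableOn (fun v => q ^ 4 * (erCe * erQd (erφ 1 v₀ v) (erg f K v) K)) (erBall v₀) :=
    (i2.const_mul erCe).const_mul (q ^ 4)
  have e1 : ery f K 1 v₀ = ∫ v in erBall v₀, erφ 1 v₀ v ^ 24 * erg f K v ^ 4 := by
    rw [er_ball_eq one_pos le_rfl v₀ (fun v hv => by simp [hv])]; rfl
  have e2 : ∫ v, erQd (erφ 1 v₀ v) (erg f K v) K = ∫ v in erBall v₀, erQd (erφ 1 v₀ v) (erg f K v) K := by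
    rw [er_ball_eq one_pos le_rfl v₀ (fun v hv => by simp [hv, erQd])]
  have e3 : ∫ v, erg f K v * (erφ 1 v₀ v ^ 24 * erg f K v ^ 4) =
      ∫ v in erBall v₀, erg f K v * (erφ 1 v₀ v ^ 24 * erg f K v ^ 4) := by
    rw [er_ball_eq one_pos le_rfl v₀ (fun v hv => by simp [hv])]
  have M1 : 4 * q ^ 3 * L * ery f K 1 v₀ + q ^ 4 * (erCe * ∫ v, erQd (erφ 1 v₀ v) (erg f K v) K) ≤
      (3 * σ + 2 * erCe) * q ^ 4 * (∫ v, erg f K v * (erφ 1 v₀ v ^ 24 * erg f K v ^ 4)) +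
        Γ * ∫ v in erBall v₀, erg f K v ^ ((3:ℝ)/2) := by
    rw [e1, e2, e3]
    simp only [← integral_const_mul]
    rw [← integral_add (i1.const_mul _) j2, ← integral_add (i3.const_mul _) (iG.const_mul _)]
    refine integral_mono ((i1.const_mul _).add j2) ((i3.const_mul _).add (iG.const_mul _)) fun v => ?_
    exact er_pt1 (hp v) (hp1 v) (hg v) q0 q1 hK hKL hC hσ
  have he2 : e ≤ erc / (8 * erCe) := he0.trans (min_le_right _ _)
  have c1 : (3 * σ + 2 * erCe) * e ≤ erc / 2 := by
    have : 3 * σ * e = erc / 4 := by rw [hσd]; field_simp; norm_num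
    have : erCe * e ≤ erc / 8 := by
      calc erCe * e ≤ erCe * (erc / (8 * erCe)) := by gcongr
        _ = erc / 8 := by field_simp
    nlinarith
  have M2 : (3 * σ + 2 * erCe) * q ^ 4 * (∫ v, erg f K v * (erφ 1 v₀ v ^ 24 * erg f K v ^ 4)) ≤
      erc / 2 * lam * (q ^ 4 * erP f K 1 v₀) := by
    calc _ ≤ (3 * σ + 2 * erCe) * q ^ 4 * (e * lam * erP f K 1 v₀) := by gcongr
      _ = ((3 * σ + 2 * erCe) * e) * (lam * (q ^ 4 * erP f K 1 v₀)) := by ring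
      _ ≤ erc / 2 * (lam * (q ^ 4 * erP f K 1 v₀)) := by gcongr
      _ = _ := by ring
  have M3 : Γ ≤ erC2 * L * √(K + 1 + e * L) ^ 5 := by
    have a1 : √((erCe + 4) * L / σ) = √(12 * erN / erc) * √(e * L) := by
      rw [← sqrt_mul (by positivity)]; congr 1
      rw [hσd]; unfold erN; field_simp
    have a2 : √(e * L) ≤ √(K + 1 + e * L) := sqrt_le_sqrt (by linarith)
    have a3 : √K ≤ √(K + 1 + e * L) := sqrt_le_sqrt (by nlinarith)
    rw [hΓ, a1]
    unfold erC2
    have b1 : (erCe + 4) * L * (√(12 * erN / erc) * √(e * L)) ^ 5 ≤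
        erN * √(12 * erN / erc) ^ 5 * L * √(K + 1 + e * L) ^ 5 := by
      calc _ = erN * √(12 * erN / erc) ^ 5 * L * √(e * L) ^ 5 := by unfold erN; ring
        _ ≤ _ := by gcongr
    have b2 : K * √K ^ 5 ≤ L * √(K + 1 + e * L) ^ 5 := by
      have : K ≤ L := by linarith
      gcongr
    have b3 := mul_le_mul_of_nonneg_left b2 hC.le
    linarith
  have M4 : Γ * ∫ v in erBall v₀, erg f K v ^ ((3:ℝ)/2) ≤
      erC2 * L * √(K + 1 + e * L) ^ 5 * √(e * lam) ^ 3 := by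
    have hC2 := erC2_pos
    have h0 : 0 ≤ ∫ v in erBall v₀, erg f K v ^ ((3:ℝ)/2) :=
      integral_nonneg fun v => rpow_nonneg (hg v) _
    exact mul_le_mul M3 hH h0 (by positivity)
  linarith


def erC3 : ℝ := 16 * erC2 * (1 + 2 / erc)
theorem erC3_pos : 0 < erC3 := by
  have := erC2_pos; have := erc_pos; unfold erC3; positivity

theorem er_stage1 {T : ℝ} {f : ℝ → V3 → ℝ} (hf : SmoothRapidSolutionOn (Set.Icc 0 T) f)
    (hm : ∀ t ∈ Set.Icc (0:ℝ) T, ∫ v, f t v = 1) (v₀ : V3) {lam : ℝ} (hlam : 0 < lam) (hlam1 : lam ≤ 1)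
    (hge : ∀ t ∈ Set.Icc (0:ℝ) T, ∀ v, ‖v - v₀‖ ≤ 1 → matGE lam (Amat (f t) v))
    {e K L : ℝ} (he : 0 < e) (he0 : e ≤ ere0) (hK : 0 ≤ K) (hKL : K + 1 ≤ L)
    (hH : ∀ t ∈ Set.Ioo (0:ℝ) T, ∫ v in erBall v₀, erg (f t) K v ^ ((3:ℝ)/2) ≤ √(e * lam) ^ 3)
    {a : ℝ} (ha : 0 ≤ a) (hb : a + 1 / L ≤ T) :
    (∀ t ∈ Set.Icc (a + 1 / L / 2) (a + 1 / L), ery (f t) K 1 v₀ ≤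
        erC3 * √(K + 1 + e * L) ^ 5 * √(e * lam) ^ 3) ∧
      lam * (∫ t in (a + 1 / L / 2)..(a + 1 / L), erP (f t) K 1 v₀) ≤
        erC3 * √(K + 1 + e * L) ^ 5 * √(e * lam) ^ 3 := by
  have hC := erCe_pos
  have hc := erc_pos
  have hC2 := erC2_pos
  have hL : 0 < L := by linarith
  have hl : 0 < 1 / L := by positivity
  set A := erC2 * √(K + 1 + e * L) ^ 5 * √(e * lam) ^ 3 with hA
  have hA0 : 0 ≤ A := by positivity
  set ζ : ℝ → ℝ := fun x => ((x - a) * L) ^ 4 with hζd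
  have hζ : ∀ x, HasDerivAt ζ (4 * ((x - a) * L) ^ 3 * L) x := by
    intro x
    have h1 : HasDerivAt (fun x => (x - a) * L) L x := by
      simpa using ((hasDerivAt_id x).sub_const a).mul_const L
    have h2 := h1.pow 4
    exact h2.congr_deriv (by norm_num)
  have hζc : Continuous ζ := by rw [hζd]; fun_prop
  have hPc : ∀ t ≤ a + 1 / L, ContinuousOn (fun x => ζ x * erP (f x) K 1 v₀) (Set.Icc a t) := fun t ht =>
    hζc.continuousOn.mul ((er_P_cont hf one_pos v₀ K).mono (Set.Icc_subset_Icc ha (ht.trans hb)))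
  have main : ∀ t, a ≤ t → t ≤ a + 1 / L → ζ t * ery (f t) K 1 v₀ +
      erc / 2 * lam * (∫ x in a..t, ζ x * erP (f x) K 1 v₀) ≤ A := by
    intro t hat htb
    have key := er_time hf hm hK one_pos le_rfl v₀ hlam.le hlam1 hge ha hat (htb.trans hb)
      (ρ := fun x => erc / 2 * lam * (ζ x * erP (f x) K 1 v₀) + A * L) hζ (fun x hx => by
        have : 0 ≤ x - a := by linarith
        positivity) (by simp [hζd])
      ((continuousOn_const.mul (hPc t htb)).add continuousOn_const) (by
        intro x hx
        have hq0 : 0 ≤ (x - a) * L := mul_nonneg (by linarith [hx.1]) hL.le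
        have hq1 : (x - a) * L ≤ 1 := by
          have : x - a ≤ 1 / L := by linarith [hx.2]
          calc (x - a) * L ≤ 1 / L * L := by gcongr
            _ = 1 := by field_simp
        have hxT : x ∈ Set.Ioo 0 T := ⟨by linarith [hx.1], by linarith [hx.2]⟩
        have := er_stage1_fixed (er_slice_cont hf (Set.Ioo_subset_Icc_self hxT)) v₀ hlam he he0 hK hKL hq0 hq1 (hH x hxT)
        rw [hA]
        refine this.trans (le_of_eq ?_)
        rw [hζd]; ring)
    rw [intervalIntegral.integral_add, intervalIntegral.integral_const_mul, intervalIntegral.integral_const] at key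
    · have h1 : (t - a) * (A * L) ≤ A := by
        have : t - a ≤ 1 / L := by linarith
        calc (t - a) * (A * L) ≤ 1 / L * (A * L) := by gcongr
          _ = A := by field_simp
      simp only [smul_eq_mul] at key
      linarith
    · exact ContinuousOn.intervalIntegrable_of_Icc hat (continuousOn_const.mul (hPc t htb))
    · exact intervalIntegrable_const
  have hζ16 : ∀ t, a + 1 / L / 2 ≤ t → 1 / 16 ≤ ζ t := by
    intro t ht
    have h1 : 1 / 2 ≤ (t - a) * L := by
      have : 1 / L / 2 ≤ t - a := by linarith
      calc (1:ℝ) / 2 = 1 / L / 2 * L := by field_simp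
        _ ≤ _ := by gcongr
    have := pow_le_pow_left₀ (by norm_num) h1 4
    rw [hζd]
    norm_num at this ⊢
    exact this
  have hP0 : ∀ x, 0 ≤ erP (f x) K 1 v₀ := fun x => erP_nonneg _ _ _ _
  have hζ0 : ∀ x, 0 ≤ ζ x := fun x => by rw [hζd]; positivity
  have eC : erC3 * √(K + 1 + e * L) ^ 5 * √(e * lam) ^ 3 = 16 * A + 32 / erc * A := by
    rw [hA]; unfold erC3; ring
  rw [eC]
  have hx0 : 0 ≤ 32 / erc * A := by positivity
  constructor
  · intro t ht
    have h1 := main t (by linarith [ht.1]) ht.2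
    have h2 : 0 ≤ ∫ x in a..t, ζ x * erP (f x) K 1 v₀ :=
      intervalIntegral.integral_nonneg (by linarith [ht.1]) fun x _ => mul_nonneg (hζ0 x) (hP0 x)
    have h3 : 1 / 16 * ery (f t) K 1 v₀ ≤ ζ t * ery (f t) K 1 v₀ :=
      mul_le_mul_of_nonneg_right (hζ16 t ht.1) (ery_nonneg _ _ _ _)
    have h4 : 0 ≤ erc / 2 * lam * ∫ x in a..t, ζ x * erP (f x) K 1 v₀ := by positivity
    linarith
  · have h1 := main (a + 1 / L) (by linarith) le_rfl
    have i1 : IntervalIntegrable (fun x => ζ x * erP (f x) K 1 v₀) volume a (a + 1 / L / 2) :=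
      ContinuousOn.intervalIntegrable_of_Icc (by linarith) (hPc _ (by linarith))
    have i2 : IntervalIntegrable (fun x => ζ x * erP (f x) K 1 v₀) volume (a + 1 / L / 2) (a + 1 / L) :=
      ContinuousOn.intervalIntegrable_of_Icc (by linarith) ((hPc _ le_rfl).mono (Set.Icc_subset_Icc_left (by linarith)))
    have i3 : IntervalIntegrable (fun x => erP (f x) K 1 v₀) volume (a + 1 / L / 2) (a + 1 / L) :=
      ContinuousOn.intervalIntegrable_of_Icc (by linarith)
        ((er_P_cont hf one_pos v₀ K).mono (Set.Icc_subset_Icc (by linarith) hb))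
    have h2 := intervalIntegral.integral_add_adjacent_intervals i1 i2
    have h3 : 0 ≤ ∫ x in a..(a + 1 / L / 2), ζ x * erP (f x) K 1 v₀ :=
      intervalIntegral.integral_nonneg (by linarith) fun x _ => mul_nonneg (hζ0 x) (hP0 x)
    have h4 : 1 / 16 * (∫ x in (a + 1 / L / 2)..(a + 1 / L), erP (f x) K 1 v₀) ≤
        ∫ x in (a + 1 / L / 2)..(a + 1 / L), ζ x * erP (f x) K 1 v₀ := by
      rw [← intervalIntegral.integral_const_mul]
      refine intervalIntegral.integral_mono_on (by linarith) (i3.const_mul _) i2 fun x hx => ?_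
      exact mul_le_mul_of_nonneg_right (hζ16 x hx.1) (hP0 x)
    set I := ∫ x in (a + 1 / L / 2)..(a + 1 / L), erP (f x) K 1 v₀
    have h5 : 0 ≤ ζ (a + 1 / L) * ery (f (a + 1 / L)) K 1 v₀ := mul_nonneg (hζ0 _) (ery_nonneg _ _ _ _)
    have h6 : erc / 2 * lam * (1 / 16 * I) ≤ A := by
      refine le_trans ?_ ((le_add_of_nonneg_left h5).trans h1)
      gcongr
      linarith
    have h7 : lam * I ≤ 32 / erc * A := by
      rw [div_mul_eq_mul_div, le_div_iff₀ hc]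
      linarith
    linarith


def erC4 : ℝ := (8 + 46 * erCe) * 4 ^ 41
theorem erC4_pos : 0 < erC4 := by have := erCe_pos; unfold erC4; positivity

theorem er_pt2a {p' g' g k' L e s M C ζ : ℝ} (p0 : 0 ≤ p') (p1 : p' ≤ 1) (g0 : 0 ≤ g')
    (hg : g' ≤ g) (hd : M * s ≤ 2 * g) (hs : 0 < s) (hs1 : s ≤ 1) (he : 0 < e) (he1 : e ≤ 1) (hM : 1 ≤ M)
    (hk0 : 0 ≤ k') (hk : k' ≤ 2 * M) (hL : e * L ≤ M) (hL0 : 0 ≤ L) (hC : 0 < C) (hζ : ζ ≤ 2) :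
    (s ^ 2 * e) * (4 * L / s * (p' ^ 24 * g' ^ 4) + ζ * (C * erQd p' g' k')) ≤ (8 + 46 * C) * g ^ 5 := by
  have hgg : 0 ≤ g := g0.trans hg
  have P24 : p' ^ 24 ≤ 1 := pow_le_one₀ p0 p1
  have P18 : p' ^ 18 ≤ 1 := pow_le_one₀ p0 p1
  have P6 : p' ^ 6 ≤ 1 := pow_le_one₀ p0 p1
  have G3 : g' ^ 3 ≤ g ^ 3 := pow_le_pow_left₀ g0 hg 3
  have G4 : g' ^ 4 ≤ g ^ 4 := pow_le_pow_left₀ g0 hg 4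
  have G5 : g' ^ 5 ≤ g ^ 5 := pow_le_pow_left₀ g0 hg 5
  have Q0 : 0 ≤ erQd p' g' k' := by unfold erQd; positivity
  have Q1 : erQd p' g' k' ≤ g ^ 4 + (g ^ 5 + (2 * M) * g ^ 4 + (2 * M) ^ 2 * g ^ 3) := by
    unfold erQd
    have h1 : p' ^ 6 * (g' ^ 5 + k' * g' ^ 4 + k' ^ 2 * g' ^ 3) ≤
        1 * (g ^ 5 + (2 * M) * g ^ 4 + (2 * M) ^ 2 * g ^ 3) := by gcongr
    calc _ ≤ 1 * (g ^ 4 + 1 * (g ^ 5 + (2 * M) * g ^ 4 + (2 * M) ^ 2 * g ^ 3)) := by gcongr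
      _ = _ := by ring
  have T1 : (s ^ 2 * e) * (4 * L / s * (p' ^ 24 * g' ^ 4)) ≤ 8 * g ^ 5 := by
    calc (s ^ 2 * e) * (4 * L / s * (p' ^ 24 * g' ^ 4)) = 4 * (e * L * s) * (p' ^ 24 * g' ^ 4) := by field_simp
      _ ≤ 4 * (M * s) * (1 * g ^ 4) := by gcongr
      _ ≤ 4 * (2 * g) * (1 * g ^ 4) := by gcongr
      _ = _ := by ring
  have sM : s ≤ M * s := by nlinarith
  have T2 : s ^ 2 * (g ^ 4 + (g ^ 5 + (2 * M) * g ^ 4 + (2 * M) ^ 2 * g ^ 3)) ≤ 23 * g ^ 5 := by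
    have a1 : s ^ 2 * g ^ 4 ≤ 2 * g ^ 5 := by
      calc s ^ 2 * g ^ 4 = s * (s * g ^ 4) := by ring
        _ ≤ 1 * (2 * g * g ^ 4) := by gcongr; linarith
        _ = _ := by ring
    have a2 : s ^ 2 * g ^ 5 ≤ g ^ 5 := by
      have : s ^ 2 ≤ 1 := pow_le_one₀ hs.le hs1
      have := mul_le_mul_of_nonneg_right this (pow_nonneg hgg 5)
      linarith
    have a3 : s ^ 2 * ((2 * M) * g ^ 4) ≤ 4 * g ^ 5 := by
      calc s ^ 2 * ((2 * M) * g ^ 4) = s * (2 * (M * s) * g ^ 4) := by ring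
        _ ≤ 1 * (2 * (2 * g) * g ^ 4) := by gcongr
        _ = _ := by ring
    have a4 : s ^ 2 * ((2 * M) ^ 2 * g ^ 3) ≤ 16 * g ^ 5 := by
      calc s ^ 2 * ((2 * M) ^ 2 * g ^ 3) = 4 * (M * s) ^ 2 * g ^ 3 := by ring
        _ ≤ 4 * (2 * g) ^ 2 * g ^ 3 := by gcongr
        _ = _ := by ring
    linarith
  have T3 : (s ^ 2 * e) * (ζ * (C * erQd p' g' k')) ≤ 46 * C * g ^ 5 := by
    calc (s ^ 2 * e) * (ζ * (C * erQd p' g' k')) ≤ (s ^ 2 * e) * (2 * (C * erQd p' g' k')) := by gcongr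
      _ ≤ (s ^ 2 * 1) * (2 * (C * erQd p' g' k')) := by gcongr
      _ ≤ (s ^ 2 * 1) * (2 * (C * (g ^ 4 + (g ^ 5 + (2 * M) * g ^ 4 + (2 * M) ^ 2 * g ^ 3)))) := by gcongr
      _ = 2 * C * (s ^ 2 * (g ^ 4 + (g ^ 5 + (2 * M) * g ^ 4 + (2 * M) ^ 2 * g ^ 3))) := by ring
      _ ≤ 2 * C * (23 * g ^ 5) := by gcongr
      _ = _ := by ring
  linarith

theorem er_pt2b {p g s M : ℝ} (hs : 0 < s) (hs1 : s ≤ 1) (hM : 1 ≤ M) (hp : s / 4 ≤ p) (hd : M * s ≤ 2 * g) :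
    (s ^ 42 * M ^ ((5:ℝ)/3)) * g ^ 5 ≤ 4 ^ 41 * ((p ^ 24 * g ^ 4) ^ ((2:ℝ)/3) * (p ^ 24 * g ^ 4)) := by
  have hMs : 0 < M * s := by positivity
  have hg : 0 < g := by linarith
  have hp0 : 0 < p := lt_of_lt_of_le (by positivity) hp
  have e1 : (p ^ 24 * g ^ 4) ^ ((2:ℝ)/3) = p ^ 16 * (g * g ^ ((5:ℝ)/3)) := by
    rw [mul_rpow (by positivity) (by positivity)]
    congr 1
    · rw [← rpow_natCast, ← rpow_natCast, ← rpow_mul hp0.le]; norm_num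
    · rw [← rpow_natCast, ← rpow_mul hg.le]
      nth_rewrite 2 [← rpow_one g]
      rw [← rpow_add hg]; norm_num
  rw [e1]
  have h1 : M ^ ((5:ℝ)/3) * (s/2) ^ 2 ≤ g ^ ((5:ℝ)/3) := by
    calc M ^ ((5:ℝ)/3) * (s/2) ^ 2 ≤ M ^ ((5:ℝ)/3) * (s/2) ^ ((5:ℝ)/3) := by
          gcongr
          rw [← rpow_natCast]
          exact rpow_le_rpow_of_exponent_ge (by positivity) (by linarith) (by norm_num)
      _ = (M * (s/2)) ^ ((5:ℝ)/3) := by rw [mul_rpow (by positivity) (by positivity)]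
      _ ≤ g ^ ((5:ℝ)/3) := rpow_le_rpow (by positivity) (by linarith) (by norm_num)
  have h2 : (s/4) ^ 40 ≤ p ^ 40 := pow_le_pow_left₀ (by positivity) hp 40
  calc (s ^ 42 * M ^ ((5:ℝ)/3)) * g ^ 5 = 4 ^ 41 * ((s/4) ^ 40 * (M ^ ((5:ℝ)/3) * (s/2) ^ 2) * g ^ 5) := by ring
    _ ≤ 4 ^ 41 * (p ^ 40 * g ^ ((5:ℝ)/3) * g ^ 5) := by gcongr
    _ = _ := by ring

theorem er_stage2_fixed {f : V3 → ℝ} (hf : Continuous f) (v₀ : V3) {e K L M s k k' r r' ζ : ℝ}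
    (hs : 0 < s) (hs1 : s ≤ 1) (he : 0 < e) (he1 : e ≤ 1) (hM : 1 ≤ M) (hK : 0 ≤ K) (hKM : K ≤ M)
    (hL : e * L ≤ M) (hL0 : 0 ≤ L) (hζ : ζ ≤ 2)
    (hk : k = K + M * (1 - s)) (hk' : k' = K + M * (1 - s / 2)) (hr : r = √(1 / 2 + s / 2))
    (hr' : r' = √(1 / 2 + s / 4)) :
    4 * L / s * ery f k' r' v₀ + ζ * (erCe * ∫ v, erQd (erφ r' v₀ v) (erg f k' v) k') ≤
      erC4 / (s ^ 44 * e * M ^ ((5:ℝ)/3)) * (ery f k r v₀ ^ ((2:ℝ)/3) * erP f k r v₀) := by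
  have hC := erCe_pos
  have hC4 := erC4_pos
  have r0 : 0 < r := by rw [hr]; positivity
  have r1 : r ≤ 1 := by rw [hr, sqrt_le_one]; linarith
  have r0' : 0 < r' := by rw [hr']; positivity
  have r1' : r' ≤ 1 := by rw [hr', sqrt_le_one]; linarith
  have hr2 : r ^ 2 = 1 / 2 + s / 2 := by rw [hr, sq_sqrt (by positivity)]
  have hr2' : r' ^ 2 = 1 / 2 + s / 4 := by rw [hr', sq_sqrt (by positivity)]
  have hk0' : 0 ≤ k' := by rw [hk']; nlinarith
  have hk2' : k' ≤ 2 * M := by rw [hk']; nlinarith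
  have hMp : 0 < M ^ ((5:ℝ)/3) := rpow_pos_of_pos (by linarith) _
  set D := s ^ 44 * e * M ^ ((5:ℝ)/3) with hD
  have hD0 : 0 < D := by positivity
  have hgc := erg_cont hf k
  have hgc' := erg_cont hf k'
  have hpc := erφ_cont r v₀
  have hpc' := erφ_cont r' v₀
  have hYc : Continuous (fun v => (erφ r v₀ v ^ 24 * erg f k v ^ 4) ^ ((2:ℝ)/3)) := by
    refine Continuous.rpow_const (by fun_prop) fun v => Or.inr (by norm_num)
  have hY0 : ∀ v, 0 ≤ erφ r v₀ v ^ 24 * erg f k v ^ 4 := fun v =>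
    mul_nonneg (pow_nonneg (erφ_nonneg r v₀ v) 24) (pow_nonneg (erg_nonneg f k v) 4)
  have pt : ∀ v, 4 * L / s * (erφ r' v₀ v ^ 24 * erg f k' v ^ 4) + ζ * (erCe * erQd (erφ r' v₀ v) (erg f k' v) k') ≤
      erC4 / D * ((erφ r v₀ v ^ 24 * erg f k v ^ 4) ^ ((2:ℝ)/3) * (erφ r v₀ v ^ 24 * erg f k v ^ 4)) := by
    intro v
    have hRn : 0 ≤ erC4 / D * ((erφ r v₀ v ^ 24 * erg f k v ^ 4) ^ ((2:ℝ)/3) * (erφ r v₀ v ^ 24 * erg f k v ^ 4)) := by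
      have := rpow_nonneg (hY0 v) ((2:ℝ)/3)
      have := hY0 v
      positivity
    rcases (erφ_nonneg r' v₀ v).eq_or_lt with h | h
    · rw [← h]; simp [erQd]; exact hRn
    rcases (erg_nonneg f k' v).eq_or_lt with h2 | h2
    · rw [← h2]; simp [erQd]; exact hRn
    have hp : s / 4 ≤ erφ r v₀ v := by
      unfold erφ at h ⊢
      rw [hr2'] at h
      rw [hr2]
      rcases lt_max_iff.1 h with h | h
      · exact le_max_of_le_left (by linarith)
      · exact absurd h (lt_irrefl _)
    have hgl : k' < f v := by
      unfold erg at h2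
      rcases lt_max_iff.1 h2 with h | h
      · linarith
      · exact absurd h (lt_irrefl _)
    have hkk : k' = k + M * s / 2 := by rw [hk, hk']; ring
    have hMs : 0 < M * s := by positivity
    have g1 : erg f k' v = f v - k' := max_eq_left (by linarith)
    have g2 : erg f k v = f v - k := max_eq_left (by linarith)
    have hd : M * s ≤ 2 * erg f k v := by rw [g2]; linarith
    have A1 := er_pt2a (erφ_nonneg r' v₀ v) (erφ_le_one r0'.le r1' v₀ v) (erg_nonneg f k' v)
      (show erg f k' v ≤ erg f k v by rw [g1, g2]; linarith) hd hs hs1 he he1 hM hk0' hk2' hL hL0 hC hζ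
    have A2 := er_pt2b hs hs1 hM hp hd
    set X := 4 * L / s * (erφ r' v₀ v ^ 24 * erg f k' v ^ 4) + ζ * (erCe * erQd (erφ r' v₀ v) (erg f k' v) k')
    set Y := (erφ r v₀ v ^ 24 * erg f k v ^ 4) ^ ((2:ℝ)/3) * (erφ r v₀ v ^ 24 * erg f k v ^ 4)
    rw [div_mul_eq_mul_div, le_div_iff₀ hD0]
    calc X * D = (s ^ 42 * M ^ ((5:ℝ)/3)) * ((s ^ 2 * e) * X) := by rw [hD]; ring
      _ ≤ (s ^ 42 * M ^ ((5:ℝ)/3)) * ((8 + 46 * erCe) * erg f k v ^ 5) := by gcongr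
      _ = (8 + 46 * erCe) * ((s ^ 42 * M ^ ((5:ℝ)/3)) * erg f k v ^ 5) := by ring
      _ ≤ (8 + 46 * erCe) * (4 ^ 41 * Y) := by gcongr
      _ = erC4 * Y := by unfold erC4; ring
  have i1 : Integrable (fun v => erφ r' v₀ v ^ 24 * erg f k' v ^ 4) := er_cs_int (a := 23) r' r0'.le v₀ (by fun_prop)
  have i2 : Integrable (fun v => erQd (erφ r' v₀ v) (erg f k' v) k') := by
    unfold erQd; exact er_cs_int (a := 17) r' r0'.le v₀ (by fun_prop)
  have j2 : Integrable (fun v => ζ * (erCe * erQd (erφ r' v₀ v) (erg f k' v) k')) := (i2.const_mul _).const_mul _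
  have i3 : Integrable (fun v => (erφ r v₀ v ^ 24 * erg f k v ^ 4) ^ ((2:ℝ)/3) * (erφ r v₀ v ^ 24 * erg f k v ^ 4)) := by
    have : Integrable (fun v => erφ r v₀ v ^ 24 * ((erφ r v₀ v ^ 24 * erg f k v ^ 4) ^ ((2:ℝ)/3) * erg f k v ^ 4)) :=
      er_cs_int (a := 23) r r0.le v₀ (hYc.mul (hgc.pow 4))
    refine this.congr (Filter.Eventually.of_forall fun v => ?_)
    simp only; ring
  have H := er_holderP hf r0 r1 v₀ k hYc (fun v => rpow_nonneg (hY0 v) _)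
  have e3 : ∫ v in erBall v₀, ((erφ r v₀ v ^ 24 * erg f k v ^ 4) ^ ((2:ℝ)/3)) ^ ((3:ℝ)/2) = ery f k r v₀ := by
    have : ∀ v, ((erφ r v₀ v ^ 24 * erg f k v ^ 4) ^ ((2:ℝ)/3)) ^ ((3:ℝ)/2) = erφ r v₀ v ^ 24 * erg f k v ^ 4 := by
      intro v; rw [← rpow_mul (hY0 v)]; norm_num
    simp_rw [this]
    rw [er_ball_eq r0 r1 v₀ (fun v hv => by simp [hv])]; rfl
  rw [e3] at H
  have M1 : 4 * L / s * ery f k' r' v₀ + ζ * (erCe * ∫ v, erQd (erφ r' v₀ v) (erg f k' v) k') ≤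
      erC4 / D * ∫ v, (erφ r v₀ v ^ 24 * erg f k v ^ 4) ^ ((2:ℝ)/3) * (erφ r v₀ v ^ 24 * erg f k v ^ 4) := by
    unfold ery
    simp only [← integral_const_mul]
    rw [← integral_add (i1.const_mul _) j2]
    exact integral_mono ((i1.const_mul _).add j2) (i3.const_mul _) pt
  exact M1.trans (mul_le_mul_of_nonneg_left H (by positivity))


theorem er_step {T : ℝ} {f : ℝ → V3 → ℝ} (hf : SmoothRapidSolutionOn (Set.Icc 0 T) f)
    (hm : ∀ t ∈ Set.Icc (0:ℝ) T, ∫ v, f t v = 1) (v₀ : V3) {lam : ℝ} (hlam : 0 < lam) (hlam1 : lam ≤ 1)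
    (hge : ∀ t ∈ Set.Icc (0:ℝ) T, ∀ v, ‖v - v₀‖ ≤ 1 → matGE lam (Amat (f t) v))
    {e K L M s k k' r r' a W : ℝ} (hs : 0 < s) (hs1 : s ≤ 1) (he : 0 < e) (he1 : e ≤ 1) (hM : 1 ≤ M)
    (hK : 0 ≤ K) (hKM : K ≤ M) (hL : e * L ≤ M) (hL0 : 0 < L)
    (hk : k = K + M * (1 - s)) (hk' : k' = K + M * (1 - s / 2)) (hr : r = √(1 / 2 + s / 2))
    (hr' : r' = √(1 / 2 + s / 4)) (ha : 0 ≤ a) (hb : a + 1 / L ≤ T) (hW : 0 ≤ W)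
    (H1 : ∀ t ∈ Set.Icc (a + 1 / L * (1 - s / 2)) (a + 1 / L), ery (f t) k r v₀ ≤ W ^ 3)
    (H2 : lam * (∫ t in (a + 1 / L * (1 - s / 2))..(a + 1 / L), erP (f t) k r v₀) ≤ W ^ 3) :
    (∀ t ∈ Set.Icc (a + 1 / L * (1 - s / 4)) (a + 1 / L), ery (f t) k' r' v₀ ≤
        erC4 / (s ^ 44 * e * M ^ ((5:ℝ)/3)) * (W ^ 5 / lam)) ∧
      lam * (∫ t in (a + 1 / L * (1 - s / 4))..(a + 1 / L), erP (f t) k' r' v₀) ≤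
        erC4 / (s ^ 44 * e * M ^ ((5:ℝ)/3)) * (W ^ 5 / lam) / erc := by
  have hc := erc_pos
  have hC4 := erC4_pos
  have r0 : 0 < r := by rw [hr]; positivity
  have r0' : 0 < r' := by rw [hr']; positivity
  have r1' : r' ≤ 1 := by rw [hr', sqrt_le_one]; linarith
  have hk0' : 0 ≤ k' := by rw [hk']; nlinarith
  have hMp : 0 < M ^ ((5:ℝ)/3) := rpow_pos_of_pos (by linarith) _
  set D := erC4 / (s ^ 44 * e * M ^ ((5:ℝ)/3)) with hD
  have hD0 : 0 < D := by positivity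
  have hl : 0 < 1 / L := by positivity
  set b := a + 1 / L with hbd
  set t0 := a + 1 / L * (1 - s / 2) with ht0
  set t1 := a + 1 / L * (1 - s / 4) with ht1
  have hq : 0 < 1 / L * s := by positivity
  have t0a : 0 ≤ t0 := by rw [ht0]; have : 0 ≤ 1 / L * (1 - s / 2) := mul_nonneg hl.le (by linarith); linarith
  have t01 : t1 - t0 = (1 / L * s) / 4 := by rw [ht0, ht1]; ring
  have t1b : b - t1 = (1 / L * s) / 4 := by rw [hbd, ht1]; ring
  set ζ : ℝ → ℝ := fun x => (x - t0) * (4 * L / s) with hζd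
  have hZ : 0 < 4 * L / s := by positivity
  have hζ : ∀ x, HasDerivAt ζ (4 * L / s) x := by
    intro x
    simpa using ((hasDerivAt_id x).sub_const t0).mul_const (4 * L / s)
  have hζ0 : ∀ x, t0 ≤ x → 0 ≤ ζ x := fun x hx => mul_nonneg (by linarith) hZ.le
  have hqz : (1 / L * s) / 4 * (4 * L / s) = 1 := by field_simp
  have hζ1 : ∀ x, t1 ≤ x → 1 ≤ ζ x := fun x hx => by
    rw [← hqz]; exact mul_le_mul_of_nonneg_right (by linarith) hZ.le
  have hζ2 : ∀ x, x ≤ b → ζ x ≤ 2 := fun x hx => by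
    have : ζ x ≤ (2 * ((1 / L * s) / 4)) * (4 * L / s) := mul_le_mul_of_nonneg_right (by linarith) hZ.le
    linarith
  have hζc : Continuous ζ := by rw [hζd]; fun_prop
  have hP0 : ∀ x k r, 0 ≤ erP (f x) k r v₀ := fun x k r => erP_nonneg _ _ _ _
  have hPc : ContinuousOn (fun x => erP (f x) k r v₀) (Set.Icc t0 b) :=
    (er_P_cont hf r0 v₀ k).mono (Set.Icc_subset_Icc t0a hb)
  have hPc' : ContinuousOn (fun x => erP (f x) k' r' v₀) (Set.Icc t0 b) :=
    (er_P_cont hf r0' v₀ k').mono (Set.Icc_subset_Icc t0a hb)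
  have hzPc : ContinuousOn (fun x => ζ x * erP (f x) k' r' v₀) (Set.Icc t0 b) :=
    hζc.continuousOn.mul hPc'
  have hPi : IntervalIntegrable (fun x => erP (f x) k r v₀) volume t0 b :=
    ContinuousOn.intervalIntegrable_of_Icc (by linarith) hPc
  have main : ∀ t, t1 ≤ t → t ≤ b →
      ζ t * ery (f t) k' r' v₀ + erc * lam * (∫ x in t0..t, ζ x * erP (f x) k' r' v₀) ≤ D * (W ^ 5 / lam) := by
    intro t h1 h2
    have A := er_time hf hm hk0' r0' r1' v₀ hlam.le hlam1 hge t0a (show t0 ≤ t by linarith) (h2.trans hb)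
      (ρ := fun x => D * W ^ 2 * erP (f x) k r v₀) hζ hζ0 (by simp [hζd])
      (continuousOn_const.mul (hPc.mono (Set.Icc_subset_Icc_right h2))) ?_
    · refine A.trans ?_
      rw [intervalIntegral.integral_const_mul]
      have B : ∫ x in t0..t, erP (f x) k r v₀ ≤ ∫ x in t0..b, erP (f x) k r v₀ := by
        refine intervalIntegral.integral_mono_interval le_rfl (by linarith) h2 ?_ hPi
        exact Filter.Eventually.of_forall fun x => hP0 x k r
      have B2 : ∫ x in t0..b, erP (f x) k r v₀ ≤ W ^ 3 / lam := by
        rw [le_div_iff₀ hlam]; linarith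
      calc D * W ^ 2 * (∫ x in t0..t, erP (f x) k r v₀) ≤ D * W ^ 2 * (W ^ 3 / lam) := by
            gcongr; exact B.trans B2
        _ = _ := by ring
    · intro x hx
      have hxI : x ∈ Set.Icc 0 T := ⟨by linarith [hx.1], by linarith [hx.2]⟩
      have S := er_stage2_fixed (er_slice_cont hf hxI) v₀ hs hs1 he he1 hM hK hKM hL hL0.le
        (hζ2 x (by linarith [hx.2])) hk hk' hr hr'
      refine S.trans ?_
      have Y : ery (f x) k r v₀ ^ ((2:ℝ)/3) ≤ W ^ 2 := by
        calc ery (f x) k r v₀ ^ ((2:ℝ)/3) ≤ (W ^ 3) ^ ((2:ℝ)/3) :=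
              rpow_le_rpow (ery_nonneg _ _ _ _) (H1 x ⟨hx.1.le, by linarith [hx.2]⟩) (by norm_num)
          _ = W ^ 2 := by rw [← rpow_natCast, ← rpow_natCast, ← rpow_mul hW]; norm_num
      have := hP0 x k r
      calc _ ≤ D * (W ^ 2 * erP (f x) k r v₀) := by gcongr
        _ = _ := by ring
  constructor
  · intro t ht
    have h1 := main t ht.1 ht.2
    have h2 : 0 ≤ ∫ x in t0..t, ζ x * erP (f x) k' r' v₀ :=
      intervalIntegral.integral_nonneg (by linarith [ht.1]) fun x hx => mul_nonneg (hζ0 x hx.1) (hP0 x _ _)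
    have h3 : 1 * ery (f t) k' r' v₀ ≤ ζ t * ery (f t) k' r' v₀ :=
      mul_le_mul_of_nonneg_right (hζ1 t ht.1) (ery_nonneg _ _ _ _)
    have h4 : 0 ≤ erc * lam * ∫ x in t0..t, ζ x * erP (f x) k' r' v₀ := by positivity
    linarith
  · have h1 := main b (by linarith) le_rfl
    have i1 : IntervalIntegrable (fun x => ζ x * erP (f x) k' r' v₀) volume t0 b :=
      ContinuousOn.intervalIntegrable_of_Icc (by linarith) hzPc
    have i2 : IntervalIntegrable (fun x => ζ x * erP (f x) k' r' v₀) volume t1 b :=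
      ContinuousOn.intervalIntegrable_of_Icc (by linarith) (hzPc.mono (Set.Icc_subset_Icc_left (by linarith)))
    have i3 : IntervalIntegrable (fun x => erP (f x) k' r' v₀) volume t1 b :=
      ContinuousOn.intervalIntegrable_of_Icc (by linarith) (hPc'.mono (Set.Icc_subset_Icc_left (by linarith)))
    have i4 : IntervalIntegrable (fun x => ζ x * erP (f x) k' r' v₀) volume t0 t1 :=
      ContinuousOn.intervalIntegrable_of_Icc (by linarith) (hzPc.mono (Set.Icc_subset_Icc_right (by linarith)))
    have h2 := intervalIntegral.integral_add_adjacent_intervals i4 i2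
    have h3 : 0 ≤ ∫ x in t0..t1, ζ x * erP (f x) k' r' v₀ :=
      intervalIntegral.integral_nonneg (by linarith) fun x hx => mul_nonneg (hζ0 x hx.1) (hP0 x _ _)
    have h4 : (∫ x in t1..b, erP (f x) k' r' v₀) ≤ ∫ x in t1..b, ζ x * erP (f x) k' r' v₀ := by
      refine intervalIntegral.integral_mono_on (by linarith) i3 i2 fun x hx => ?_
      exact le_mul_of_one_le_left (hP0 x _ _) (hζ1 x hx.1)
    have h5 : 0 ≤ ζ b * ery (f b) k' r' v₀ := mul_nonneg (hζ0 _ (by linarith)) (ery_nonneg _ _ _ _)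
    set I := ∫ x in t1..b, erP (f x) k' r' v₀
    rw [le_div_iff₀ hc]
    have h6 : erc * lam * I ≤ D * (W ^ 5 / lam) := by
      refine le_trans ?_ ((le_add_of_nonneg_left h5).trans h1)
      gcongr
      linarith
    linarith

def erD : ℝ := 2 ^ 66 * (1 + 1 / erc) * erC4 + 1
def erw : ℝ := 1 / erD
def erC5 : ℝ := (1 + erC3 / erw ^ 3) ^ 2
theorem erD_pos : 1 < erD := by
  have := erc_pos; have := erC4_pos; unfold erD
  have : 0 < 2 ^ 66 * (1 + 1 / erc) * erC4 := by positivity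
  linarith
theorem erw_pos : 0 < erw := by have := erD_pos; unfold erw; positivity
theorem erC5_ge : 1 ≤ erC5 := by
  have := erw_pos; have := erC3_pos; unfold erC5
  have : 0 < erC3 / erw ^ 3 := by positivity
  nlinarith

theorem erw_spec : (1 + 1 / erc) * erC4 * erw ^ 2 * 2 ^ 66 ≤ 1 := by
  have h1 := erD_pos
  have hc := erc_pos; have hC := erC4_pos
  have h2 : (1 + 1 / erc) * erC4 * 2 ^ 66 ≤ erD := by unfold erD; linarith
  unfold erw
  calc (1 + 1 / erc) * erC4 * (1 / erD) ^ 2 * 2 ^ 66 = ((1 + 1 / erc) * erC4 * 2 ^ 66) * (1 / erD) ^ 2 := by ring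
    _ ≤ erD * (1 / erD) ^ 2 := by gcongr
    _ = 1 / erD := by field_simp
    _ ≤ 1 := by rw [div_le_one (by linarith)]; exact h1.le

theorem er_iter {T : ℝ} {f : ℝ → V3 → ℝ} (hf : SmoothRapidSolutionOn (Set.Icc 0 T) f)
    (hm : ∀ t ∈ Set.Icc (0:ℝ) T, ∫ v, f t v = 1) (v₀ : V3) {lam : ℝ} (hlam : 0 < lam) (hlam1 : lam ≤ 1)
    (hge : ∀ t ∈ Set.Icc (0:ℝ) T, ∀ v, ‖v - v₀‖ ≤ 1 → matGE lam (Amat (f t) v))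
    {e K L M S : ℝ} (he : 0 < e) (he0 : e ≤ ere0) (hK : 0 ≤ K) (hKL : K + 1 ≤ L)
    (hH : ∀ t ∈ Set.Ioo (0:ℝ) T, ∫ v in erBall v₀, erg (f t) K v ^ ((3:ℝ)/2) ≤ √(e * lam) ^ 3)
    {a : ℝ} (ha : 0 ≤ a) (hb : a + 1 / L ≤ T) (hM : M = erC5 * (K + 1 + e * L)) (hS : S = √(M ^ ((5:ℝ)/3) * (e * lam)))
    (n : ℕ) : ∀ s : ℝ, s = (1 / 2) ^ n →
    (∀ t ∈ Set.Icc (a + 1 / L * (1 - s / 2)) (a + 1 / L), ery (f t) (K + M * (1 - s)) (√(1 / 2 + s / 2)) v₀ ≤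
        (S * erw * s ^ 22) ^ 3) ∧
      lam * (∫ t in (a + 1 / L * (1 - s / 2))..(a + 1 / L), erP (f t) (K + M * (1 - s)) (√(1 / 2 + s / 2)) v₀) ≤
        (S * erw * s ^ 22) ^ 3 := by
  have hw := erw_pos
  have hC3 := erC3_pos
  have hC1 := erC5_ge
  have hc := erc_pos
  have hC4 := erC4_pos
  have hL0 : 0 < L := by linarith
  have heL : 0 < e * L := by positivity
  have hMge : K + 1 + e * L ≤ M := by rw [hM]; exact le_mul_of_one_le_left (by linarith) hC1
  have hM0 : 0 < M := by linarith
  have hMp : 0 < M ^ ((5:ℝ)/3) := rpow_pos_of_pos hM0 _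
  have hel : 0 < e * lam := by positivity
  have hS0 : 0 < S := by rw [hS]; positivity
  have hS2 : S ^ 2 = M ^ ((5:ℝ)/3) * (e * lam) := by rw [hS, sq_sqrt (by positivity)]
  have he1 : e ≤ 1 := he0.trans (min_le_left _ _)
  induction n with
  | zero =>
    intro s hs
    simp only [pow_zero] at hs
    subst hs
    have hS3 : S ^ 3 = √M ^ 5 * √(e * lam) ^ 3 := by
      have h1 : S = √(M ^ ((5:ℝ)/3)) * √(e * lam) := by rw [hS, sqrt_mul hMp.le]
      rw [h1, mul_pow]
      congr 1
      rw [sqrt_eq_rpow, sqrt_eq_rpow, ← rpow_mul hM0.le, ← rpow_natCast, ← rpow_natCast, ← rpow_mul hM0.le,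
        ← rpow_mul hM0.le]
      norm_num
    have B : erC3 * √(K + 1 + e * L) ^ 5 * √(e * lam) ^ 3 ≤ (S * erw * 1 ^ 22) ^ 3 := by
      have h1 : √M = (1 + erC3 / erw ^ 3) * √(K + 1 + e * L) := by
        rw [hM, sqrt_mul (by linarith)]; unfold erC5; rw [sqrt_sq (by positivity)]
      have q0 : 0 < erC3 / erw ^ 3 := by positivity
      have h2 : erC3 / erw ^ 3 ≤ (1 + erC3 / erw ^ 3) ^ 5 :=
        le_trans (by linarith) (le_self_pow₀ (by linarith) (by norm_num))
      have h3 : erC3 ≤ (1 + erC3 / erw ^ 3) ^ 5 * erw ^ 3 := by rwa [div_le_iff₀ (by positivity)] at h2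
      calc erC3 * √(K + 1 + e * L) ^ 5 * √(e * lam) ^ 3
          ≤ ((1 + erC3 / erw ^ 3) ^ 5 * erw ^ 3) * √(K + 1 + e * L) ^ 5 * √(e * lam) ^ 3 := by gcongr
        _ = (√M ^ 5 * √(e * lam) ^ 3) * erw ^ 3 := by rw [h1]; ring
        _ = _ := by rw [← hS3]; ring
    have St := er_stage1 hf hm v₀ hlam hlam1 hge he he0 hK hKL hH ha hb
    have e1 : a + 1 / L * (1 - 1 / 2) = a + 1 / L / 2 := by ring
    have e2 : K + M * (1 - 1) = K := by ring
    have e3 : √(1 / 2 + 1 / 2 : ℝ) = 1 := by norm_num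
    rw [e1, e2, e3]
    exact ⟨fun t ht => (St.1 t ht).trans B, St.2.trans B⟩
  | succ n ih =>
    intro s' hs'
    obtain ⟨I1, I2⟩ := ih _ rfl
    set s : ℝ := (1 / 2) ^ n with hs
    have hs0 : 0 < s := by positivity
    have hs1 : s ≤ 1 := pow_le_one₀ (by norm_num) (by norm_num)
    have hss : s' = s / 2 := by rw [hs', hs, pow_succ]; ring
    have hW : 0 ≤ S * erw * s ^ 22 := by positivity
    have St := er_step hf hm v₀ hlam hlam1 hge hs0 hs1 he he1 (show 1 ≤ M by linarith) hK (by linarith)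
      (by linarith) hL0 rfl rfl rfl rfl ha hb hW I1 I2
    have X0 : erC4 / (s ^ 44 * e * M ^ ((5:ℝ)/3)) * ((S * erw * s ^ 22) ^ 5 / lam) =
        erC4 * erw ^ 2 * 2 ^ 66 * (S * erw * s' ^ 22) ^ 3 := by
      have : (S * erw * s ^ 22) ^ 5 = (M ^ ((5:ℝ)/3) * (e * lam)) * S ^ 3 * erw ^ 5 * s ^ 110 := by
        rw [← hS2]; ring
      rw [this, hss]
      field_simp
    have hp : 0 < (S * erw * s' ^ 22) ^ 3 := by rw [hss]; positivity
    have sp := erw_spec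
    have q1 : erC4 * erw ^ 2 * 2 ^ 66 ≤ 1 := by
      have : 0 ≤ 1 / erc * (erC4 * erw ^ 2 * 2 ^ 66) := by positivity
      linarith
    have q2 : erC4 * erw ^ 2 * 2 ^ 66 / erc ≤ 1 := by
      have : 0 ≤ (erC4 * erw ^ 2 * 2 ^ 66) := by positivity
      rw [div_eq_mul_one_div]
      linarith
    rw [X0] at St
    have e1 : s' / 2 = s / 4 := by rw [hss]; ring
    rw [e1]
    have St1 : _ ∧ _ := St
    rw [← hss] at St1
    refine ⟨fun t ht => (St1.1 t ht).trans ?_, St1.2.trans ?_⟩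
    · exact mul_le_of_le_one_left hp.le q1
    · rw [mul_div_right_comm]; exact mul_le_of_le_one_left hp.le q2

theorem er_local {T : ℝ} {f : ℝ → V3 → ℝ} (hf : SmoothRapidSolutionOn (Set.Icc 0 T) f)
    (hm : ∀ t ∈ Set.Icc (0:ℝ) T, ∫ v, f t v = 1) (v₀ : V3) {lam : ℝ} (hlam : 0 < lam) (hlam1 : lam ≤ 1)
    (hge : ∀ t ∈ Set.Icc (0:ℝ) T, ∀ v, ‖v - v₀‖ ≤ 1 → matGE lam (Amat (f t) v))
    {e K L : ℝ} (he : 0 < e) (he0 : e ≤ ere0) (hK : 0 ≤ K) (hKL : K + 1 ≤ L)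
    (hH : ∀ t ∈ Set.Ioo (0:ℝ) T, ∫ v in erBall v₀, erg (f t) K v ^ ((3:ℝ)/2) ≤ √(e * lam) ^ 3)
    {a : ℝ} (ha : 0 ≤ a) (hb : a + 1 / L ≤ T) :
    f (a + 1 / L) v₀ ≤ K + erC5 * (K + 1 + e * L) := by
  have hL0 : 0 < L := by linarith
  have hl : 0 < 1 / L := by positivity
  set b := a + 1 / L with hbd
  set M := erC5 * (K + 1 + e * L) with hM
  set S := √(M ^ ((5:ℝ)/3) * (e * lam)) with hS
  have heL : 0 < e * L := by positivity
  have hM0 : 0 ≤ M := mul_nonneg (by linarith [erC5_ge]) (by linarith)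
  have hfc : Continuous (f b) := er_slice_cont hf ⟨by linarith, hb⟩
  have hgc : ∀ k, Continuous (erg (f b) k) := fun k => erg_cont hfc k
  have hpc : ∀ r, Continuous (erφ r v₀) := fun r => erφ_cont r v₀
  have bound : ∀ n : ℕ, ery (f b) (K + M) (√(1 / 2)) v₀ ≤ (S * erw * ((1/2) ^ n) ^ 22) ^ 3 := by
    intro n
    have h := (er_iter hf hm v₀ hlam hlam1 hge he he0 hK hKL hH ha hb hM hS n _ rfl).1 b
      ⟨by
        have : 0 ≤ 1 / L * ((1 / 2) ^ n / 2) := by positivity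
        rw [hbd]; linarith, le_rfl⟩
    refine le_trans ?_ h
    set s : ℝ := (1 / 2) ^ n
    have hs : 0 < s := by positivity
    have i1 : ∀ k r : ℝ, 0 ≤ r → Integrable (fun v => erφ r v₀ v ^ 24 * erg (f b) k v ^ 4) := fun k r hr =>
      er_cs_int (a := 23) r hr v₀ ((hgc k).pow 4)
    unfold ery
    refine integral_mono (i1 _ _ (by positivity)) (i1 _ _ (by positivity)) fun v => ?_
    have m1 : erφ (√(1/2)) v₀ v ≤ erφ (√(1/2 + s/2)) v₀ v := by
      unfold erφ
      rw [sq_sqrt (by positivity), sq_sqrt (by positivity)]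
      exact max_le_max (by linarith) le_rfl
    have m2 : erg (f b) (K + M) v ≤ erg (f b) (K + M * (1 - s)) v := by
      unfold erg
      have : 0 ≤ M * s := by positivity
      exact max_le_max (by linarith) le_rfl
    have n1 := erφ_nonneg (√(1/2)) v₀ v
    have n2 := erφ_nonneg (√(1/2 + s/2)) v₀ v
    have n3 := erg_nonneg (f b) (K + M) v
    simp only
    gcongr
  have lim : Filter.Tendsto (fun n : ℕ => (S * erw * ((1/2 : ℝ) ^ n) ^ 22) ^ 3) Filter.atTop (nhds 0) := by
    have h1 : Filter.Tendsto (fun n : ℕ => (1/2 : ℝ) ^ n) Filter.atTop (nhds 0) :=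
      tendsto_pow_atTop_nhds_zero_of_lt_one (by norm_num) (by norm_num)
    have h2 := (((h1.pow 22).const_mul (S * erw)).pow 3)
    simpa using h2
  have y0 : ery (f b) (K + M) (√(1 / 2)) v₀ ≤ 0 := ge_of_tendsto' lim bound
  by_contra hcon
  push Not at hcon
  have pos : 0 < ery (f b) (K + M) (√(1 / 2)) v₀ := by
    unfold ery
    refine Continuous.integral_pos_of_hasCompactSupport_nonneg_nonzero (x := v₀)
      (f := fun v => erφ (√(1/2)) v₀ v ^ 24 * erg (f b) (K + M) v ^ 4) ?_ ?_ ?_ ?_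
    · exact ((hpc _).pow 24).mul ((hgc _).pow 4)
    · exact er_cs (a := 23) _ (by positivity) v₀ _
    · intro v
      exact mul_nonneg (pow_nonneg (erφ_nonneg _ v₀ v) 24) (pow_nonneg (erg_nonneg _ _ v) 4)
    · have a1 : erφ (√(1/2)) v₀ v₀ = 1/2 := by
        unfold erφ; rw [sq_sqrt (by positivity)]; norm_num
      have a2 : 0 < erg (f b) (K + M) v₀ := lt_max_of_lt_left (by linarith)
      rw [a1]; positivity
  linarith


theorem er_jap_pos (v : V3) : 0 < jap v := by unfold jap; positivity

theorem er_jap_cont : Continuous jap := by unfold jap; fun_prop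

theorem er_jap_two {v w : V3} (h : ‖v - w‖ ≤ 1) : jap v ≤ 2 * jap w := by
  unfold jap
  have h1 : ‖v‖ ≤ ‖w‖ + 1 := by
    have := norm_add_le (v - w) w
    rw [sub_add_cancel] at this
    linarith
  have h2 : (2 : ℝ) = √(2 ^ 2) := by rw [sqrt_sq (by norm_num)]
  rw [h2, ← sqrt_mul (by norm_num)]
  apply sqrt_le_sqrt
  nlinarith [norm_nonneg v, norm_nonneg w, sq_nonneg (‖w‖ - 1)]

theorem er_jap_le (v : V3) : jap v ≤ 1 + ‖v‖ := by
  unfold jap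
  rw [sqrt_le_left (by positivity)]
  nlinarith [norm_nonneg v]

theorem er_wint {T : ℝ} {f : ℝ → V3 → ℝ} (hf : SmoothRapidSolutionOn (Set.Icc 0 T) f) {t : ℝ}
    (ht : t ∈ Set.Icc 0 T) {K : ℝ} (hK : 0 ≤ K) :
    Integrable (fun v => jap v ^ ((9:ℝ)/2) * erg (f t) K v ^ ((3:ℝ)/2)) := by
  obtain ⟨φ, hφ⟩ := hf.schwartz t ht
  have h := fun x => SchwartzMap.one_add_le_sup_seminorm_apply (𝕜 := ℝ) (m := (6, 0)) (k := 6) (n := 0)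
    le_rfl le_rfl φ x
  set C := 2 ^ 6 * ((Finset.Iic ((6, 0) : ℕ × ℕ)).sup fun m => SchwartzMap.seminorm ℝ m.1 m.2) φ
  have hC : 0 ≤ C := by positivity
  have hI := integrable_one_add_norm (E := V3) (μ := volume) (r := 9/2) (by simp; norm_num)
  have hc : Continuous (fun v => jap v ^ ((9:ℝ)/2) * erg (f t) K v ^ ((3:ℝ)/2)) := by
    refine Continuous.mul ?_ ?_
    · exact er_jap_cont.rpow_const fun v => Or.inr (by norm_num)
    · exact (erg_cont (er_slice_cont hf ht) K).rpow_const fun v => Or.inr (by norm_num)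
  refine (hI.const_mul (C ^ ((3:ℝ)/2))).mono' hc.aestronglyMeasurable (Filter.Eventually.of_forall fun v => ?_)
  have hn : 0 < 1 + ‖v‖ := by positivity
  have g0 := erg_nonneg (f t) K v
  have g1 : erg (f t) K v ≤ C * (1 + ‖v‖) ^ (-(6:ℝ)) := by
    have h1 := h v
    simp only [norm_iteratedFDeriv_zero] at h1
    rw [← hφ v] at h1
    have h2 : erg (f t) K v ≤ ‖f t v‖ := by
      unfold erg
      exact max_le (by have := le_abs_self (f t v); rw [Real.norm_eq_abs]; linarith) (norm_nonneg _)
    rw [rpow_neg hn.le, ← div_eq_mul_inv, le_div_iff₀ (by positivity)]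
    have h3 : (1 + ‖v‖) ^ (6:ℝ) = (1 + ‖v‖) ^ 6 := by rw [← rpow_natCast]; norm_num
    rw [h3]
    have := mul_le_mul_of_nonneg_right h2 (show 0 ≤ (1 + ‖v‖) ^ 6 by positivity)
    linarith
  have j0 := er_jap_pos v
  rw [Real.norm_of_nonneg (by positivity)]
  calc jap v ^ ((9:ℝ)/2) * erg (f t) K v ^ ((3:ℝ)/2)
      ≤ (1 + ‖v‖) ^ ((9:ℝ)/2) * (C * (1 + ‖v‖) ^ (-(6:ℝ))) ^ ((3:ℝ)/2) := by
        gcongr; exact er_jap_le v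
    _ = C ^ ((3:ℝ)/2) * (1 + ‖v‖) ^ (-(9/2:ℝ)) := by
        rw [mul_rpow hC (by positivity), ← rpow_mul hn.le, mul_left_comm, ← rpow_add hn]
        norm_num

theorem er_ball_bound {T : ℝ} {f : ℝ → V3 → ℝ} (hf : SmoothRapidSolutionOn (Set.Icc 0 T) f) {t : ℝ}
    (ht : t ∈ Set.Icc 0 T) {K E : ℝ} (hK : 0 ≤ K) (v₀ : V3)
    (hE : ∫ v, jap v ^ ((9:ℝ)/2) * erg (f t) K v ^ ((3:ℝ)/2) ≤ E) :
    √(jap v₀ / 2) ^ 9 * (∫ v in erBall v₀, erg (f t) K v ^ ((3:ℝ)/2)) ≤ E := by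
  have hI := er_wint hf ht hK
  have j0 := er_jap_pos v₀
  have hn : ∀ v, 0 ≤ jap v ^ ((9:ℝ)/2) * erg (f t) K v ^ ((3:ℝ)/2) := fun v =>
    mul_nonneg (rpow_nonneg (er_jap_pos v).le _) (rpow_nonneg (erg_nonneg _ _ _) _)
  refine le_trans ?_ hE
  refine le_trans ?_ (setIntegral_le_integral (s := erBall v₀) hI (Filter.Eventually.of_forall hn))
  rw [← integral_const_mul]
  have gi : IntegrableOn (fun v => erg (f t) K v ^ ((3:ℝ)/2)) (erBall v₀) := by
    refine ContinuousOn.integrableOn_compact (isCompact_closedBall v₀ 1) (Continuous.continuousOn ?_)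
    exact (erg_cont (er_slice_cont hf ht) K).rpow_const fun v => Or.inr (by norm_num)
  refine setIntegral_mono_on (gi.const_mul _) hI.integrableOn Metric.isClosed_closedBall.measurableSet fun v hv => ?_
  refine mul_le_mul_of_nonneg_right ?_ (rpow_nonneg (erg_nonneg _ _ _) _)
  have e1 : √(jap v₀ / 2) ^ 9 = (jap v₀ / 2) ^ ((9:ℝ)/2) := by
    rw [sqrt_eq_rpow, ← rpow_natCast, ← rpow_mul (by positivity)]; norm_num
  rw [e1]
  refine rpow_le_rpow (by positivity) ?_ (by norm_num)
  have : jap v₀ ≤ 2 * jap v := er_jap_two (by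
    rw [← dist_eq_norm, dist_comm]; exact Metric.mem_closedBall.1 hv)
  linarith

theorem er_global {c' : ℝ} (hc' : 0 < c') (hc1 : c' ≤ 1) {T : ℝ} {f : ℝ → V3 → ℝ}
    (hf : SmoothRapidSolutionOn (Set.Icc 0 T) f)
    (hm : ∀ t ∈ Set.Icc (0:ℝ) T, ∫ v, f t v = 1)
    (hA : ∀ t ∈ Set.Icc (0 : ℝ) T, ∀ v : V3, matGE (c' * jap v ^ (-(3 : ℝ))) (Amat (f t) v))
    {K E y : ℝ} (hK : 0 ≤ K) (hy : 0 < y) (hEy : E ≤ y ^ 3) (hye : 64 * y ^ 2 / c' ≤ ere0)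
    (hE : ∀ t ∈ Set.Ioo (0 : ℝ) T, ∫ v, jap v ^ ((9:ℝ)/2) * erg (f t) K v ^ ((3:ℝ)/2) ≤ E)
    {t τ : ℝ} (ht : 0 < t) (hτ : τ ∈ Set.Icc t T) (v₀ : V3) :
    f τ v₀ ≤ K + erC5 * (K + 1 + 64 * y ^ 2 / c' * (K + 1 + 1 / t)) := by
  have j0 := er_jap_pos v₀
  have j1 : 1 ≤ jap v₀ := by
    unfold jap; rw [one_le_sqrt]; nlinarith [norm_nonneg v₀]
  set R := jap v₀ with hR
  set lam := c' / (2 * R) ^ 3 with hlamd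
  have hlam : 0 < lam := by positivity
  have hlam1 : lam ≤ 1 := by
    rw [hlamd, div_le_one (by positivity)]
    refine hc1.trans (one_le_pow₀ (by linarith))
  have hge : ∀ t ∈ Set.Icc (0:ℝ) T, ∀ v, ‖v - v₀‖ ≤ 1 → matGE lam (Amat (f t) v) := by
    intro t ht v hv ξ
    refine le_trans ?_ (hA t ht v ξ)
    refine mul_le_mul_of_nonneg_right ?_ (Finset.sum_nonneg fun i _ => sq_nonneg _)
    have jv := er_jap_pos v
    have e1 : jap v ^ (-(3:ℝ)) = (jap v ^ 3)⁻¹ := by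
      rw [rpow_neg jv.le]; congr 1; rw [← rpow_natCast]; norm_num
    rw [e1, hlamd, div_eq_mul_inv]
    have := er_jap_two hv
    gcongr
  set e := 64 * y ^ 2 / c' with hed
  have he : 0 < e := by positivity
  set q := √(R / 2) with hq
  have hq0 : 0 < q := by positivity
  have hq2 : q ^ 2 = R / 2 := by rw [hq, sq_sqrt (by positivity)]
  have hel : √(e * lam) = y / q ^ 3 := by
    have : e * lam = (y / q ^ 3) ^ 2 := by
      have hR2 : R = 2 * q ^ 2 := by linarith
      rw [hed, hlamd, hR2]
      field_simp
      norm_num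
    rw [this, sqrt_sq (by positivity)]
  have hH : ∀ t ∈ Set.Ioo (0:ℝ) T, ∫ v in erBall v₀, erg (f t) K v ^ ((3:ℝ)/2) ≤ √(e * lam) ^ 3 := by
    intro t ht
    have h := er_ball_bound hf ⟨ht.1.le, ht.2.le⟩ hK v₀ (hE t ht)
    rw [hel]
    have : (y / q ^ 3) ^ 3 = y ^ 3 / q ^ 9 := by rw [div_pow]; ring
    rw [this, le_div_iff₀ (by positivity)]
    rw [← hR, ← hq] at h
    linarith
  have hti : 0 < 1 / t := by positivity
  set L := K + 1 + 1 / t with hL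
  have hL0 : 0 < L := by linarith
  have hLt : 1 / L ≤ t := by
    rw [div_le_iff₀ hL0, hL]
    have : t * (1 / t) = 1 := by field_simp
    nlinarith
  have ha : 0 ≤ τ - 1 / L := by linarith [hτ.1]
  have hb : (τ - 1 / L) + 1 / L ≤ T := by linarith [hτ.2]
  have F := er_local hf hm v₀ hlam hlam1 hge he hye hK (show K + 1 ≤ L by linarith) hH ha hb
  rwa [sub_add_cancel] at F

/-- ε-regularity criterion.  Here `E` is any upper bound for the quantity
`ε(f) = sup_{0<τ<T} ∫ ⟨v⟩^{9/2}(f-K)₊^{3/2} + ∫∫ ⟨v⟩^{3/2}|∇(f-K)₊^{3/4}|²`. -/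
theorem eps_regularity_criterion
    (c₀ : ℝ) (hc₀ : 0 < c₀) :
    ∃ ε₀ Cstar : ℝ, 0 < ε₀ ∧ 0 < Cstar ∧
      ∀ T : ℝ, 0 < T →
      ∀ f : ℝ → V3 → ℝ, SmoothRapidSolutionOn (Set.Icc 0 T) f →
        (∀ t ∈ Set.Icc (0 : ℝ) T, Normalized (f t)) →
        (∀ t ∈ Set.Icc (0 : ℝ) T, ∀ v : V3,
          matGE (c₀ * jap v ^ (-(3 : ℝ))) (Amat (f t) v)) →
        ∀ K : ℝ, 0 ≤ K →
        ∀ E : ℝ,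
          (∀ τ ∈ Set.Ioo (0 : ℝ) T,
            (∫ v : V3, jap v ^ ((9 : ℝ) / 2) * plus (f τ v - K) ^ ((3 : ℝ) / 2)) +
              (∫ t in Set.Ioo (0 : ℝ) T, ∫ v : V3, jap v ^ ((3 : ℝ) / 2) *
                ‖gradient (fun u => plus (f t u - K) ^ ((3 : ℝ) / 4)) v‖ ^ 2) ≤ E) →
          E < ε₀ →
          ∀ t : ℝ, 0 < t → t ≤ T →
            ∀ τ ∈ Set.Icc t T, ∀ v : V3,
              f τ v ≤ Cstar * (K + 1) + Cstar * E ^ ((2 : ℝ) / 3) / t := by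
  have hC := erC5_ge
  have he0 := ere0_pos
  set c' := min c₀ 1 with hc'
  have hc0 : 0 < c' := lt_min hc₀ one_pos
  have hc1 : c' ≤ 1 := min_le_right _ _
  set y0 := √(c' * ere0 / 64) with hy0
  have hy0p : 0 < y0 := by positivity
  have hy02 : 64 * y0 ^ 2 / c' = ere0 := by
    rw [hy0, sq_sqrt (by positivity)]; field_simp
  refine ⟨y0 ^ 3, 1 + 2 * erC5 + 64 * erC5 / c', by positivity, by positivity, ?_⟩
  intro T hT f hf hN hA K hK E hE hEε t ht htT τ hτ v₀
  have dn : 0 ≤ (∫ t in Set.Ioo (0 : ℝ) T, ∫ v : V3, jap v ^ ((3 : ℝ) / 2) *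
                ‖gradient (fun u => plus (f t u - K) ^ ((3 : ℝ) / 4)) v‖ ^ 2) :=
    integral_nonneg fun t => integral_nonneg fun v =>
      mul_nonneg (rpow_nonneg (er_jap_pos v).le _) (sq_nonneg _)
  have hE' : ∀ t ∈ Set.Ioo (0 : ℝ) T, ∫ v, jap v ^ ((9:ℝ)/2) * erg (f t) K v ^ ((3:ℝ)/2) ≤ E := by
    intro t ht
    have h := hE t ht
    exact le_trans (le_add_of_nonneg_right dn) h
  have hE0 : 0 ≤ E := by
    refine le_trans ?_ (hE' (T / 2) ⟨by linarith, by linarith⟩)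
    exact integral_nonneg fun v =>
      mul_nonneg (rpow_nonneg (er_jap_pos v).le _) (rpow_nonneg (erg_nonneg _ _ _) _)
  have hA' : ∀ t ∈ Set.Icc (0 : ℝ) T, ∀ v : V3, matGE (c' * jap v ^ (-(3 : ℝ))) (Amat (f t) v) := by
    intro t ht v ξ
    refine le_trans ?_ (hA t ht v ξ)
    refine mul_le_mul_of_nonneg_right ?_ (Finset.sum_nonneg fun i _ => sq_nonneg _)
    exact mul_le_mul_of_nonneg_right (min_le_left _ _) (rpow_nonneg (er_jap_pos v).le _)
  set y1 := E ^ ((1:ℝ)/3) with hy1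
  have hy1n : 0 ≤ y1 := rpow_nonneg hE0 _
  have hy13 : y1 ^ 3 = E := by rw [hy1, ← rpow_natCast, ← rpow_mul hE0]; norm_num
  have hy12 : y1 ^ 2 = E ^ ((2:ℝ)/3) := by rw [hy1, ← rpow_natCast, ← rpow_mul hE0]; norm_num
  have hlt : y1 < y0 := by
    refine lt_of_pow_lt_pow_left₀ 3 hy0p.le ?_
    rw [hy13]; exact hEε
  have hy1e : 64 * y1 ^ 2 / c' ≤ 1 := by
    calc 64 * y1 ^ 2 / c' ≤ 64 * y0 ^ 2 / c' := by gcongr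
      _ = ere0 := hy02
      _ ≤ 1 := min_le_left _ _
  have hev : ∀ᶠ y in nhdsWithin y1 (Set.Ioi y1),
      f τ v₀ ≤ K + erC5 * (K + 1 + 64 * y ^ 2 / c' * (K + 1 + 1 / t)) := by
    filter_upwards [Ioo_mem_nhdsGT hlt] with y hy
    have hyp : 0 < y := lt_of_le_of_lt hy1n hy.1
    refine er_global hc0 hc1 hf (fun t ht => (hN t ht).1) hA' hK hyp ?_ ?_ hE' ht hτ v₀
    · rw [← hy13]; exact pow_le_pow_left₀ hy1n hy.1.le 3
    · rw [← hy02]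
      have := hy.2.le
      gcongr
  have hcont : Continuous (fun y : ℝ => K + erC5 * (K + 1 + 64 * y ^ 2 / c' * (K + 1 + 1 / t))) := by
    fun_prop
  have key : f τ v₀ ≤ K + erC5 * (K + 1 + 64 * y1 ^ 2 / c' * (K + 1 + 1 / t)) :=
    ge_of_tendsto (hcont.continuousAt.tendsto.mono_left nhdsWithin_le_nhds) hev
  refine key.trans ?_
  rw [← hy12]
  have hx : 0 ≤ y1 ^ 2 / t := by positivity
  calc K + erC5 * (K + 1 + 64 * y1 ^ 2 / c' * (K + 1 + 1 / t))
      = K + erC5 * (K + 1 + 64 * y1 ^ 2 / c' * (K + 1)) + 64 * erC5 / c' * (y1 ^ 2 / t) := by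
        field_simp
        ring
    _ ≤ K + erC5 * (K + 1 + 1 * (K + 1)) + 64 * erC5 / c' * (y1 ^ 2 / t) := by gcongr
    _ ≤ (1 + 2 * erC5 + 64 * erC5 / c') * (K + 1) + (1 + 2 * erC5 + 64 * erC5 / c') * (y1 ^ 2 / t) := by
        have q : 0 ≤ 64 * erC5 / c' * (K + 1) := by positivity
        have q2 : 0 ≤ (1 + 2 * erC5) * (y1 ^ 2 / t) := by positivity
        linarith
    _ = _ := by ring
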